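/- arXiv:2111.13200 — 2 statements merged into one kernel-verified Lean document; each statement's English description precedes it below -/
import Mathlib

section
/- Let κ be a kernel on S, μ a probability vector on S with μ_r > 0 for all r, and c ∈ [0,∞)^S with c ≤ μ componentwise and Σ(κ,c) > 1. Let b* be the pointwise-smallest solution of the fixed-point system for c; then b* ≠ c, Σ(κ,b*) = 1, and inf{ I_Mi(λ) : λ : ℕ₀^S → [0,∞), λ_0 = 0, c(λ) = c } = inf{ I_Mi(λ) : λ : ℕ₀^S → [0,∞), λ_0 = 0, c(λ) = b* } + I_Me(c − b*). -/
open scoped Classical ENNReal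
open Filter MeasureTheory

noncomputable section

/-- The set of ordered pairs `(i,j)` of vertices with `i < j`, representing the
potential edges of a graph on `Fin n`. -/
def upperPairs (n : ℕ) : Finset (Fin n × Fin n) :=
  Finset.univ.filter fun q => q.1 < q.2

/-- The simple graph on `Fin n` determined by a finite set of (ordered) edges. -/
def graphOf {n : ℕ} (E : Finset (Fin n × Fin n)) : SimpleGraph (Fin n) :=
  SimpleGraph.fromRel fun i j => (i, j) ∈ E

/-- `PConn n x p` is the probability that the inhomogeneous random graph `G(n, x, p)`,
with type vector `x` and independent edges where `{i,j}` is present with probability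
`p (x i) (x j)`, is connected; written as a finite sum over connected graphs. -/
def PConn {S : Type*} (n : ℕ) (x : Fin n → S) (p : S → S → ℝ) : ℝ :=
  ∑ E ∈ (upperPairs n).powerset.filter (fun E => (graphOf E).Connected),
    (∏ q ∈ E, p (x q.1) (x q.2)) * ∏ q ∈ upperPairs n \ E, (1 - p (x q.1) (x q.2))

/-- Sum over all spanning trees (connected graphs with `n - 1` edges) on `Fin n` of the
product of the kernel over the edges. -/
def treeWeight {S : Type*} (n : ℕ) (x : Fin n → S) (κ : S → S → ℝ) : ℝ :=
  ∑ E ∈ (upperPairs n).powerset.filter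
      (fun E => (graphOf E).Connected ∧ E.card + 1 = n),
    ∏ q ∈ E, κ (x q.1) (x q.2)

/-- A canonical list of types compatible with the multiplicity vector `k`. -/
def compatList {S : Type*} [Fintype S] (k : S → ℕ) : List S :=
  (∑ s : S, (k s) • ({s} : Multiset S)).toList

lemma compatList_length {S : Type*} [Fintype S] (k : S → ℕ) :
    (compatList k).length = ∑ s : S, k s := by
  simp [compatList]

/-- A canonical type vector compatible with `k`, i.e. with `∑ i δ_{x i} = k`. -/
def compatVec {S : Type*} [Fintype S] (k : S → ℕ) : Fin (∑ s : S, k s) → S :=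
  fun i => (compatList k).get (Fin.cast (compatList_length k).symm i)

/-- `tau κ k` is the spanning-tree weight `τ(k; κ)`. -/
def tau {S : Type*} [Fintype S] (κ : S → S → ℝ) (k : S → ℕ) : ℝ :=
  treeWeight (∑ s : S, k s) (compatVec k) κ

/-- `pN κN N k` is the probability that the inhomogeneous random graph on a vertex set
with type composition `k` and edge probabilities `min 1 (κN/N)` is connected. -/
def pN {S : Type*} [Fintype S] (κN : S → S → ℝ) (N : ℕ) (k : S → ℕ) : ℝ :=
  PConn (∑ s : S, k s) (compatVec k) fun r s => min 1 (κN r s / N)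

/-- Extended-real logarithm, with `elog x = -∞` for `x ≤ 0`. -/
def elog (x : ℝ) : EReal := if x ≤ 0 then (⊥ : EReal) else ((Real.log x : ℝ) : EReal)

/-- The nonnegative part of `-log u`, equal to `∞` if `u ≤ 0`. -/
def negLogPart (u : ℝ) : ℝ≥0∞ := if u ≤ 0 then ⊤ else ENNReal.ofReal (-Real.log u)

/-- The relative-entropy summand `x log (x / d)` with conventions `0 log 0 = 0` and
`x log (x/0) = +∞` for `x ≠ 0`. -/
def entTerm (x d : ℝ) : EReal :=
  if x = 0 then (0 : EReal) else if d ≤ 0 then (⊤ : EReal)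
  else ((x * Real.log (x / d) : ℝ) : EReal)

/-- `‖κ‖_∞ = max_{r,s} κ r s`. -/
def kernelSup {S : Type*} [Fintype S] [Nonempty S] (κ : S → S → ℝ) : ℝ :=
  Finset.univ.sup' Finset.univ_nonempty fun r =>
    Finset.univ.sup' Finset.univ_nonempty fun s => κ r s

/-- `Σ(κ, ν)`, the `ℓ²(ν)`-operator norm of the matrix `(κ r s * ν s)_{r,s}`. -/
def sigmaOp {S : Type*} [Fintype S] (κ : S → S → ℝ) (ν : S → ℝ) : ℝ :=
  sSup { t : ℝ | ∃ f : S → ℝ, (∀ s, 0 ≤ f s) ∧ (∑ r : S, ν r * f r ^ 2) ≤ 1 ∧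
    t = Real.sqrt (∑ r : S, ν r * (∑ s : S, κ r s * f s * ν s) ^ 2) }

/-- Irreducibility of the kernel `κ` with respect to `ν`. -/
def Irred {S : Type*} (κ : S → S → ℝ) (ν : S → ℝ) : Prop :=
  ∀ A : Set S, (∀ r ∈ A, ∀ s, s ∉ A → 0 < ν r → 0 < ν s → κ r s = 0) →
    (∀ r ∈ A, ν r = 0) ∨ (∀ s, s ∉ A → ν s = 0)

/-- The generating series `Γ_r(θ) = ∑_k τ(k) k_r ∏_s θ_s^{k_s}/k_s! ∈ [0,∞]`. -/
def Gamma0 {S : Type*} [Fintype S] (κ : S → S → ℝ) (θ : S → ℝ) (r : S) : ℝ≥0∞ :=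
  ∑' k : S → ℕ,
    ENNReal.ofReal (tau κ k * (k r : ℝ) * ∏ s : S, θ s ^ (k s) / (Nat.factorial (k s) : ℝ))

/-- `χ(κ, θ)`: the infimum over probability vectors `w ≪ θ` of
`∑_r w_r log (w_r / ((κ w)_r θ_r))`. -/
def chiFn {S : Type*} [Fintype S] (κ : S → S → ℝ) (θ : S → ℝ) : EReal :=
  sInf { v : EReal | ∃ w : S → ℝ, (∀ r, 0 ≤ w r) ∧ ((∑ r : S, w r) = 1) ∧
    (∀ r, θ r = 0 → w r = 0) ∧
    v = ∑ r : S, entTerm (w r) ((∑ s : S, κ r s * w s) * θ r) }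

/-- `Δ_r(k)`: the sum over directed spanning trees of the support of `k` rooted at `r`
(encoded as parent maps `f`, edges `(f s, s)` directed away from the root) of
`∏ κ(f s, s) * k (f s)`. -/
def Delta {S : Type*} [Fintype S] [DecidableEq S] (κ : S → S → ℝ) (k : S → ℕ) (r : S) : ℝ :=
  ∑ f ∈ (Finset.univ : Finset (S → S)).filter (fun f =>
      (∀ s, (s = r ∨ k s = 0) → f s = s) ∧
      ∀ s, 0 < k s → s ≠ r → (0 < k (f s) ∧ ∃ n, f^[n] s = r)),
    ∏ s ∈ Finset.univ.filter (fun s => 0 < k s ∧ s ≠ r), (κ (f s) s * (k (f s) : ℝ))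

/-- The reference weight `τ(k) ∏_s μ_s^{k_s}/k_s!`. -/
def rhoMu {S : Type*} [Fintype S] (κ : S → S → ℝ) (μ : S → ℝ) (k : S → ℕ) : ℝ :=
  tau κ k * ∏ s : S, μ s ^ (k s) / (Nat.factorial (k s) : ℝ)

/-- The microscopic rate function `I_Mi`. -/
def IMi {S : Type*} [Fintype S] (κ : S → S → ℝ) (μ : S → ℝ) (lam : (S → ℕ) → ℝ) : EReal :=
  (∑' k : S → ℕ, entTerm (lam k) (rhoMu κ μ k))
  + ((∑' k : S → ℕ, lam k * (((∑ s : S, k s : ℕ) : ℝ) - 1) : ℝ) : EReal)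
  + ((((1 : ℝ)/2) * ∑ r : S, ∑ s : S, (∑' k : S → ℕ, lam k * (k r : ℝ)) * κ r s * μ s : ℝ) : EReal)

/-- The minimizer candidate `λ_k(c) = τ(k) ∏_s (c_s e^{-(κ c)_s})^{k_s}/k_s!`. -/
def lamC {S : Type*} [Fintype S] (κ : S → S → ℝ) (c : S → ℝ) (k : S → ℕ) : ℝ :=
  tau κ k * ∏ s : S, (c s * Real.exp (-(∑ t : S, κ s t * c t))) ^ (k s) / (Nat.factorial (k s) : ℝ)

/-- The mesoscopic rate function `I_Me`. -/
def IMe {S : Type*} [Fintype S] (κ : S → S → ℝ) (μ ν : S → ℝ) : EReal :=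
  (∑ r : S, entTerm (ν r) ((∑ s : S, κ r s * ν s) * μ r))
  + ((((1 : ℝ)/2) * ∑ r : S, ∑ s : S, ν r * κ r s * μ s : ℝ) : EReal)

/-- `b` is a solution of the fixed-point system for `c`:
`b ∈ [0,∞)^S`, `b ≤ c` and `(κ(c-b))_r b_r = c_r - b_r` for all `r`. -/
def IsFPSol {S : Type*} [Fintype S] (κ : S → S → ℝ) (c b : S → ℝ) : Prop :=
  (∀ r, 0 ≤ b r) ∧ (∀ r, b r ≤ c r) ∧
    ∀ r, (∑ s : S, κ r s * (c s - b s)) * b r = c r - b r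

/-- The macroscopic rate summand `f_Ma`. -/
def fMa {S : Type*} [Fintype S] (κ : S → S → ℝ) (μ y : S → ℝ) : EReal :=
  (∑ r : S, entTerm (y r) ((1 - Real.exp (-(∑ s : S, κ r s * y s))) * μ r))
  + ((((1 : ℝ)/2) * ∑ r : S, ∑ s : S, y r * κ r s * (μ s - y s) : ℝ) : EReal)

/-- The functional `G_c(b)`. -/
def Gc {S : Type*} [Fintype S] (κ : S → S → ℝ) (μ c b : S → ℝ) : EReal :=
  (((∑ r : S, b r * Real.log (b r / μ r))
      - (1/2) * ∑ r : S, ∑ s : S, b r * κ r s * b s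
      + (1/2) * ∑ r : S, ∑ s : S, c r * κ r s * μ s : ℝ) : EReal)
  + ∑ r : S, entTerm (c r - b r) ((∑ s : S, κ r s * (c s - b s)) * μ r)

/-- `λ_k(t) = t^{|k|-1} τ(k) e^{-t⟨k,κμ⟩} ∏_r μ_r^{k_r}/k_r!`. -/
def lamT {S : Type*} [Fintype S] (κ : S → S → ℝ) (μ : S → ℝ) (k : S → ℕ) (t : ℝ) : ℝ :=
  t ^ ((∑ s : S, k s) - 1) * tau κ k *
    Real.exp (-t * ∑ r : S, ∑ s : S, (k r : ℝ) * κ r s * μ s) *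
    ∏ r : S, μ r ^ (k r) / (Nat.factorial (k r) : ℝ)

/-- Operator norm at most one, in unpacked form. -/
def QBd {S : Type*} [Fintype S] (κ : S → S → ℝ) (b : S → ℝ) : Prop :=
  ∀ f : S → ℝ, (∀ s, 0 ≤ f s) →
    (∑ r : S, b r * (∑ s : S, κ r s * f s * b s) ^ 2) ≤ ∑ r : S, b r * f r ^ 2

lemma QBd.sigmaOp_le {S : Type*} [Fintype S] {κ : S → S → ℝ} {b : S → ℝ} (h : QBd κ b) :
    sigmaOp κ b ≤ 1 := by
  unfold sigmaOp
  apply csSup_le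
  · exact ⟨_, fun _ => 0, by simp, by simp, rfl⟩
  · rintro t ⟨f, hf, h1, rfl⟩
    exact Real.sqrt_le_one.2 ((h f hf).trans h1)

lemma QBd.bddAbove {S : Type*} [Fintype S] {κ : S → S → ℝ} {b : S → ℝ} (h : QBd κ b) :
    BddAbove { t : ℝ | ∃ f : S → ℝ, (∀ s, 0 ≤ f s) ∧ (∑ r : S, b r * f r ^ 2) ≤ 1 ∧
    t = Real.sqrt (∑ r : S, b r * (∑ s : S, κ r s * f s * b s) ^ 2) } := by
  refine ⟨1, ?_⟩
  rintro t ⟨f, hf, h1, rfl⟩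
  exact Real.sqrt_le_one.2 ((h f hf).trans h1)

lemma QBd.schur {S : Type*} [Fintype S] {κ : S → S → ℝ} (hκsym : ∀ r s, κ r s = κ s r)
    (hκ0 : ∀ r s, 0 ≤ κ r s) {b g : S → ℝ} (hb : ∀ r, 0 ≤ b r) (hg : ∀ r, 0 < g r)
    (h : ∀ r, ∑ s, κ r s * (b s * g s) ≤ g r) : QBd κ b := by
  intro f hf
  have h1 : ∀ r, (∑ s : S, κ r s * f s * b s) ^ 2 ≤
      g r * ∑ s, κ r s * b s * f s ^ 2 / g s := by
    intro r
    calc (∑ s : S, κ r s * f s * b s) ^ 2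
        ≤ (∑ s, κ r s * (b s * g s)) * ∑ s, κ r s * b s * f s ^ 2 / g s := by
          apply Finset.sum_sq_le_sum_mul_sum_of_sq_le_mul
          · intro s _; exact mul_nonneg (hκ0 _ _) (mul_nonneg (hb _) (hg _).le)
          · intro s _
            exact div_nonneg (mul_nonneg (mul_nonneg (hκ0 _ _) (hb _)) (sq_nonneg _)) (hg _).le
          · intro s _
            have := (hg s).ne'
            apply le_of_eq
            field_simp
      _ ≤ _ := by
          apply mul_le_mul_of_nonneg_right (h r)
          apply Finset.sum_nonneg
          intro s _
          exact div_nonneg (mul_nonneg (mul_nonneg (hκ0 _ _) (hb _)) (sq_nonneg _)) (hg _).le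
  calc (∑ r : S, b r * (∑ s : S, κ r s * f s * b s) ^ 2)
      ≤ ∑ r, b r * (g r * ∑ s, κ r s * b s * f s ^ 2 / g s) :=
        Finset.sum_le_sum fun r _ => mul_le_mul_of_nonneg_left (h1 r) (hb r)
    _ = ∑ s, (∑ r, κ s r * (b r * g r)) * (b s * f s ^ 2 / g s) := by
        simp only [Finset.mul_sum, Finset.sum_mul]
        rw [Finset.sum_comm]
        refine Finset.sum_congr rfl fun s _ => Finset.sum_congr rfl fun r _ => ?_
        rw [hκsym r s]; ring
    _ ≤ ∑ s, g s * (b s * f s ^ 2 / g s) := by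
        refine Finset.sum_le_sum fun s _ => mul_le_mul_of_nonneg_right (h s) ?_
        exact div_nonneg (mul_nonneg (hb _) (sq_nonneg _)) (hg _).le
    _ = _ := by
        refine Finset.sum_congr rfl fun s _ => ?_
        have := (hg s).ne'
        field_simp

lemma QBd.mono {S : Type*} [Fintype S] {κ : S → S → ℝ} {a b : S → ℝ} (ha : ∀ r, 0 ≤ a r)
    (hab : ∀ r, a r ≤ b r) (h : QBd κ b) : QBd κ a := by
  intro f hf
  have hb : ∀ r, 0 ≤ b r := fun r => (ha r).trans (hab r)
  have h0 : ∀ s, f s * a s / b s * b s = f s * a s := by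
    intro s
    rcases (hb s).eq_or_lt with h1 | h1
    · have : a s = 0 := le_antisymm (by rw [h1]; exact hab s) (ha s)
      rw [this]; simp
    · field_simp
  have h2 := h (fun s => f s * a s / b s) (fun s => div_nonneg (mul_nonneg (hf s) (ha s)) (hb s))
  have h3 : ∀ r, ∑ s, κ r s * (f s * a s / b s) * b s = ∑ s, κ r s * f s * a s := by
    intro r
    refine Finset.sum_congr rfl fun s _ => ?_
    rw [mul_assoc, h0]; ring
  simp only [h3] at h2
  calc _ ≤ ∑ r, b r * (∑ s, κ r s * f s * a s) ^ 2 :=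
        Finset.sum_le_sum fun r _ => mul_le_mul_of_nonneg_right (hab r) (sq_nonneg _)
    _ ≤ _ := h2
    _ ≤ _ := by
        refine Finset.sum_le_sum fun r _ => ?_
        have : b r * (f r * a r / b r) ^ 2 = (f r * a r / b r * b r) * (f r * a r / b r) := by ring
        rw [this, h0]
        have h5 : f r * a r / b r ≤ f r := by
          apply div_le_of_le_mul₀ (hb r) (hf r)
          exact mul_le_mul_of_nonneg_left (hab r) (hf r)
        calc f r * a r * (f r * a r / b r) ≤ f r * a r * f r :=
              mul_le_mul_of_nonneg_left h5 (mul_nonneg (hf r) (ha r))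
          _ = _ := by ring

lemma exists_eps_fp {S : Type*} [Fintype S] {κ : S → S → ℝ}
    (hκ0 : ∀ r s, 0 ≤ κ r s) {c : S → ℝ} (hc : ∀ r, 0 ≤ c r) {ε : ℝ} (hε : 0 < ε) :
    ∃ u ∈ Set.Icc (0 : S → ℝ) c, ∀ r, u r * (1 + (ε + ∑ s, κ r s * u s)) =
      c r * (ε + ∑ s, κ r s * u s) := by
  have hc' : (0 : S → ℝ) ≤ c := hc
  have : Fact ((0 : S → ℝ) ≤ c) := ⟨hc'⟩
  have hk : ∀ u : S → ℝ, 0 ≤ u → ∀ r, 0 ≤ ∑ s, κ r s * u s := fun u hu r =>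
    Finset.sum_nonneg fun s _ => mul_nonneg (hκ0 r s) (hu s)
  let F : Set.Icc (0 : S → ℝ) c →o Set.Icc (0 : S → ℝ) c :=
    { toFun := fun u => ⟨fun r => c r * (1 - 1 / (1 + (ε + ∑ s, κ r s * u.1 s))), by
        constructor
        · intro r
          have := hk u.1 u.2.1 r
          apply mul_nonneg (hc r)
          rw [sub_nonneg, div_le_one (by positivity)]
          linarith
        · intro r
          have := hk u.1 u.2.1 r
          have h2 : 0 ≤ 1 / (1 + (ε + ∑ s, κ r s * u.1 s)) := by positivity
          exact mul_le_of_le_one_right (hc r) (by linarith)⟩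
      monotone' := by
        intro u v huv r
        have h1 := hk u.1 u.2.1 r
        have h2 : ∑ s, κ r s * u.1 s ≤ ∑ s, κ r s * v.1 s :=
          Finset.sum_le_sum fun s _ => mul_le_mul_of_nonneg_left (huv s) (hκ0 r s)
        apply mul_le_mul_of_nonneg_left _ (hc r)
        have : 1 / (1 + (ε + ∑ s, κ r s * v.1 s)) ≤ 1 / (1 + (ε + ∑ s, κ r s * u.1 s)) :=
          one_div_le_one_div_of_le (by positivity) (by linarith)
        linarith }
  refine ⟨(OrderHom.lfp F).1, (OrderHom.lfp F).2, fun r => ?_⟩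
  have h := congrFun (congrArg Subtype.val (OrderHom.map_lfp F)) r
  have h1 := hk _ (OrderHom.lfp F).2.1 r
  have h2 : c r * (1 - 1 / (1 + (ε + ∑ s, κ r s * (OrderHom.lfp F).1 s))) = (OrderHom.lfp F).1 r := h
  rw [← h2]
  have : (1 + (ε + ∑ s, κ r s * (OrderHom.lfp F).1 s)) ≠ 0 := by positivity
  generalize (∑ s, κ r s * (OrderHom.lfp F).1 s) = X at *
  field_simp
  ring

lemma exists_FP_QBd {S : Type*} [Fintype S] {κ : S → S → ℝ} (hκsym : ∀ r s, κ r s = κ s r)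
    (hκ0 : ∀ r s, 0 ≤ κ r s) {c : S → ℝ} (hc : ∀ r, 0 ≤ c r) :
    ∃ b, IsFPSol κ c b ∧ QBd κ b := by
  have hpos : ∀ n : ℕ, (0:ℝ) < 1 / ((n:ℝ) + 1) := fun n => by positivity
  choose u hu hfp using fun n : ℕ => exists_eps_fp hκ0 hc (hpos n)
  obtain ⟨v, hv, φ, hφ, hlim⟩ := (isCompact_Icc (a := (0 : S → ℝ)) (b := c)).tendsto_subseq hu
  have hlim' : ∀ r, Tendsto (fun n => u (φ n) r) atTop (nhds (v r)) := fun r =>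
    (tendsto_pi_nhds.1 hlim r)
  have hsum : ∀ r, Tendsto (fun n => ∑ s, κ r s * u (φ n) s) atTop (nhds (∑ s, κ r s * v s)) :=
    fun r => tendsto_finsetSum _ fun s _ => (hlim' s).const_mul _
  have heps : Tendsto (fun n => 1 / ((φ n : ℝ) + 1)) atTop (nhds 0) :=
    tendsto_one_div_add_atTop_nhds_zero_nat.comp hφ.tendsto_atTop
  have hveq : ∀ r, v r * (1 + (0 + ∑ s, κ r s * v s)) = c r * (0 + ∑ s, κ r s * v s) := by
    intro r
    refine tendsto_nhds_unique ((hlim' r).mul ((heps.add (hsum r)).const_add 1)) ?_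
    simp only [hfp]
    exact (heps.add (hsum r)).const_mul _
  refine ⟨fun r => c r - v r, ⟨fun r => sub_nonneg.2 (hv.2 r), fun r => sub_le_self _ (hv.1 r),
    fun r => ?_⟩, ?_⟩
  · have := hveq r
    simp only [sub_sub_cancel]
    linarith
  · have hQ : ∀ n, QBd κ (fun r => c r - u n r) := by
      intro n
      have hk : ∀ r, 0 ≤ ∑ s, κ r s * u n s := fun r =>
        Finset.sum_nonneg fun s _ => mul_nonneg (hκ0 r s) ((hu n).1 s)
      apply QBd.schur hκsym hκ0 (g := fun r => 1 / ((n:ℝ) + 1) + ∑ s, κ r s * u n s)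
      · intro r; exact sub_nonneg.2 ((hu n).2 r)
      · intro r; have := hk r; have := hpos n; positivity
      · intro r
        have h1 : ∀ s, (c s - u n s) * (1 / ((n:ℝ) + 1) + ∑ t, κ s t * u n t) = u n s := by
          intro s; have := hfp n s; linarith
        simp only [h1]
        have := hpos n; linarith
    intro f hf
    refine le_of_tendsto_of_tendsto' (b := atTop) ?_ ?_ (fun n => hQ (φ n) f hf)
    · refine tendsto_finsetSum _ fun r _ => ((hlim' r).const_sub _).mul ?_
      refine Tendsto.pow ?_ 2
      exact tendsto_finsetSum _ fun s _ => ((hlim' s).const_sub _).const_mul _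
    · exact tendsto_finsetSum _ fun r _ => ((hlim' r).const_sub _).mul_const _

/-- Strict comparison: a nonnegative `h` with `h ≤ b (1 - exp (- κ h))` vanishes. -/
lemma QBd.eq_zero {S : Type*} [Fintype S] {κ : S → S → ℝ}
    (hκ0 : ∀ r s, 0 ≤ κ r s) {b h : S → ℝ} (hb : ∀ r, 0 ≤ b r) (hQ : QBd κ b)
    (hh : ∀ r, 0 ≤ h r) (hle : ∀ r, h r ≤ b r * (1 - Real.exp (-(∑ s, κ r s * h s)))) :
    ∀ r, h r = 0 := by
  have hk : ∀ r, 0 ≤ ∑ s, κ r s * h s := fun r =>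
    Finset.sum_nonneg fun s _ => mul_nonneg (hκ0 r s) (hh s)
  have hex : ∀ x : ℝ, 1 - Real.exp (-x) ≤ x := fun x => by
    have := Real.add_one_le_exp (-x); linarith
  have hb0 : ∀ r, b r = 0 → h r = 0 := fun r hr =>
    le_antisymm (by have := hle r; rwa [hr, zero_mul] at this) (hh r)
  have hfb : ∀ s, h s / b s * b s = h s := by
    intro s
    by_cases h1 : b s = 0
    · rw [hb0 s h1, h1]; simp
    · field_simp
  have h1 := hQ (fun s => h s / b s) (fun s => div_nonneg (hh s) (hb s))
  have h2 : ∀ r, ∑ s, κ r s * (h s / b s) * b s = ∑ s, κ r s * h s := fun r =>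
    Finset.sum_congr rfl fun s _ => by rw [mul_assoc, hfb]
  simp only [h2] at h1
  have h3 : ∀ r, h r / b r ≤ ∑ s, κ r s * h s := by
    intro r
    apply div_le_of_le_mul₀ (hb r) (hk r)
    rw [mul_comm]
    exact (hle r).trans (mul_le_mul_of_nonneg_left (hex _) (hb r))
  have h4 : ∀ r ∈ Finset.univ, b r * (h r / b r) ^ 2 ≤ b r * (∑ s, κ r s * h s) ^ 2 := fun r _ =>
    mul_le_mul_of_nonneg_left (pow_le_pow_left₀ (div_nonneg (hh r) (hb r)) (h3 r) 2) (hb r)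
  have h5 := (Finset.sum_eq_sum_iff_of_le h4).1 (le_antisymm (Finset.sum_le_sum h4) h1)
  intro r
  by_contra hr
  have hbr : 0 < b r := (hb r).lt_of_ne fun h => hr (hb0 r h.symm)
  have h6 := h5 r (Finset.mem_univ r)
  have h7 : h r / b r = ∑ s, κ r s * h s := by
    have := mul_left_cancel₀ hbr.ne' h6
    exact (pow_left_inj₀ (div_nonneg (hh r) (hb r)) (hk r) two_ne_zero).1 this
  have hpos : 0 < ∑ s, κ r s * h s := by
    rw [← h7]; exact div_pos ((hh r).lt_of_ne (Ne.symm hr)) hbr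
  have h8 : h r / b r ≤ 1 - Real.exp (-(∑ s, κ r s * h s)) := by
    rw [div_le_iff₀ hbr, mul_comm]; exact hle r
  have h9 := Real.add_one_lt_exp (x := -(∑ s, κ r s * h s)) (by linarith)
  linarith

lemma FP_part {S : Type*} [Fintype S]
    (κ : S → S → ℝ) (hκsym : ∀ r s, κ r s = κ s r) (hκ0 : ∀ r s, 0 ≤ κ r s)
    (c : S → ℝ) (hc0 : ∀ r, 0 ≤ c r) (hSig : 1 < sigmaOp κ c)
    (b : S → ℝ) (hb : IsFPSol κ c b)
    (hmin : ∀ b', IsFPSol κ c b' → ∀ r, b r ≤ b' r) :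
    b ≠ c ∧ sigmaOp κ b = 1 ∧ QBd κ b := by
  obtain ⟨b', hb', hQ'⟩ := exists_FP_QBd hκsym hκ0 hc0
  have hQ : QBd κ b := hQ'.mono hb.1 (hmin b' hb')
  have hne : b ≠ c := by
    rintro rfl
    exact absurd hQ.sigmaOp_le (not_le.2 hSig)
  refine ⟨hne, le_antisymm hQ.sigmaOp_le ?_, hQ⟩
  obtain ⟨hb0, hbc, hfp⟩ := hb
  set u : S → ℝ := fun r => c r - b r with hu
  have hu0 : ∀ r, 0 ≤ u r := fun r => sub_nonneg.2 (hbc r)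
  have hfp' : ∀ r, (∑ s, κ r s * u s) * b r = u r := hfp
  set g : S → ℝ := fun r => ∑ s, κ r s * u s with hg
  have hg0 : ∀ r, 0 ≤ g r := fun r =>
    Finset.sum_nonneg fun s _ => mul_nonneg (hκ0 r s) (hu0 s)
  have hTg : ∀ r, ∑ s, κ r s * g s * b s = g r := fun r =>
    Finset.sum_congr rfl fun s _ => by rw [mul_assoc, hfp' s]
  obtain ⟨r0, hr0⟩ : ∃ r, u r ≠ 0 := by
    by_contra! hall
    exact hne (funext fun r => (sub_eq_zero.1 (hall r)).symm)
  have hpos : 0 < ∑ r, b r * g r ^ 2 := by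
    apply Finset.sum_pos' (fun r _ => mul_nonneg (hb0 r) (sq_nonneg _))
    refine ⟨r0, Finset.mem_univ _, ?_⟩
    have h1 : g r0 * b r0 ≠ 0 := by rw [hfp' r0]; exact hr0
    have h2 : g r0 ≠ 0 := left_ne_zero_of_mul h1
    have h3 : b r0 ≠ 0 := right_ne_zero_of_mul h1
    have : 0 < b r0 := (hb0 r0).lt_of_ne h3.symm
    positivity
  set N := ∑ r, b r * g r ^ 2 with hN
  have hs := Real.sqrt_pos.2 hpos
  have hsq : Real.sqrt N ^ 2 = N := Real.sq_sqrt hpos.le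
  apply le_csSup hQ.bddAbove
  refine ⟨fun r => g r / Real.sqrt N, fun r => div_nonneg (hg0 r) hs.le, ?_, ?_⟩
  · simp only [div_pow, hsq]
    rw [← div_self hpos.ne', hN, Finset.sum_div]
    exact le_of_eq (Finset.sum_congr rfl fun r _ => by ring)
  · have h1 : ∀ r, ∑ s, κ r s * (g s / Real.sqrt N) * b s = g r / Real.sqrt N := fun r => by
      rw [← hTg r, Finset.sum_div]
      refine Finset.sum_congr rfl fun s _ => ?_
      ring
    simp only [h1, div_pow, hsq]
    symm
    rw [Real.sqrt_eq_one]
    have : ∀ r, b r * (g r ^ 2 / N) = b r * g r ^ 2 / N := fun r => by ring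
    simp only [this, ← Finset.sum_div]
    exact div_self hpos.ne'

lemma hasSum_congr_fun {ι : Type*} {f g : ι → ℝ} {x : ℝ} (h : ∀ i, f i = g i) (hg : HasSum g x) :
    HasSum f x := by
  rwa [funext h]

lemma powser_hasDerivAt {a : ℕ → ℝ} (ha0 : ∀ n, 0 ≤ a n) (ha : Summable a) {t : ℝ} (ht0 : 0 < t)
    (ht1 : t < 1) :
    Summable (fun n : ℕ => (n : ℝ) * a n * t ^ (n - 1)) ∧
    HasDerivAt (fun t => ∑' n, a n * t ^ n) (∑' n : ℕ, (n : ℝ) * a n * t ^ (n - 1)) t := by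
  obtain ⟨R, hR1, hR2⟩ := exists_between ht1
  have hR0 : 0 < R := ht0.trans hR1
  have hgeo : Summable (fun n : ℕ => (n : ℝ) * R ^ (n - 1)) := by
    have h := summable_pow_mul_geometric_of_norm_lt_one 1 (r := R)
      (by rw [Real.norm_of_nonneg hR0.le]; exact hR2)
    have h2 := h.mul_right R⁻¹
    refine h2.congr fun n => ?_
    rcases n with _ | n
    · simp
    · simp [pow_succ]; field_simp
  have hbd : ∀ n : ℕ, (n : ℝ) * R ^ (n - 1) ≤ ∑' n : ℕ, (n : ℝ) * R ^ (n - 1) := fun n =>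
    hgeo.le_tsum n fun m _ => by positivity
  have hu : Summable (fun n : ℕ => (n : ℝ) * a n * R ^ (n - 1)) := by
    refine Summable.of_nonneg_of_le (fun n => by have := ha0 n; positivity) (fun n => ?_)
      (ha.mul_right (∑' n : ℕ, (n : ℝ) * R ^ (n - 1)))
    calc (n : ℝ) * a n * R ^ (n - 1) = a n * (n * R ^ (n - 1)) := by ring
      _ ≤ _ := mul_le_mul_of_nonneg_left (hbd n) (ha0 n)
  have key : HasDerivAt (fun t => ∑' n, a n * t ^ n) (∑' n : ℕ, a n * ((n : ℝ) * t ^ (n - 1))) t := by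
    refine hasDerivAt_tsum_of_isPreconnected (t := Set.Ioo 0 R) hu isOpen_Ioo
      isPreconnected_Ioo (fun n y hy => (hasDerivAt_pow n y).const_mul (a n)) ?_ (y₀ := t) ⟨ht0, hR1⟩
      ?_ ⟨ht0, hR1⟩
    · intro n y hy
      have := ha0 n
      have := hy.1
      rw [Real.norm_of_nonneg (by positivity)]
      calc a n * (n * y ^ (n - 1)) = n * a n * y ^ (n - 1) := by ring
        _ ≤ _ := by
          have := pow_le_pow_left₀ hy.1.le hy.2.le (n - 1)
          gcongr
    · refine Summable.of_nonneg_of_le (fun n => by have := ha0 n; positivity) (fun n => ?_) ha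
      exact mul_le_of_le_one_right (ha0 n) (pow_le_one₀ ht0.le ht1.le)
  refine ⟨?_, ?_⟩
  · refine Summable.of_nonneg_of_le (fun n => by have := ha0 n; positivity) (fun n => ?_) hu
    have := ha0 n
    have := pow_le_pow_left₀ ht0.le hR1.le (n - 1)
    gcongr
  · convert key using 1
    exact tsum_congr fun n => by ring

lemma powser_continuousOn {a : ℕ → ℝ} (ha0 : ∀ n, 0 ≤ a n) (ha : Summable a) :
    ContinuousOn (fun t : ℝ => ∑' n, a n * t ^ n) (Set.Icc 0 1) := by
  refine continuousOn_tsum (u := a) (fun n => by fun_prop) ha ?_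
  intro n t ht
  have := ha0 n
  have h0 := ht.1
  rw [Real.norm_of_nonneg (by positivity)]
  exact mul_le_of_le_one_right (ha0 n) (pow_le_one₀ ht.1 ht.2)

/-- `t (A' - A B')` as a series. -/
lemma ode_aux {a e : ℕ → ℝ} (ha0 : ∀ n, 0 ≤ a n) (ha : Summable a) (he0 : ∀ n, 0 ≤ e n)
    (he : Summable e) {t : ℝ} (ht0 : 0 < t) (ht1 : t < 1) :
    ∃ A' B' : ℝ, HasDerivAt (fun t => ∑' n, a n * t ^ n) A' t ∧
      HasDerivAt (fun t => ∑' n, e n * t ^ n) B' t ∧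
      HasSum (fun n : ℕ => ((n : ℝ) * a n -
        ∑ p ∈ Finset.HasAntidiagonal.antidiagonal n, a p.1 * (p.2 * e p.2)) * t ^ n)
        (t * (A' - (∑' n, a n * t ^ n) * B')) := by
  obtain ⟨hs1, hd1⟩ := powser_hasDerivAt ha0 ha ht0 ht1
  obtain ⟨hs2, hd2⟩ := powser_hasDerivAt he0 he ht0 ht1
  refine ⟨_, _, hd1, hd2, ?_⟩
  have hA : Summable (fun n => a n * t ^ n) := by
    refine Summable.of_nonneg_of_le (fun n => by have := ha0 n; positivity) (fun n => ?_) ha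
    exact mul_le_of_le_one_right (ha0 n) (pow_le_one₀ ht0.le ht1.le)
  have h1 : HasSum (fun n : ℕ => (n : ℝ) * a n * t ^ n) (t * ∑' n : ℕ, (n : ℝ) * a n * t ^ (n - 1)) := by
    have := hs1.hasSum.mul_left t
    refine hasSum_congr_fun (fun n => ?_) this
    rcases n with _ | n
    · simp
    · simp [pow_succ]; ring
  have h2 : HasSum (fun n : ℕ => (n : ℝ) * e n * t ^ n) (t * ∑' n : ℕ, (n : ℝ) * e n * t ^ (n - 1)) := by
    have := hs2.hasSum.mul_left t
    refine hasSum_congr_fun (fun n => ?_) this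
    rcases n with _ | n
    · simp
    · simp [pow_succ]; ring
  have hAn : Summable (fun n => ‖a n * t ^ n‖) := hA.norm
  have hBn : Summable (fun n : ℕ => ‖(n : ℝ) * e n * t ^ n‖) := h2.summable.norm
  have h3 := tsum_mul_tsum_eq_tsum_sum_antidiagonal_of_summable_norm hAn hBn
  have h4 := (summable_norm_sum_mul_antidiagonal_of_summable_norm hAn hBn).of_norm.hasSum
  rw [← h3, h2.tsum_eq] at h4
  have h5 := h1.sub h4
  have h6 : ∀ x y z : ℝ, t * x - y * (t * z) = t * (x - y * z) := fun x y z => by ring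
  rw [h6] at h5
  refine hasSum_congr_fun (fun n => ?_) h5
  rw [sub_mul, Finset.sum_mul]
  congr 1
  refine Finset.sum_congr rfl fun p hp => ?_
  rw [← Finset.HasAntidiagonal.mem_antidiagonal.1 hp, pow_add]; ring

lemma powser_zero (a : ℕ → ℝ) : ∑' n, a n * (0 : ℝ) ^ n = a 0 := by
  rw [tsum_eq_single 0]
  · simp
  · intro n hn; simp [hn]

lemma ode_le {a e : ℕ → ℝ} (ha0 : ∀ n, 0 ≤ a n) (ha : Summable a) (he0 : ∀ n, 0 ≤ e n)
    (he : Summable e) (hee : e 0 = 0)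
    (h : ∀ n : ℕ, (n : ℝ) * a n ≤ ∑ p ∈ Finset.HasAntidiagonal.antidiagonal n, a p.1 * (p.2 * e p.2)) :
    ∑' n, a n ≤ a 0 * Real.exp (∑' n, e n) := by
  have hanti : AntitoneOn (fun t : ℝ => (∑' n, a n * t ^ n) * Real.exp (-∑' n, e n * t ^ n))
      (Set.Icc 0 1) := by
    have hcont : ContinuousOn (fun t : ℝ => (∑' n, a n * t ^ n) * Real.exp (-∑' n, e n * t ^ n))
      (Set.Icc 0 1) := (powser_continuousOn ha0 ha).mul (powser_continuousOn he0 he).neg.rexp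
    have hder : ∀ t ∈ Set.Ioo (0:ℝ) 1, ∃ d ≤ 0, HasDerivAt
        (fun t : ℝ => (∑' n, a n * t ^ n) * Real.exp (-∑' n, e n * t ^ n)) d t := by
      rintro t ⟨h0, h1⟩
      obtain ⟨A', B', hA, hB, hs⟩ := ode_aux ha0 ha he0 he h0 h1
      refine ⟨_, ?_, hA.mul hB.neg.exp⟩
      have : t * (A' - (∑' n, a n * t ^ n) * B') ≤ 0 :=
        hasSum_le (g := fun _ => 0) (fun n => mul_nonpos_of_nonpos_of_nonneg (by have := h n; linarith) (by positivity)) hs hasSum_zero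
      have h2 : (A' - (∑' n, a n * t ^ n) * B') ≤ 0 := nonpos_of_mul_nonpos_right this h0
      have h3 := mul_nonpos_of_nonpos_of_nonneg h2 (Real.exp_pos (-∑' n, e n * t ^ n)).le
      simp only [Pi.neg_apply]
      linarith
    refine antitoneOn_of_deriv_nonpos (convex_Icc 0 1) hcont ?_ ?_
    · rw [interior_Icc]; intro t ht
      obtain ⟨d, _, hd⟩ := hder t ht
      exact hd.differentiableAt.differentiableWithinAt
    · rw [interior_Icc]; intro t ht
      obtain ⟨d, hd0, hd⟩ := hder t ht
      rw [hd.deriv]; exact hd0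
  have := hanti (Set.left_mem_Icc.2 zero_le_one) (Set.right_mem_Icc.2 zero_le_one) zero_le_one
  simp only [powser_zero, hee, one_pow, mul_one, neg_zero, Real.exp_zero] at this
  rwa [Real.exp_neg, ← div_eq_mul_inv, div_le_iff₀ (Real.exp_pos _)] at this

lemma ode_ge {a e : ℕ → ℝ} (ha0 : ∀ n, 0 ≤ a n) (ha : Summable a) (he0 : ∀ n, 0 ≤ e n)
    (he : Summable e) (hee : e 0 = 0)
    (h : ∀ n : ℕ, ∑ p ∈ Finset.HasAntidiagonal.antidiagonal n, a p.1 * (p.2 * e p.2) ≤ (n : ℝ) * a n) :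
    a 0 * Real.exp (∑' n, e n) ≤ ∑' n, a n := by
  have hmono : MonotoneOn (fun t : ℝ => (∑' n, a n * t ^ n) * Real.exp (-∑' n, e n * t ^ n))
      (Set.Icc 0 1) := by
    have hcont : ContinuousOn (fun t : ℝ => (∑' n, a n * t ^ n) * Real.exp (-∑' n, e n * t ^ n))
      (Set.Icc 0 1) := (powser_continuousOn ha0 ha).mul (powser_continuousOn he0 he).neg.rexp
    have hder : ∀ t ∈ Set.Ioo (0:ℝ) 1, ∃ d ≥ 0, HasDerivAt
        (fun t : ℝ => (∑' n, a n * t ^ n) * Real.exp (-∑' n, e n * t ^ n)) d t := by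
      rintro t ⟨h0, h1⟩
      obtain ⟨A', B', hA, hB, hs⟩ := ode_aux ha0 ha he0 he h0 h1
      refine ⟨_, ?_, hA.mul hB.neg.exp⟩
      have : 0 ≤ t * (A' - (∑' n, a n * t ^ n) * B') :=
        hasSum_le (f := fun _ => 0) (fun n => mul_nonneg (by have := h n; linarith) (by positivity)) hasSum_zero hs
      have h2 : 0 ≤ (A' - (∑' n, a n * t ^ n) * B') := nonneg_of_mul_nonneg_right this h0
      have h3 := mul_nonneg h2 (Real.exp_pos (-∑' n, e n * t ^ n)).le
      simp only [Pi.neg_apply]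
      linarith
    refine monotoneOn_of_deriv_nonneg (convex_Icc 0 1) hcont ?_ ?_
    · rw [interior_Icc]; intro t ht
      obtain ⟨d, _, hd⟩ := hder t ht
      exact hd.differentiableAt.differentiableWithinAt
    · rw [interior_Icc]; intro t ht
      obtain ⟨d, hd0, hd⟩ := hder t ht
      rw [hd.deriv]; exact hd0
  have := hmono (Set.left_mem_Icc.2 zero_le_one) (Set.right_mem_Icc.2 zero_le_one) zero_le_one
  simp only [powser_zero, hee, one_pow, mul_one, neg_zero, Real.exp_zero] at this
  rwa [Real.exp_neg, ← div_eq_mul_inv, le_div_iff₀ (Real.exp_pos _)] at this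

/-- edge-product weight of a graph -/
def gwt {V S : Type*} [Fintype V] (K : Sym2 S → ℝ) (x : V → S) (G : SimpleGraph V) : ℝ :=
  ∏ e ∈ Finset.univ.filter (fun e : Sym2 V => e ∈ G.edgeSet), K (e.map x)

/-- spanning tree weight on a general finite vertex type -/
def TW {V S : Type*} [Fintype V] (K : Sym2 S → ℝ) (x : V → S) : ℝ :=
  ∑ G ∈ Finset.univ.filter (fun G : SimpleGraph V => G.IsTree), gwt K x G

lemma gwt_comap {V W S : Type*} [Fintype V] [Fintype W] (K : Sym2 S → ℝ) (e : V ≃ W) (x : W → S)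
    (G : SimpleGraph W) : gwt K (x ∘ e) (G.comap e) = gwt K x G := by
  unfold gwt
  refine Finset.prod_bij' (fun p _ => p.map e) (fun p _ => p.map e.symm) ?_ ?_ ?_ ?_ ?_
  · intro p hp
    induction p with | _ a b => simpa using hp
  · intro p hp
    induction p with | _ a b => simpa using hp
  · intro p hp
    simp [Sym2.map_map]
  · intro p hp
    simp [Sym2.map_map]
  · intro p hp
    simp [Sym2.map_map]

lemma TW_comp_equiv {V W S : Type*} [Fintype V] [Fintype W] (K : Sym2 S → ℝ) (e : V ≃ W)
    (x : W → S) : TW K (x ∘ e) = TW K x := by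
  unfold TW
  symm
  refine Finset.sum_bij' (fun G _ => G.comap e) (fun G _ => G.comap e.symm) ?_ ?_ ?_ ?_ ?_
  · intro G hG
    simp only [Finset.mem_filter, Finset.mem_univ, true_and] at hG ⊢
    exact (SimpleGraph.Iso.isTree_iff (SimpleGraph.Iso.comap e G)).2 hG
  · intro G hG
    simp only [Finset.mem_filter, Finset.mem_univ, true_and] at hG ⊢
    exact (SimpleGraph.Iso.isTree_iff (SimpleGraph.Iso.comap e.symm G)).2 hG
  · intro G _; ext a b; simp
  · intro G _; ext a b; simp
  · intro G _; exact (gwt_comap K e x G).symm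

lemma reachable_map_of_adj {V W : Type*} {G : SimpleGraph V} {H : SimpleGraph W} (f : V → W)
    (h : ∀ u v, G.Adj u v → H.Reachable (f u) (f v)) {u v : V} (huv : G.Reachable u v) :
    H.Reachable (f u) (f v) := by
  obtain ⟨p⟩ := huv
  induction p with
  | nil => exact SimpleGraph.Reachable.refl _
  | cons hadj _ ih => exact (h _ _ hadj).trans ih

/-- Glue two graphs along an edge. -/
def glueG {α β : Type*} (G : SimpleGraph α) (H : SimpleGraph β) (i : α) (j : β) :
    SimpleGraph (α ⊕ β) where
  Adj u v := match u, v with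
    | Sum.inl a, Sum.inl b => G.Adj a b
    | Sum.inr a, Sum.inr b => H.Adj a b
    | Sum.inl a, Sum.inr b => a = i ∧ b = j
    | Sum.inr b, Sum.inl a => a = i ∧ b = j
  symm := ⟨by
    rintro (a | a) (b | b) h
    · exact SimpleGraph.Adj.symm (G := G) h
    · exact h
    · exact h
    · exact SimpleGraph.Adj.symm (G := H) h⟩
  loopless := ⟨by
    rintro (a | a) h
    · exact G.irrefl h
    · exact H.irrefl h⟩

section glue
variable {α β : Type*} (G : SimpleGraph α) (H : SimpleGraph β) (i : α) (j : β)

@[simp] lemma glueG_ll (a b : α) : (glueG G H i j).Adj (Sum.inl a) (Sum.inl b) ↔ G.Adj a b := Iff.rfl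
@[simp] lemma glueG_rr (a b : β) : (glueG G H i j).Adj (Sum.inr a) (Sum.inr b) ↔ H.Adj a b := Iff.rfl
@[simp] lemma glueG_lr (a : α) (b : β) :
    (glueG G H i j).Adj (Sum.inl a) (Sum.inr b) ↔ a = i ∧ b = j := Iff.rfl
@[simp] lemma glueG_rl (a : α) (b : β) :
    (glueG G H i j).Adj (Sum.inr b) (Sum.inl a) ↔ a = i ∧ b = j := Iff.rfl

lemma glueG_edges [Fintype α] [Fintype β] :
    Finset.univ.filter (fun e : Sym2 (α ⊕ β) => e ∈ (glueG G H i j).edgeSet) =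
    insert s(Sum.inl i, Sum.inr j)
    (((Finset.univ.filter (fun e : Sym2 α => e ∈ G.edgeSet)).image (Sym2.map Sum.inl)) ∪
     ((Finset.univ.filter (fun e : Sym2 β => e ∈ H.edgeSet)).image (Sym2.map Sum.inr))) := by
  ext e
  simp only [Finset.mem_filter, Finset.mem_univ, true_and, Finset.mem_insert, Finset.mem_union,
    Finset.mem_image]
  constructor
  · induction e with | _ a b =>
    rcases a with a | a <;> rcases b with b | b
    · intro h; right; left; exact ⟨s(a, b), h, rfl⟩
    · intro h; left
      obtain ⟨rfl, rfl⟩ := (h : a = i ∧ b = j); rfl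
    · intro h; left
      obtain ⟨rfl, rfl⟩ := (h : b = i ∧ a = j); exact Sym2.eq_swap
    · intro h; right; right; exact ⟨s(a, b), h, rfl⟩
  · rintro (rfl | ⟨p, hp, rfl⟩ | ⟨p, hp, rfl⟩)
    · simp
    · induction p with | _ a b => simpa using hp
    · induction p with | _ a b => simpa using hp

lemma glueG_notMem [Fintype α] [Fintype β] : s(Sum.inl i, Sum.inr j) ∉
    (((Finset.univ.filter (fun e : Sym2 α => e ∈ G.edgeSet)).image (Sym2.map Sum.inl)) ∪
     ((Finset.univ.filter (fun e : Sym2 β => e ∈ H.edgeSet)).image (Sym2.map Sum.inr))) := by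
  simp only [Finset.mem_union, Finset.mem_image, not_or]
  constructor
  · rintro ⟨p, hp, h⟩
    induction p with | _ a b => simp at h
  · rintro ⟨p, hp, h⟩
    induction p with | _ a b => simp at h

lemma glueG_disj [Fintype α] [Fintype β] : Disjoint
    ((Finset.univ.filter (fun e : Sym2 α => e ∈ G.edgeSet)).image (Sym2.map (Sum.inl : α → α ⊕ β)))
     ((Finset.univ.filter (fun e : Sym2 β => e ∈ H.edgeSet)).image (Sym2.map Sum.inr)) := by
  rw [Finset.disjoint_left]
  intro e h1 h2
  simp only [Finset.mem_image] at h1 h2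
  obtain ⟨p, _, rfl⟩ := h1
  obtain ⟨q, _, h⟩ := h2
  induction p with | _ a b =>
  induction q with | _ c d => simp at h

lemma gwt_glue [Fintype α] [Fintype β] {S : Type*} (K : Sym2 S → ℝ) (x : α ⊕ β → S) :
    gwt K x (glueG G H i j) =
      K s(x (Sum.inl i), x (Sum.inr j)) * (gwt K (x ∘ Sum.inl) G * gwt K (x ∘ Sum.inr) H) := by
  unfold gwt
  rw [glueG_edges, Finset.prod_insert (glueG_notMem G H i j), Finset.prod_union (glueG_disj G H),
    Finset.prod_image (Sym2.map.injective Sum.inl_injective).injOn,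
    Finset.prod_image (Sym2.map.injective Sum.inr_injective).injOn]
  simp [Sym2.map_map]

lemma natcard_edgeSet {V : Type*} [Fintype V] (G : SimpleGraph V) :
    Nat.card G.edgeSet = (Finset.univ.filter (fun e : Sym2 V => e ∈ G.edgeSet)).card := by
  rw [Nat.card_eq_fintype_card, Fintype.card_subtype]

lemma glueG_card [Fintype α] [Fintype β] :
    Nat.card (glueG G H i j).edgeSet = Nat.card G.edgeSet + Nat.card H.edgeSet + 1 := by
  rw [natcard_edgeSet, natcard_edgeSet, natcard_edgeSet, glueG_edges,
    Finset.card_insert_of_notMem (glueG_notMem G H i j), Finset.card_union_of_disjoint (glueG_disj G H),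
    Finset.card_image_of_injective _ (Sym2.map.injective Sum.inl_injective),
    Finset.card_image_of_injective _ (Sym2.map.injective Sum.inr_injective)]

lemma glueG_isTree [Fintype α] [Fintype β] : (glueG G H i j).IsTree ↔ G.IsTree ∧ H.IsTree := by
  constructor
  · intro h
    refine ⟨⟨?_, ?_⟩, ⟨?_, ?_⟩⟩
    · have : Nonempty α := ⟨i⟩
      refine ⟨fun a b => ?_⟩
      have := h.1.preconnected (Sum.inl a) (Sum.inl b)
      refine reachable_map_of_adj (fun v => Sum.elim id (fun _ => i) v) ?_ this
      rintro (u | u) (v | v) huv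
      · exact SimpleGraph.Adj.reachable huv
      · obtain ⟨rfl, -⟩ := huv; exact SimpleGraph.Reachable.refl _
      · obtain ⟨rfl, -⟩ := huv; exact SimpleGraph.Reachable.refl _
      · exact SimpleGraph.Reachable.refl _
    · exact h.2.comap (⟨Sum.inl, fun {a b} hab => hab⟩ : G →g glueG G H i j) Sum.inl_injective
    · have : Nonempty β := ⟨j⟩
      refine ⟨fun a b => ?_⟩
      have := h.1.preconnected (Sum.inr a) (Sum.inr b)
      refine reachable_map_of_adj (fun v => Sum.elim (fun _ => j) id v) ?_ this
      rintro (u | u) (v | v) huv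
      · exact SimpleGraph.Reachable.refl _
      · obtain ⟨-, rfl⟩ := huv; exact SimpleGraph.Reachable.refl _
      · obtain ⟨-, rfl⟩ := huv; exact SimpleGraph.Reachable.refl _
      · exact SimpleGraph.Adj.reachable huv
    · exact h.2.comap (⟨Sum.inr, fun {a b} hab => hab⟩ : H →g glueG G H i j) Sum.inr_injective
  · rintro ⟨hG, hH⟩
    rw [SimpleGraph.isTree_iff_connected_and_card] at hG hH ⊢
    refine ⟨?_, ?_⟩
    · have : Nonempty (α ⊕ β) := ⟨Sum.inl i⟩
      have key : ∀ v, (glueG G H i j).Reachable (Sum.inl i) v := by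
        rintro (v | v)
        · exact reachable_map_of_adj (H := glueG G H i j) Sum.inl
            (fun u v h => SimpleGraph.Adj.reachable (by simpa using h)) (hG.1.preconnected i v)
        · have h1 : (glueG G H i j).Reachable (Sum.inl i) (Sum.inr j) :=
            SimpleGraph.Adj.reachable (by simp)
          exact h1.trans (reachable_map_of_adj (H := glueG G H i j) Sum.inr
            (fun u v h => SimpleGraph.Adj.reachable (by simpa using h)) (hH.1.preconnected j v))
      exact ⟨fun u v => (key u).symm.trans (key v)⟩
    · rw [glueG_card, Nat.card_sum, ← hG.2, ← hH.2]; ring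

lemma sum_cross_sum [Fintype α] [Fintype β] {S : Type*} (K : Sym2 S → ℝ) (x : α ⊕ β → S) :
    ∑ T ∈ Finset.univ.filter (fun T : SimpleGraph (α ⊕ β) => T.IsTree ∧
      ∀ a b, T.Adj (Sum.inl a) (Sum.inr b) ↔ a = i ∧ b = j), gwt K x T =
    K s(x (Sum.inl i), x (Sum.inr j)) * (TW K (x ∘ Sum.inl) * TW K (x ∘ Sum.inr)) := by
  unfold TW
  rw [Finset.sum_mul_sum, ← Finset.sum_product', Finset.mul_sum]
  have hgl : ∀ T : SimpleGraph (α ⊕ β), (∀ a b, T.Adj (Sum.inl a) (Sum.inr b) ↔ a = i ∧ b = j) →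
      glueG (T.comap Sum.inl) (T.comap Sum.inr) i j = T := by
    intro T hT
    ext u v
    rcases u with u | u <;> rcases v with v | v
    · simp
    · simp [hT]
    · simp [T.adj_comm (Sum.inr u), hT]
    · simp
  refine Finset.sum_bij' (fun T _ => (T.comap Sum.inl, T.comap Sum.inr))
    (fun p _ => glueG p.1 p.2 i j) ?_ ?_ ?_ ?_ ?_
  · intro T hT
    simp only [Finset.mem_filter, Finset.mem_univ, true_and, Finset.mem_product] at hT ⊢
    rw [← glueG_isTree _ _ i j, hgl T hT.2]
    exact hT.1
  · intro p hp
    simp only [Finset.mem_filter, Finset.mem_univ, true_and, Finset.mem_product] at hp ⊢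
    exact ⟨(glueG_isTree _ _ i j).2 hp, fun a b => Iff.rfl⟩
  · intro T hT
    simp only [Finset.mem_filter, Finset.mem_univ, true_and] at hT
    exact hgl T hT.2
  · intro p hp
    rfl
  · intro T hT
    simp only [Finset.mem_filter, Finset.mem_univ, true_and] at hT
    rw [← gwt_glue, hgl T hT.2]
end glue

/-- `T` crosses from `A` to its complement exactly along `i → j`. -/
def Crs {V : Type*} (T : SimpleGraph V) (A : Finset V) (i j : V) : Prop :=
  i ∈ A ∧ j ∉ A ∧ ∀ u v, u ∈ A → v ∉ A → (T.Adj u v ↔ u = i ∧ v = j)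

lemma sum_cross {V S : Type*} [Fintype V] (K : Sym2 S → ℝ) (x : V → S) (A : Finset V) (i j : V)
    (hi : i ∈ A) (hj : j ∉ A) :
    ∑ T ∈ Finset.univ.filter (fun T : SimpleGraph V => T.IsTree ∧ Crs T A i j), gwt K x T =
    K s(x i, x j) * (TW K (fun v : {v // v ∈ A} => x v) * TW K (fun v : {v // v ∉ A} => x v)) := by
  let e := Equiv.sumCompl (fun v => v ∈ A)
  have h := sum_cross_sum (⟨i, hi⟩ : {v // v ∈ A}) (⟨j, hj⟩ : {v // v ∉ A}) K (x ∘ e)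
  have h2 : (x ∘ e) ∘ Sum.inl = (fun v : {v // v ∈ A} => x v) := by ext v; simp [e]
  have h3 : (x ∘ e) ∘ Sum.inr = (fun v : {v // v ∉ A} => x v) := by ext v; simp [e]
  rw [h2, h3] at h
  have h4 : K s((x ∘ e) (Sum.inl ⟨i, hi⟩), (x ∘ e) (Sum.inr ⟨j, hj⟩)) = K s(x i, x j) := by simp [e]
  rw [h4] at h
  rw [← h]
  have hcr : ∀ T : SimpleGraph V, Crs T A i j ↔ ∀ (a : {v // v ∈ A}) (b : {v // v ∉ A}),
      (T.comap e).Adj (Sum.inl a) (Sum.inr b) ↔ a = ⟨i, hi⟩ ∧ b = ⟨j, hj⟩ := by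
    intro T
    constructor
    · rintro ⟨_, _, h⟩ a b
      simp [e, h a b a.2 b.2, Subtype.ext_iff]
    · intro h
      refine ⟨hi, hj, fun u v hu hv => ?_⟩
      have := h ⟨u, hu⟩ ⟨v, hv⟩
      simpa [e, Subtype.ext_iff] using this
  refine Finset.sum_bij' (fun G _ => G.comap e) (fun G _ => G.comap e.symm) ?_ ?_ ?_ ?_ ?_
  · intro G hG
    simp only [Finset.mem_filter, Finset.mem_univ, true_and] at hG ⊢
    exact ⟨(SimpleGraph.Iso.isTree_iff (SimpleGraph.Iso.comap e G)).2 hG.1, (hcr G).1 hG.2⟩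
  · intro G hG
    simp only [Finset.mem_filter, Finset.mem_univ, true_and] at hG ⊢
    refine ⟨(SimpleGraph.Iso.isTree_iff (SimpleGraph.Iso.comap e.symm G)).2 hG.1, (hcr _).2 ?_⟩
    have : (G.comap e.symm).comap e = G := by ext a b; simp
    rw [this]; exact hG.2
  · intro G _; ext a b; simp
  · intro G _; ext a b; simp
  · intro G _; exact (gwt_comap K e x G).symm

lemma crs_mem_iff {V : Type*} {T : SimpleGraph V} {A : Finset V} {i j : V} (hC : Crs T A i j)
    {y w : V} (h : T.Adj i y) (q : T.Walk y w) (hq : i ∉ q.support) : w ∉ A ↔ y = j := by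
  obtain ⟨hi, hj, hC⟩ := hC
  constructor
  · intro hw
    obtain ⟨d, hd, h1, h2⟩ := (SimpleGraph.Walk.cons h q).exists_boundary_dart (A : Set V) hi hw
    have h3 := (hC d.fst d.snd h1 h2).1 d.adj
    rw [SimpleGraph.Walk.darts_cons, List.mem_cons] at hd
    rcases hd with rfl | hd
    · exact h3.2
    · exact absurd (h3.1 ▸ q.dart_fst_mem_support_of_mem_darts hd) hq
  · rintro rfl hw
    obtain ⟨d, hd, h1, h2⟩ := q.reverse.exists_boundary_dart (A : Set V) hw hj
    have h3 := (hC d.fst d.snd h1 h2).1 d.adj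
    have h4 := q.reverse.dart_fst_mem_support_of_mem_darts hd
    rw [SimpleGraph.Walk.support_reverse, List.mem_reverse, h3.1] at h4
    exact hq h4

lemma exists_first_step {V : Type*} {T : SimpleGraph V} (hT : T.IsTree) {i w : V} (hw : w ≠ i) :
    ∃ y, T.Adj i y ∧ ∃ q : T.Walk y w, i ∉ q.support := by
  obtain ⟨p, hp⟩ := hT.1.exists_isPath i w
  cases p with
  | nil => exact absurd rfl hw
  | cons h q =>
    rw [SimpleGraph.Walk.cons_isPath_iff] at hp
    exact ⟨_, h, q, hp.2⟩

lemma crs_exists {V : Type*} [Fintype V] {T : SimpleGraph V} (hT : T.IsTree) {i j : V}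
    (h : T.Adj i j) : ∃ A, Crs T A i j := by
  have hbr := SimpleGraph.isAcyclic_iff_forall_adj_isBridge.1 hT.2 h
  rw [SimpleGraph.isBridge_iff] at hbr
  refine ⟨Finset.univ.filter fun u => (T.deleteEdges {s(i, j)}).Reachable i u, ?_, ?_, ?_⟩
  · simp
  · simp only [Finset.mem_filter, Finset.mem_univ, true_and]
    exact hbr
  · intro u v hu hv
    simp only [Finset.mem_filter, Finset.mem_univ, true_and] at hu hv
    constructor
    · intro huv
      have : s(u, v) = s(i, j) := by
        by_contra hne
        apply hv
        refine hu.trans (SimpleGraph.Adj.reachable ?_)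
        rw [SimpleGraph.deleteEdges_adj]
        exact ⟨huv, by simpa using hne⟩
      rw [Sym2.eq_iff] at this
      rcases this with h | ⟨rfl, rfl⟩
      · exact h
      · exact absurd (SimpleGraph.Reachable.refl _) hv
    · rintro ⟨rfl, rfl⟩; exact h

lemma sum_crs_card {V : Type*} [Fintype V] {T : SimpleGraph V} (hT : T.IsTree) (i : V) :
    ∑ j, ∑ A : Finset V, (if Crs T A i j then (Fintype.card {v // v ∉ A} : ℝ) else 0) =
      (Fintype.card V : ℝ) - 1 := by
  have h1 : ∀ A : Finset V, (Fintype.card {v // v ∉ A} : ℝ) = ∑ w, if w ∉ A then (1 : ℝ) else 0 := by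
    intro A
    rw [Fintype.card_subtype, Finset.sum_boole]
  have h2 : ∀ w, ∑ p : V × Finset V, (if Crs T p.2 i p.1 ∧ w ∉ p.2 then (1 : ℝ) else 0) =
      if w = i then 0 else 1 := by
    intro w
    by_cases hw : w = i
    · rw [if_pos hw]
      refine Finset.sum_eq_zero fun p _ => if_neg ?_
      rintro ⟨h, h3⟩
      exact h3 (hw ▸ h.1)
    · rw [if_neg hw]
      obtain ⟨y, hy, q, hq⟩ := exists_first_step hT hw
      obtain ⟨A, hA⟩ := crs_exists hT hy
      rw [Finset.sum_eq_single (y, A)]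
      · rw [if_pos]; exact ⟨hA, (crs_mem_iff hA hy q hq).2 rfl⟩
      · rintro ⟨y', A'⟩ _ hne
        refine if_neg ?_
        rintro ⟨h3, h4⟩
        simp only at h3 h4
        obtain rfl := (crs_mem_iff h3 hy q hq).1 h4
        apply hne
        congr 1
        ext u
        by_cases hu : u = i
        · rw [hu]; exact ⟨fun _ => hA.1, fun _ => h3.1⟩
        · obtain ⟨z, hz, q', hq'⟩ := exists_first_step hT hu
          exact not_iff_not.1 ((crs_mem_iff h3 hz q' hq').trans (crs_mem_iff hA hz q' hq').symm)
      · intro h; exact absurd (Finset.mem_univ _) h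
  calc _ = ∑ p : V × Finset V, ∑ w, (if Crs T p.2 i p.1 ∧ w ∉ p.2 then (1 : ℝ) else 0) := by
        rw [Fintype.sum_prod_type]
        refine Finset.sum_congr rfl fun j _ => Finset.sum_congr rfl fun A _ => ?_
        rw [h1]
        by_cases hC : Crs T A i j
        · simp [hC]
        · simp [hC]
    _ = ∑ w, if w = i then (0 : ℝ) else 1 := by
        rw [Finset.sum_comm]; exact Finset.sum_congr rfl fun w _ => h2 w
    _ = _ := by
        have : ∀ w, (if w = i then (0 : ℝ) else 1) = 1 - if w = i then 1 else 0 := by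
          intro w; split_ifs <;> simp
        simp only [this, Finset.sum_sub_distrib]
        simp

/-- number of vertices of type `r` -/
def Nty {V S : Type*} [Fintype V] (x : V → S) (r : S) : ℝ := ∑ v, if x v = r then (1 : ℝ) else 0

lemma sum_kN {V S : Type*} [Fintype V] [Fintype S] (x : V → S) (f : S → ℝ) :
    ∑ s, f s * Nty x s = ∑ v, f (x v) := by
  unfold Nty
  simp only [Finset.mul_sum]
  rw [Finset.sum_comm]
  refine Finset.sum_congr rfl fun v _ => ?_
  simp

lemma TW_rec_fixed {V S : Type*} [Fintype V] [Fintype S] (K : Sym2 S → ℝ) (x : V → S) (r : S) :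
    ((Fintype.card V : ℝ) - 1) * (Nty x r * TW K x) =
    ∑ A : Finset V, (Nty (fun v : {v // v ∈ A} => x v) r * TW K (fun v : {v // v ∈ A} => x v)) *
      ((Fintype.card {v // v ∉ A} : ℝ) * ∑ s, K s(r, s) *
        (Nty (fun v : {v // v ∉ A} => x v) s * TW K (fun v : {v // v ∉ A} => x v))) := by
  have h0 : ∀ i j : V, ∀ A : Finset V,
      ∑ T ∈ Finset.univ.filter (fun T : SimpleGraph V => T.IsTree),
        (if Crs T A i j then gwt K x T else 0) = if i ∈ A ∧ j ∉ A then
        K s(x i, x j) * (TW K (fun v : {v // v ∈ A} => x v) * TW K (fun v : {v // v ∉ A} => x v))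
        else 0 := by
    intro i j A
    rw [← Finset.sum_filter, Finset.filter_filter]
    split_ifs with h
    · exact sum_cross K x A i j h.1 h.2
    · rw [Finset.filter_false_of_mem, Finset.sum_empty]
      rintro T _ ⟨_, h1, h2, _⟩
      exact h ⟨h1, h2⟩
  have h1 : ∀ i : V, ((Fintype.card V : ℝ) - 1) * TW K x = ∑ A : Finset V, ∑ j,
      (Fintype.card {v // v ∉ A} : ℝ) * if i ∈ A ∧ j ∉ A then
        K s(x i, x j) * (TW K (fun v : {v // v ∈ A} => x v) * TW K (fun v : {v // v ∉ A} => x v))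
        else 0 := by
    intro i
    rw [TW, Finset.mul_sum]
    calc _ = ∑ T ∈ Finset.univ.filter (fun T : SimpleGraph V => T.IsTree), ∑ j, ∑ A : Finset V,
          (Fintype.card {v // v ∉ A} : ℝ) * (if Crs T A i j then gwt K x T else 0) := by
          refine Finset.sum_congr rfl fun T hT => ?_
          rw [← sum_crs_card (Finset.mem_filter.1 hT).2 i, Finset.sum_mul]
          refine Finset.sum_congr rfl fun j _ => ?_
          rw [Finset.sum_mul]
          refine Finset.sum_congr rfl fun A _ => ?_
          split_ifs <;> simp
      _ = _ := by
          rw [Finset.sum_comm]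
          rw [Finset.sum_comm (s := (Finset.univ : Finset (Finset V)))]
          refine Finset.sum_congr rfl fun j _ => ?_
          rw [Finset.sum_comm]
          refine Finset.sum_congr rfl fun A _ => ?_
          rw [← h0, Finset.mul_sum]
  have h2 : ((Fintype.card V : ℝ) - 1) * (Nty x r * TW K x) =
      ∑ i, (if x i = r then (1 : ℝ) else 0) * (((Fintype.card V : ℝ) - 1) * TW K x) := by
    rw [← Finset.sum_mul, Nty]; ring
  rw [h2]
  rw [Finset.sum_congr rfl (fun i _ => congrArg
    (fun t => (if x i = r then (1 : ℝ) else 0) * t) (h1 i))]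
  simp only [Finset.mul_sum]
  rw [Finset.sum_comm]
  refine Finset.sum_congr rfl fun A _ => ?_
  have h3 : ∑ s, K s(r, s) *
        (Nty (fun v : {v // v ∉ A} => x v) s * TW K (fun v : {v // v ∉ A} => x v)) =
        (∑ v : {v // v ∉ A}, K s(r, x v)) * TW K (fun v : {v // v ∉ A} => x v) := by
    rw [← sum_kN (fun v : {v // v ∉ A} => x v) (fun s => K s(r, s)), Finset.sum_mul]
    refine Finset.sum_congr rfl fun s _ => by ring
  simp only [← Finset.mul_sum]
  rw [h3, Nty, Finset.sum_mul, Finset.sum_mul]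
  rw [← Finset.sum_subset (Finset.subset_univ A), ← Finset.sum_coe_sort A]
  · refine Finset.sum_congr rfl fun i _ => ?_
    have h4 : ∀ j, (if (i : V) ∈ A ∧ j ∉ A then
        K s(x i, x j) * (TW K (fun v : {v // v ∈ A} => x v) * TW K (fun v : {v // v ∉ A} => x v))
        else 0) = (if j ∈ Aᶜ then K s(x i, x j) else 0) *
          (TW K (fun v : {v // v ∈ A} => x v) * TW K (fun v : {v // v ∉ A} => x v)) := by
      intro j
      by_cases hj : j ∈ A <;> simp [hj, i.2]
    simp only [h4]
    rw [← Finset.sum_mul, Finset.sum_ite_mem, Finset.univ_inter]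
    rw [Finset.sum_subtype (p := fun v => v ∉ A) Aᶜ (by simp)]
    by_cases hr : x i = r
    · simp only [hr, if_true]; ring
    · simp [hr]
  · intro i _ hi
    simp [hi]

/-- the vertex-labelled generating coefficients -/
def GV {S : Type*} [Fintype S] (K : Sym2 S → ℝ) (θ : S → ℝ) (V : Type) [Fintype V] (r : S) : ℝ :=
  ∑ x : V → S, (Nty x r * TW K x) * ∏ v, θ (x v)

lemma GV_def {S : Type*} [Fintype S] (K : Sym2 S → ℝ) (θ : S → ℝ) (V : Type) [Fintype V]
    [DecidableEq V] (r : S) :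
    GV K θ V r = ∑ x : V → S, (Nty x r * TW K x) * ∏ v, θ (x v) := by
  unfold GV
  congr!

lemma Nty_comp_equiv {V W S : Type*} [Fintype V] [Fintype W] (e : V ≃ W) (x : W → S) (r : S) :
    Nty (x ∘ e) r = Nty x r := by
  unfold Nty
  exact Fintype.sum_equiv e _ _ (fun v => rfl)

lemma GV_equiv {S : Type*} [Fintype S] (K : Sym2 S → ℝ) (θ : S → ℝ) {V W : Type} [Fintype V]
    [Fintype W] (e : V ≃ W) (r : S) : GV K θ V r = GV K θ W r := by
  unfold GV
  symm
  refine Fintype.sum_equiv (e.arrowCongr (Equiv.refl S)).symm _ _ (fun x => ?_)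
  have : (e.arrowCongr (Equiv.refl S)).symm x = x ∘ e := by ext; simp
  rw [this, Nty_comp_equiv, TW_comp_equiv]
  congr 1
  symm
  exact Fintype.prod_equiv e _ _ (fun v => rfl)

lemma GV_fin {S : Type*} [Fintype S] (K : Sym2 S → ℝ) (θ : S → ℝ) {V : Type} [Fintype V] (r : S) :
    GV K θ V r = GV K θ (Fin (Fintype.card V)) r := GV_equiv K θ (Fintype.equivFin V) r

lemma GV_rec1 {S : Type*} [Fintype S] (K : Sym2 S → ℝ) (θ : S → ℝ) (V : Type) [Fintype V] (r : S) :
    ((Fintype.card V : ℝ) - 1) * GV K θ V r =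
    ∑ A : Finset V, GV K θ {v // v ∈ A} r *
      ((Fintype.card {v // v ∉ A} : ℝ) * ∑ s, K s(r, s) * GV K θ {v // v ∉ A} s) := by
  rw [GV_def, Finset.mul_sum]
  have h : ∀ x : V → S, ((Fintype.card V : ℝ) - 1) * ((Nty x r * TW K x) * ∏ v, θ (x v)) =
    ∑ A : Finset V, ((Nty (fun v : {v // v ∈ A} => x v) r * TW K (fun v : {v // v ∈ A} => x v)) *
        ∏ v : {v // v ∈ A}, θ (x v)) *
      ((Fintype.card {v // v ∉ A} : ℝ) * ∑ s, K s(r, s) *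
        ((Nty (fun v : {v // v ∉ A} => x v) s * TW K (fun v : {v // v ∉ A} => x v)) *
          ∏ v : {v // v ∉ A}, θ (x v))) := by
    intro x
    rw [← mul_assoc, TW_rec_fixed, Finset.sum_mul]
    refine Finset.sum_congr rfl fun A _ => ?_
    have hp : ∏ v, θ (x v) = (∏ v : {v // v ∈ A}, θ (x v)) * ∏ v : {v // v ∉ A}, θ (x v) := by
      convert (Fintype.prod_subtype_mul_prod_subtype (fun v => v ∈ A) (fun v => θ (x v))).symm
    rw [hp]
    simp only [Finset.mul_sum, Finset.sum_mul]
    refine Finset.sum_congr rfl fun s _ => by ring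
  simp_rw [h]
  rw [Finset.sum_comm]
  refine Finset.sum_congr rfl fun A _ => ?_
  refine (Fintype.sum_equiv (Equiv.piEquivPiSubtypeProd (fun v => v ∈ A) (fun _ => S)) _
    (fun p => ((Nty p.1 r * TW K p.1) * ∏ v, θ (p.1 v)) *
      ((Fintype.card {v // v ∉ A} : ℝ) * ∑ s, K s(r, s) *
        ((Nty p.2 s * TW K p.2) * ∏ v, θ (p.2 v)))) (fun x => rfl)).trans ?_
  rw [Fintype.sum_prod_type]
  trans (∑ y : {v // v ∈ A} → S, ∑ z : {v // v ∉ A} → S, ((Nty y r * TW K y) * ∏ v, θ (y v)) *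
      ((Fintype.card {v // v ∉ A} : ℝ) * ∑ s, K s(r, s) *
        ((Nty z s * TW K z) * ∏ v, θ (z v))))
  · congr!
  rw [GV_def, Finset.sum_mul]
  refine Finset.sum_congr rfl fun y _ => ?_
  rw [← Finset.mul_sum, ← Finset.mul_sum]
  congr 2
  rw [Finset.sum_comm]
  refine Finset.sum_congr rfl fun s _ => ?_
  rw [← Finset.mul_sum, GV_def]

lemma GV_rec2 {S : Type*} [Fintype S] (K : Sym2 S → ℝ) (θ : S → ℝ) (n : ℕ) (r : S) :
    ((n : ℝ) - 1) * GV K θ (Fin n) r =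
    ∑ m ∈ Finset.range (n + 1), (n.choose m : ℝ) * (GV K θ (Fin m) r *
      (((n - m : ℕ) : ℝ) * ∑ s, K s(r, s) * GV K θ (Fin (n - m)) s)) := by
  have h := GV_rec1 K θ (Fin n) r
  rw [Fintype.card_fin] at h
  rw [h]
  have h2 : ∀ A : Finset (Fin n), GV K θ {v // v ∈ A} r *
      ((Fintype.card {v // v ∉ A} : ℝ) * ∑ s, K s(r, s) * GV K θ {v // v ∉ A} s) =
      (fun m => GV K θ (Fin m) r *
      (((n - m : ℕ) : ℝ) * ∑ s, K s(r, s) * GV K θ (Fin (n - m)) s)) A.card := by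
    intro A
    have e1 : Fintype.card {v // v ∈ A} = A.card := Fintype.card_coe A
    have e2 : Fintype.card {v // v ∉ A} = n - A.card := by
      rw [Fintype.card_subtype_compl, e1, Fintype.card_fin]
    simp only [GV_equiv K θ (Fintype.equivFinOfCardEq e1), GV_equiv K θ (Fintype.equivFinOfCardEq e2), e2]
  trans (∑ A : Finset (Fin n), (fun m => GV K θ (Fin m) r *
      (((n - m : ℕ) : ℝ) * ∑ s, K s(r, s) * GV K θ (Fin (n - m)) s)) A.card)
  · refine Finset.sum_congr rfl fun A _ => ?_
    convert h2 A
  rw [← Finset.powerset_univ, Finset.sum_powerset_apply_card (fun m => GV K θ (Fin m) r *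
      (((n - m : ℕ) : ℝ) * ∑ s, K s(r, s) * GV K θ (Fin (n - m)) s))]
  simp

/-- kernel as a function on unordered pairs -/
def KS {S : Type*} (κ : S → S → ℝ) (h : ∀ r s, κ r s = κ s r) : Sym2 S → ℝ :=
  Sym2.lift ⟨κ, h⟩

/-- type of a vector -/
def ty {V S : Type*} [Fintype V] (x : V → S) (r : S) : ℕ := (Finset.univ.filter (fun v => x v = r)).card

lemma Nty_eq {V S : Type*} [Fintype V] (x : V → S) (r : S) : Nty x r = ty x r := by
  unfold Nty ty
  rw [Finset.sum_boole]

lemma graphOf_edges {n : ℕ} (E : Finset (Fin n × Fin n)) (hE : E ⊆ upperPairs n) :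
    Finset.univ.filter (fun e : Sym2 (Fin n) => e ∈ (graphOf E).edgeSet) =
      E.image (fun q => s(q.1, q.2)) := by
  ext e
  induction e with | _ a b =>
  have hadj : (graphOf E).Adj a b ↔ a ≠ b ∧ ((a, b) ∈ E ∨ (b, a) ∈ E) := by
    unfold graphOf
    rw [SimpleGraph.fromRel_adj]
  rw [Finset.mem_filter, Finset.mem_image, SimpleGraph.mem_edgeSet, hadj]
  simp only [Finset.mem_univ, true_and]
  constructor
  · rintro ⟨_, h | h⟩
    · exact ⟨_, h, rfl⟩
    · exact ⟨_, h, Sym2.eq_swap⟩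
  · rintro ⟨⟨c, d⟩, h, h2⟩
    have h3 : c < d := by
      have := hE h
      simpa [upperPairs] using this
    rw [Sym2.eq_iff] at h2
    rcases h2 with ⟨rfl, rfl⟩ | ⟨rfl, rfl⟩
    · exact ⟨h3.ne, Or.inl h⟩
    · exact ⟨h3.ne', Or.inr h⟩

lemma graphOf_inj {n : ℕ} (E : Finset (Fin n × Fin n)) (hE : E ⊆ upperPairs n) :
    Set.InjOn (fun q : Fin n × Fin n => s(q.1, q.2)) E := by
  rintro ⟨a, b⟩ h1 ⟨c, d⟩ h2 h
  have h3 : a < b := by simpa [upperPairs] using hE h1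
  have h4 : c < d := by simpa [upperPairs] using hE h2
  simp only [Sym2.eq_iff] at h
  rcases h with ⟨rfl, rfl⟩ | ⟨rfl, rfl⟩
  · rfl
  · exact absurd h3 h4.asymm

lemma treeWeight_eq {S : Type*} (κ : S → S → ℝ) (hs : ∀ r s, κ r s = κ s r) (n : ℕ) (x : Fin n → S) :
    treeWeight n x κ = TW (KS κ hs) x := by
  unfold treeWeight TW
  have hinv : ∀ G : SimpleGraph (Fin n),
      graphOf ((upperPairs n).filter (fun q => G.Adj q.1 q.2)) = G := by
    intro G
    ext a b
    simp only [graphOf, SimpleGraph.fromRel_adj, Finset.mem_filter, upperPairs, Finset.mem_univ,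
      true_and]
    constructor
    · rintro ⟨_, ⟨_, h⟩ | ⟨_, h⟩⟩
      · exact h
      · exact h.symm
    · intro h
      refine ⟨h.ne, ?_⟩
      rcases lt_or_gt_of_ne h.ne with h2 | h2
      · exact Or.inl ⟨h2, h⟩
      · exact Or.inr ⟨h2, h.symm⟩
  have hcard : ∀ E ⊆ upperPairs n, Nat.card (graphOf E).edgeSet = E.card := by
    intro E hE
    rw [natcard_edgeSet, graphOf_edges E hE, Finset.card_image_of_injOn (graphOf_inj E hE)]
  refine Finset.sum_bij' (fun E _ => graphOf E)
    (fun G _ => (upperPairs n).filter (fun q => G.Adj q.1 q.2)) ?_ ?_ ?_ ?_ ?_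
  · intro E hE
    simp only [Finset.mem_filter, Finset.mem_powerset, Finset.mem_univ, true_and] at hE ⊢
    rw [SimpleGraph.isTree_iff_connected_and_card]
    exact ⟨hE.2.1, by rw [hcard E hE.1, hE.2.2, Nat.card_fin]⟩
  · intro G hG
    simp only [Finset.mem_filter, Finset.mem_powerset, Finset.mem_univ, true_and] at hG ⊢
    rw [SimpleGraph.isTree_iff_connected_and_card] at hG
    refine ⟨Finset.filter_subset _ _, by rw [hinv]; exact hG.1, ?_⟩
    rw [← hcard _ (Finset.filter_subset _ _), hinv, hG.2, Nat.card_fin]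
  · intro E hE
    simp only [Finset.mem_filter, Finset.mem_powerset] at hE
    ext ⟨a, b⟩
    simp only [Finset.mem_filter, graphOf, SimpleGraph.fromRel_adj]
    constructor
    · rintro ⟨h1, h2, h | h⟩
      · exact h
      · have h3 := hE.1 h
        simp only [upperPairs, Finset.mem_filter, Finset.mem_univ, true_and] at h1 h3
        exact absurd h1 h3.asymm
    · intro h
      have h3 := hE.1 h
      refine ⟨h3, ?_, Or.inl h⟩
      simp only [upperPairs, Finset.mem_filter, Finset.mem_univ, true_and] at h3
      exact h3.ne
  · intro G _; exact hinv G
  · intro E hE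
    simp only [Finset.mem_filter, Finset.mem_powerset] at hE
    unfold gwt
    rw [graphOf_edges E hE.1, Finset.prod_image (graphOf_inj E hE.1)]
    refine Finset.prod_congr rfl fun q _ => ?_
    simp [KS]

lemma exists_equiv_of_ty {V W S : Type*} [Fintype V] [Fintype W] (x : V → S) (y : W → S)
    (h : ∀ r, ty x r = ty y r) : ∃ e : V ≃ W, x = y ∘ e := by
  have h2 : ∀ s, Nonempty ({v // x v = s} ≃ {w // y w = s}) := by
    intro s
    refine ⟨Fintype.equivOfCardEq ?_⟩
    rw [Fintype.card_subtype, Fintype.card_subtype]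
    exact h s
  let f := fun s => (h2 s).some
  let e : V ≃ W := (Equiv.sigmaFiberEquiv x).symm.trans ((Equiv.sigmaCongrRight f).trans
    (Equiv.sigmaFiberEquiv y))
  refine ⟨e, ?_⟩
  ext v
  have : e v = (f (x v) ⟨v, rfl⟩ : W) := rfl
  rw [Function.comp, this]
  exact (f (x v) ⟨v, rfl⟩).2.symm

lemma ty_compatVec {S : Type*} [Fintype S] (k : S → ℕ) (r : S) : ty (compatVec k) r = k r := by
  have h1 : (Finset.univ.val.map (compatVec k) : Multiset S) = (compatList k : Multiset S) := by
    rw [Fin.univ_val_map]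
    congr 1
    apply List.ext_get
    · simp [compatList_length]
    · intro i h1 h2
      simp [compatVec]
  have h2 : Multiset.count r (Finset.univ.val.map (compatVec k) : Multiset S) = k r := by
    rw [h1]
    simp only [compatList, Multiset.coe_toList]
    rw [Multiset.count_sum']
    simp [Multiset.count_singleton]
  rw [← h2, Multiset.count_map, ty]
  simp only [Finset.card, Finset.filter]
  congr 1
  refine Multiset.filter_congr fun v _ => eq_comm

lemma tau_eq {S : Type*} [Fintype S] (κ : S → S → ℝ) (hs : ∀ r s, κ r s = κ s r) {V : Type*}
    [Fintype V] (x : V → S) : tau κ (ty x) = TW (KS κ hs) x := by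
  unfold tau
  rw [treeWeight_eq κ hs]
  obtain ⟨e, he⟩ := exists_equiv_of_ty (compatVec (ty x)) x (fun r => ty_compatVec _ _)
  rw [he, TW_comp_equiv]

lemma prod_comp_ty {V S M : Type*} [Fintype V] [Fintype S] [CommMonoid M] (x : V → S) (θ : S → M) :
    ∏ v, θ (x v) = ∏ s, θ s ^ ty x s := by
  rw [← Finset.prod_fiberwise_of_maps_to (s := Finset.univ) (t := Finset.univ) (g := x)
    (fun _ _ => Finset.mem_univ _)]
  refine Finset.prod_congr rfl fun s _ => ?_
  rw [Finset.prod_congr rfl (g := fun _ => θ s)]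
  · simp [ty]
  · intro v hv
    rw [(Finset.mem_filter.1 hv).2]

lemma sum_ty {V S : Type*} [Fintype V] [Fintype S] (x : V → S) : ∑ s, ty x s = Fintype.card V := by
  unfold ty
  rw [← Finset.card_univ, Finset.card_eq_sum_card_fiberwise (f := x) (t := Finset.univ)]
  intro v _; simp

lemma card_ty {S : Type*} [Fintype S] (n : ℕ) (k : S → ℕ) (hk : ∑ s, k s = n) :
    (Finset.univ.filter (fun x : Fin n → S => ty x = k)).card = Nat.multinomial Finset.univ k := by
  have h1 := Finset.sum_pow_eq_sum_piAntidiag (Finset.univ : Finset S)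
    (fun s => (MvPolynomial.X s : MvPolynomial S ℚ)) n
  rw [Fintype.sum_pow] at h1
  simp only [prod_comp_ty] at h1
  have hM : ∀ k' : S → ℕ, (∏ s, (MvPolynomial.X s : MvPolynomial S ℚ) ^ k' s) =
      MvPolynomial.monomial (Finsupp.equivFunOnFinite.symm k') 1 := by
    intro k'
    rw [MvPolynomial.monomial_eq, Finsupp.prod_fintype _ _ (by simp)]
    simp
  simp only [hM] at h1
  have h2 := congrArg (MvPolynomial.coeff (Finsupp.equivFunOnFinite.symm k)) h1
  simp only [MvPolynomial.coeff_sum, MvPolynomial.coeff_monomial,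
    EmbeddingLike.apply_eq_iff_eq] at h2
  rw [Finset.sum_boole] at h2
  have h3 : ∀ k' : S → ℕ, MvPolynomial.coeff (Finsupp.equivFunOnFinite.symm k)
      ((Nat.multinomial Finset.univ k' : MvPolynomial S ℚ) *
        MvPolynomial.monomial (Finsupp.equivFunOnFinite.symm k') 1) =
      if k' = k then (Nat.multinomial Finset.univ k' : ℚ) else 0 := by
    intro k'
    have : (Nat.multinomial Finset.univ k' : MvPolynomial S ℚ) =
      MvPolynomial.C (Nat.multinomial Finset.univ k' : ℚ) := by simp
    rw [this, MvPolynomial.coeff_C_mul, MvPolynomial.coeff_monomial]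
    simp
  simp only [h3] at h2
  rw [Finset.sum_ite_eq' _ k, if_pos] at h2
  · exact_mod_cast h2
  · rw [Finset.mem_piAntidiag]; exact ⟨hk, by simp⟩

/-- coefficients by size -/
def gco {S : Type*} [Fintype S] (κ : S → S → ℝ) (θ : S → ℝ) (r : S) (n : ℕ) : ℝ :=
  ∑ k ∈ Finset.piAntidiag Finset.univ n, rhoMu κ θ k * k r

lemma gco_eq {S : Type*} [Fintype S] (κ : S → S → ℝ) (hs : ∀ r s, κ r s = κ s r) (θ : S → ℝ) (r : S)
    (n : ℕ) : (n.factorial : ℝ) * gco κ θ r n = GV (KS κ hs) θ (Fin n) r := by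
  rw [GV_def, gco]
  rw [← Finset.sum_fiberwise_of_maps_to (s := Finset.univ)
    (t := Finset.piAntidiag (Finset.univ : Finset S) n) (g := fun x : Fin n → S => ty x)]
  · rw [Finset.mul_sum]
    refine Finset.sum_congr rfl fun k hk => ?_
    rw [Finset.mem_piAntidiag] at hk
    rw [Finset.sum_congr rfl (g := fun _ => ((k r : ℝ) * tau κ k) * ∏ s, θ s ^ k s)]
    · rw [Finset.sum_const, card_ty n k hk.1, nsmul_eq_mul, rhoMu, Finset.prod_div_distrib]
      have := Nat.multinomial_spec Finset.univ k
      rw [hk.1] at this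
      rw [← this]
      push_cast
      have h0 : (∏ s, ((k s).factorial : ℝ)) ≠ 0 :=
        Finset.prod_ne_zero_iff.2 fun s _ => by positivity
      field_simp
    · intro x hx
      rw [← (Finset.mem_filter.1 hx).2, tau_eq κ hs, Nty_eq, prod_comp_ty]
  · intro x _
    rw [Finset.mem_piAntidiag]
    exact ⟨by rw [sum_ty]; simp, by simp⟩

lemma gco_zero {S : Type*} [Fintype S] (κ : S → S → ℝ) (θ : S → ℝ) (r : S) : gco κ θ r 0 = 0 := by
  simp [gco, Finset.piAntidiag_zero]

lemma tau_zero {S : Type*} [Fintype S] (κ : S → S → ℝ) : tau κ 0 = 0 := by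
  unfold tau treeWeight
  refine Finset.sum_eq_zero fun E hE => ?_
  have := (Finset.mem_filter.1 hE).2.2
  simp at this

lemma tau_nonneg {S : Type*} [Fintype S] (κ : S → S → ℝ) (hκ0 : ∀ r s, 0 ≤ κ r s) (k : S → ℕ) :
    0 ≤ tau κ k := Finset.sum_nonneg fun _ _ => Finset.prod_nonneg fun _ _ => hκ0 _ _

lemma TW_subsingleton {V S : Type*} [Fintype V] [Subsingleton V] [Nonempty V] (K : Sym2 S → ℝ) (x : V → S) :
    TW K x = 1 := by
  unfold TW gwt
  have h : Finset.univ.filter (fun G : SimpleGraph V => G.IsTree) = {⊥} := by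
    ext G
    simp only [Finset.mem_filter, Finset.mem_univ, true_and, Finset.mem_singleton]
    constructor
    · intro _; ext a b; simp [Subsingleton.elim a b]
    · rintro rfl; exact SimpleGraph.IsTree.of_subsingleton
  rw [h]
  simp

lemma gco_one {S : Type*} [Fintype S] (κ : S → S → ℝ) (hs : ∀ r s, κ r s = κ s r) (θ : S → ℝ) (r : S) :
    gco κ θ r 1 = θ r := by
  have h := gco_eq κ hs θ r 1
  rw [Nat.factorial_one, Nat.cast_one, one_mul] at h
  rw [h, GV_def]
  simp only [TW_subsingleton, Nty]
  rw [Fintype.sum_equiv (Equiv.funUnique (Fin 1) S) _ (fun s => (if s = r then 1 else 0) * θ s)]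
  · simp
  · intro x; by_cases hx : x 0 = r <;> simp [Equiv.funUnique, hx, Finset.filter_singleton]

lemma gco_rec {S : Type*} [Fintype S] (κ : S → S → ℝ) (hs : ∀ r s, κ r s = κ s r) (θ : S → ℝ) (r : S)
    (n : ℕ) : (n : ℝ) * gco κ θ r (n + 1) = ∑ p ∈ Finset.HasAntidiagonal.antidiagonal n,
      gco κ θ r (p.1 + 1) * ((p.2 : ℝ) * ∑ s, κ r s * gco κ θ s p.2) := by
  have h := GV_rec2 (KS κ hs) θ (n + 1) r
  simp only [← gco_eq κ hs] at h
  have hf : ((n + 1).factorial : ℝ) ≠ 0 := by positivity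
  rw [Finset.sum_range_succ', gco_zero] at h
  rw [Finset.Nat.sum_antidiagonal_eq_sum_range_succ
    (fun i j => gco κ θ r (i + 1) * ((j : ℝ) * ∑ s, κ r s * gco κ θ s j))]
  apply mul_left_cancel₀ hf
  rw [Finset.mul_sum]
  push_cast at h ⊢
  trans ((n : ℝ) + 1 - 1) * (((n + 1).factorial : ℝ) * gco κ θ r (n + 1))
  · ring
  rw [h]
  simp only [mul_zero, zero_mul, add_zero]
  refine Finset.sum_congr rfl fun m hm => ?_
  have hm' : m + 1 ≤ n + 1 := by simp at hm; omega
  rw [← Nat.choose_mul_factorial_mul_factorial hm']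
  have e : n + 1 - (m + 1) = n - m := by omega
  rw [e]
  simp only [Finset.mul_sum]
  refine Finset.sum_congr rfl fun s _ => ?_
  simp only [KS, Sym2.lift_mk]
  push_cast
  ring

/-- exhausting finsets -/
def BN (S : Type*) [Fintype S] (N : ℕ) : Finset (S → ℕ) :=
  (Finset.range N).biUnion (fun n => Finset.piAntidiag Finset.univ n)

lemma mem_BN {S : Type*} [Fintype S] {N : ℕ} {k : S → ℕ} : k ∈ BN S N ↔ ∑ s, k s < N := by
  simp [BN, Finset.mem_piAntidiag]

lemma BN_mono {S : Type*} [Fintype S] : Monotone (BN S) := by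
  intro M N h k hk
  rw [mem_BN] at *
  omega

lemma tendsto_BN {S : Type*} [Fintype S] : Tendsto (BN S) atTop atTop :=
  tendsto_atTop_finset_of_monotone BN_mono fun k => ⟨∑ s, k s + 1, mem_BN.2 (Nat.lt_succ_self _)⟩

lemma sum_BN {S : Type*} [Fintype S] (f : (S → ℕ) → ℝ) (N : ℕ) :
    ∑ k ∈ BN S N, f k = ∑ n ∈ Finset.range N, ∑ k ∈ Finset.piAntidiag Finset.univ n, f k := by
  unfold BN
  rw [Finset.sum_biUnion]
  intro m _ n _ hmn
  rw [Function.onFun, Finset.disjoint_left]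
  intro k hk hk2
  rw [Finset.mem_piAntidiag] at hk hk2
  exact hmn (hk.1.symm.trans hk2.1)

lemma exists_BN {S : Type*} [Fintype S] (A : Finset (S → ℕ)) : ∃ N, A ⊆ BN S N := by
  refine ⟨A.sup (fun k => ∑ s, k s) + 1, fun k hk => mem_BN.2 ?_⟩
  exact Nat.lt_succ_of_le (Finset.le_sup (f := fun k : S → ℕ => ∑ s, k s) hk)

lemma summable_of_BN {S : Type*} [Fintype S] {f : (S → ℕ) → ℝ} (hf : ∀ k, 0 ≤ f k) {C : ℝ}
    (h : ∀ N, ∑ k ∈ BN S N, f k ≤ C) : Summable f ∧ ∑' k, f k ≤ C := by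
  have h2 : ∀ A : Finset (S → ℕ), ∑ k ∈ A, f k ≤ C := fun A => by
    obtain ⟨N, hN⟩ := exists_BN A
    exact (Finset.sum_le_sum_of_subset_of_nonneg hN fun k _ _ => hf k).trans (h N)
  exact ⟨summable_of_sum_le hf h2, Real.tsum_le_of_sum_le hf h2⟩

lemma hasSum_piAnti {S : Type*} [Fintype S] {f : (S → ℕ) → ℝ} (hf : ∀ k, 0 ≤ f k) {x : ℝ}
    (h : HasSum f x) : HasSum (fun n => ∑ k ∈ Finset.piAntidiag Finset.univ n, f k) x := by
  rw [hasSum_iff_tendsto_nat_of_nonneg (fun n => Finset.sum_nonneg fun k _ => hf k)]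
  have := h.comp (tendsto_BN (S := S))
  refine this.congr fun N => ?_
  exact sum_BN f N

lemma rho_nonneg {S : Type*} [Fintype S] {κ : S → S → ℝ} (hκ0 : ∀ r s, 0 ≤ κ r s)
    {θ : S → ℝ} (hθ : ∀ r, 0 ≤ θ r) (k : S → ℕ) : 0 ≤ rhoMu κ θ k :=
  mul_nonneg (tau_nonneg κ hκ0 k)
    (Finset.prod_nonneg fun s _ => div_nonneg (pow_nonneg (hθ s) _) (by positivity))

lemma rho_zero {S : Type*} [Fintype S] (κ : S → S → ℝ) (θ : S → ℝ) : rhoMu κ θ 0 = 0 := by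
  rw [rhoMu, tau_zero, zero_mul]

lemma gco_nonneg {S : Type*} [Fintype S] {κ : S → S → ℝ} (hκ0 : ∀ r s, 0 ≤ κ r s)
    {θ : S → ℝ} (hθ : ∀ r, 0 ≤ θ r) (r : S) (n : ℕ) : 0 ≤ gco κ θ r n :=
  Finset.sum_nonneg fun k _ => mul_nonneg (rho_nonneg hκ0 hθ k) (Nat.cast_nonneg _)

lemma gco_upper {S : Type*} [Fintype S] {κ : S → S → ℝ} (hs : ∀ r s, κ r s = κ s r)
    (hκ0 : ∀ r s, 0 ≤ κ r s) {θ b : S → ℝ} (hθ : ∀ r, 0 ≤ θ r) (hb : ∀ r, 0 ≤ b r)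
    (h : ∀ r, θ r * Real.exp (∑ s, κ r s * b s) ≤ b r) (N : ℕ) :
    ∀ r, ∑ n ∈ Finset.range N, gco κ θ r n ≤ b r := by
  induction N with
  | zero => intro r; simpa using hb r
  | succ N ih =>
    intro r
    rw [Finset.sum_range_succ', gco_zero, add_zero]
    rcases Nat.eq_zero_or_pos N with rfl | hN
    · simpa using hb r
    set a : ℕ → ℝ := fun n => if n ∈ Finset.range N then gco κ θ r (n + 1) else 0 with ha
    set e : ℕ → ℝ := fun n => if n ∈ Finset.range N then ∑ s, κ r s * gco κ θ s n else 0 with he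
    have hsa : HasSum a (∑ n ∈ Finset.range N, gco κ θ r (n + 1)) := by
      have : HasSum a (∑ n ∈ Finset.range N, a n) := hasSum_sum_of_ne_finset_zero
        (fun n hn => by simp only [ha, if_neg hn])
      rwa [Finset.sum_congr rfl (g := fun n => gco κ θ r (n + 1)) (fun n hn => by simp only [ha, if_pos hn])] at this
    have hse : HasSum e (∑ n ∈ Finset.range N, ∑ s, κ r s * gco κ θ s n) := by
      have : HasSum e (∑ n ∈ Finset.range N, e n) := hasSum_sum_of_ne_finset_zero
        (fun n hn => by simp only [he, if_neg hn])
      rwa [Finset.sum_congr rfl (g := fun n => ∑ s, κ r s * gco κ θ s n)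
        (fun n hn => by simp only [he, if_pos hn])] at this
    have ha0 : ∀ n, 0 ≤ a n := fun n => by
      simp only [ha]; split_ifs
      · exact gco_nonneg hκ0 hθ _ _
      · exact le_rfl
    have he0 : ∀ n, 0 ≤ e n := fun n => by
      simp only [he]; split_ifs
      · exact Finset.sum_nonneg fun s _ => mul_nonneg (hκ0 r s) (gco_nonneg hκ0 hθ _ _)
      · exact le_rfl
    have key := ode_le ha0 hsa.summable he0 hse.summable (by simp [he, gco_zero]) (by
      intro n
      by_cases hn : n ∈ Finset.range N
      · simp only [ha, if_pos hn]
        rw [gco_rec κ hs]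
        refine le_of_eq (Finset.sum_congr rfl fun p hp => ?_)
        rw [Finset.HasAntidiagonal.mem_antidiagonal] at hp
        rw [Finset.mem_range] at hn
        have h1 : p.1 ∈ Finset.range N := Finset.mem_range.2 (by omega)
        have h2 : p.2 ∈ Finset.range N := Finset.mem_range.2 (by omega)
        simp only [he, if_pos h1, if_pos h2]
      · have : a n = 0 := by simp only [ha, if_neg hn]
        rw [this, mul_zero]
        exact Finset.sum_nonneg fun p _ => mul_nonneg (ha0 _) (mul_nonneg (Nat.cast_nonneg _) (he0 _)))
    rw [hsa.tsum_eq, hse.tsum_eq] at key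
    have ha1 : a 0 = θ r := by
      simp only [ha, Finset.mem_range, if_pos hN, zero_add, gco_one κ hs]
    rw [ha1] at key
    refine key.trans (le_trans ?_ (h r))
    refine mul_le_mul_of_nonneg_left (Real.exp_le_exp.2 ?_) (hθ r)
    rw [Finset.sum_comm]
    refine Finset.sum_le_sum fun s _ => ?_
    rw [← Finset.mul_sum]
    exact mul_le_mul_of_nonneg_left (ih s) (hκ0 r s)

lemma gam_upper {S : Type*} [Fintype S] {κ : S → S → ℝ} (hs : ∀ r s, κ r s = κ s r)
    (hκ0 : ∀ r s, 0 ≤ κ r s) {θ b : S → ℝ} (hθ : ∀ r, 0 ≤ θ r) (hb : ∀ r, 0 ≤ b r)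
    (h : ∀ r, θ r * Real.exp (∑ s, κ r s * b s) ≤ b r) (r : S) :
    Summable (fun k : S → ℕ => rhoMu κ θ k * k r) ∧ ∑' k : S → ℕ, rhoMu κ θ k * k r ≤ b r := by
  apply summable_of_BN
  · intro k; exact mul_nonneg (rho_nonneg hκ0 hθ k) (Nat.cast_nonneg _)
  · intro N
    rw [sum_BN]
    exact gco_upper hs hκ0 hθ hb h N r

lemma gam_lower {S : Type*} [Fintype S] {κ : S → S → ℝ} (hs : ∀ r s, κ r s = κ s r)
    (hκ0 : ∀ r s, 0 ≤ κ r s) {θ g : S → ℝ} (hθ : ∀ r, 0 ≤ θ r)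
    (h : ∀ r, HasSum (fun k : S → ℕ => rhoMu κ θ k * k r) (g r)) (r : S) :
    θ r * Real.exp (∑ s, κ r s * g s) ≤ g r := by
  have hg : ∀ r, HasSum (gco κ θ r) (g r) := fun r =>
    hasSum_piAnti (fun k => mul_nonneg (rho_nonneg hκ0 hθ k) (Nat.cast_nonneg _)) (h r)
  have hsa : HasSum (fun n => gco κ θ r (n + 1)) (g r) := by
    have := (hasSum_nat_add_iff' 1).2 (hg r)
    simpa [gco_zero] using this
  have hse : HasSum (fun n => ∑ s, κ r s * gco κ θ s n) (∑ s, κ r s * g s) :=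
    hasSum_sum fun s _ => (hg s).mul_left _
  have key := ode_ge (fun n => gco_nonneg hκ0 hθ r (n + 1)) hsa.summable
    (fun n => Finset.sum_nonneg fun s _ => mul_nonneg (hκ0 r s) (gco_nonneg hκ0 hθ _ _))
    hse.summable (by simp [gco_zero]) (fun n => (gco_rec κ hs θ r n).ge)
  rwa [hsa.tsum_eq, hse.tsum_eq, zero_add, gco_one κ hs] at key

/-- critical activity -/
def thS {S : Type*} [Fintype S] (κ : S → S → ℝ) (b : S → ℝ) (r : S) : ℝ :=
  b r * Real.exp (-(∑ s, κ r s * b s))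

lemma thS_nonneg {S : Type*} [Fintype S] {κ : S → S → ℝ} {b : S → ℝ} (hb : ∀ r, 0 ≤ b r) (r : S) :
    0 ≤ thS κ b r := mul_nonneg (hb r) (Real.exp_pos _).le

lemma gam_b {S : Type*} [Fintype S] {κ : S → S → ℝ} (hs : ∀ r s, κ r s = κ s r)
    (hκ0 : ∀ r s, 0 ≤ κ r s) {b : S → ℝ} (hb : ∀ r, 0 ≤ b r) (hQ : QBd κ b) (r : S) :
    HasSum (fun k : S → ℕ => rhoMu κ (thS κ b) k * k r) (b r) := by
  have hup := gam_upper hs hκ0 (thS_nonneg (κ := κ) hb) hb (fun r => by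
    rw [thS, mul_assoc, ← Real.exp_add]; simp)
  set g : S → ℝ := fun r => ∑' k : S → ℕ, rhoMu κ (thS κ b) k * k r with hg
  have hg' : ∀ r, HasSum (fun k : S → ℕ => rhoMu κ (thS κ b) k * k r) (g r) :=
    fun r => (hup r).1.hasSum
  have hlow := gam_lower hs hκ0 (thS_nonneg hb) hg'
  have := hQ.eq_zero hκ0 hb (h := fun r => b r - g r) (fun r => sub_nonneg.2 (hup r).2) (fun r => by
    have := hlow r
    rw [thS, mul_assoc, ← Real.exp_add] at this
    have e : -∑ s, κ r s * (b s - g s) = -(∑ s, κ r s * b s) + ∑ s, κ r s * g s := by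
      simp only [mul_sub, Finset.sum_sub_distrib]; ring
    rw [e]
    linarith)
  have e : g r = b r := by have := this r; linarith
  rw [← e]; exact hg' r

lemma le_sum_k {S : Type*} [Fintype S] {k : S → ℕ} (hk : k ≠ 0) : (1 : ℝ) ≤ ∑ r, (k r : ℝ) := by
  have : ∑ r, k r ≠ 0 := by
    intro h
    apply hk
    funext r
    exact (Finset.sum_eq_zero_iff.1 h) r (Finset.mem_univ r)
  exact_mod_cast Nat.one_le_iff_ne_zero.2 this

lemma summable_of_moments {S : Type*} [Fintype S] {l : (S → ℕ) → ℝ} (hl : ∀ k, 0 ≤ l k) (h0 : l 0 = 0)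
    (h : ∀ r, Summable (fun k : S → ℕ => l k * k r)) : Summable l := by
  refine Summable.of_nonneg_of_le hl (fun k => ?_) (summable_sum (s := Finset.univ) fun r _ => h r)
  rw [← Finset.mul_sum]
  by_cases hk : k = 0
  · rw [hk, h0]; simp
  · exact le_mul_of_one_le_right (hl k) (le_sum_k hk)

lemma rho_smul {S : Type*} [Fintype S] (κ : S → S → ℝ) (θ : S → ℝ) (t : ℝ) (k : S → ℕ) :
    rhoMu κ (fun s => t * θ s) k = t ^ (∑ s, k s) * rhoMu κ θ k := by
  unfold rhoMu
  simp only [mul_pow, mul_div_assoc]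
  rw [Finset.prod_mul_distrib, Finset.prod_pow_eq_pow_sum]
  ring

lemma critC {S : Type*} [Fintype S] {κ : S → S → ℝ} (hs : ∀ r s, κ r s = κ s r)
    (hκ0 : ∀ r s, 0 ≤ κ r s) {b u θ : S → ℝ} (hb : ∀ r, 0 ≤ b r) (hu : ∀ r, 0 ≤ u r)
    (hub : ∀ r, u r = b r * ∑ s, κ r s * u s) (hθ : ∀ r, 0 ≤ θ r) (hθb : ∀ r, 0 < b r → 0 < θ r)
    (hZ : Summable (rhoMu κ θ)) :
    ∑ r, u r * (Real.log (θ r) - (Real.log (b r) - ∑ s, κ r s * b s)) ≤ 0 := by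
  set X := ∑ r, u r * (Real.log (θ r) - (Real.log (b r) - ∑ s, κ r s * b s)) with hX
  have key : ∀ t : ℝ, 0 < t → t < 1 → (∑ r, u r) * Real.log t + X ≤ 0 := by
    intro t ht0 ht1
    obtain ⟨C, hC⟩ := (tendsto_self_mul_const_pow_of_lt_one ht0.le ht1).bddAbove_range
    have hsm : ∀ r, Summable (fun k : S → ℕ => rhoMu κ (fun s => t * θ s) k * k r) := by
      intro r
      refine Summable.of_nonneg_of_le (fun k => mul_nonneg (rho_nonneg hκ0
        (fun s => mul_nonneg ht0.le (hθ s)) k) (Nat.cast_nonneg _)) (fun k => ?_) (hZ.mul_left C)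
      rw [rho_smul]
      have h1 : ((∑ s, k s : ℕ) : ℝ) * t ^ (∑ s, k s) ≤ C := hC ⟨∑ s, k s, rfl⟩
      have h2 : (k r : ℝ) ≤ ((∑ s, k s : ℕ) : ℝ) := by
        exact_mod_cast Finset.single_le_sum (f := k) (fun s _ => Nat.zero_le _) (Finset.mem_univ r)
      have h3 : t ^ (∑ s, k s) * (k r : ℝ) ≤ C := by
        refine le_trans ?_ h1
        rw [mul_comm]
        exact mul_le_mul_of_nonneg_right h2 (by positivity)
      calc _ = (t ^ (∑ s, k s) * (k r : ℝ)) * rhoMu κ θ k := by ring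
        _ ≤ _ := mul_le_mul_of_nonneg_right h3 (rho_nonneg hκ0 hθ k)
    set g : S → ℝ := fun r => ∑' k : S → ℕ, rhoMu κ (fun s => t * θ s) k * k r with hg
    have hlow := gam_lower hs hκ0 (fun s => mul_nonneg ht0.le (hθ s)) (fun r => (hsm r).hasSum)
    change ∀ r, t * θ r * Real.exp (∑ s, κ r s * g s) ≤ g r at hlow
    have hg0 : ∀ r, 0 ≤ g r := fun r =>
      le_trans (mul_nonneg (mul_nonneg ht0.le (hθ r)) (Real.exp_pos _).le) (hlow r)
    have hterm : ∀ r, u r * (Real.log t + (Real.log (θ r) - (Real.log (b r) - ∑ s, κ r s * b s))) ≤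
        (∑ s, κ r s * u s) * (g r - b r) - u r * ∑ s, κ r s * (g s - b s) := by
      intro r
      have hsplit : ∑ s, κ r s * (g s - b s) = ∑ s, κ r s * g s - ∑ s, κ r s * b s := by
        simp only [mul_sub, Finset.sum_sub_distrib]
      rcases (hu r).eq_or_lt with h0 | h0
      · rw [← h0, zero_mul, zero_mul, sub_zero]
        have := hub r
        rw [← h0] at this
        rcases mul_eq_zero.1 this.symm with h1 | h1
        · rw [h1, sub_zero]
          exact mul_nonneg (Finset.sum_nonneg fun s _ => mul_nonneg (hκ0 r s) (hu s)) (hg0 r)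
        · rw [h1, zero_mul]
      · have hbr : 0 < b r := by
          rcases (hb r).eq_or_lt with h1 | h1
          · have := hub r; rw [← h1, zero_mul] at this; linarith
          · exact h1
        have hθr := hθb r hbr
        have hpos : 0 < t * θ r * Real.exp (∑ s, κ r s * g s) := by positivity
        have hgr : 0 < g r := lt_of_lt_of_le hpos (hlow r)
        have h1 := Real.log_le_log hpos (hlow r)
        rw [Real.log_mul (by positivity) (by positivity), Real.log_mul ht0.ne' hθr.ne', Real.log_exp] at h1
        have h2 := Real.log_le_sub_one_of_pos (div_pos hgr hbr)
        rw [Real.log_div hgr.ne' hbr.ne'] at h2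
        have h3 : u r * (Real.log t + (Real.log (θ r) - (Real.log (b r) - ∑ s, κ r s * b s))) ≤
            u r * ((g r / b r - 1) - (∑ s, κ r s * g s - ∑ s, κ r s * b s)) :=
          mul_le_mul_of_nonneg_left (by linarith) (hu r)
        refine h3.trans (le_of_eq ?_)
        rw [hsplit]
        have h4 : u r * (g r / b r - 1) = (∑ s, κ r s * u s) * (g r - b r) := by
          rw [hub r]; field_simp
        rw [← h4]; ring
    have hsum := Finset.sum_le_sum fun r (_ : r ∈ Finset.univ) => hterm r
    have hz : ∑ r, ((∑ s, κ r s * u s) * (g r - b r) - u r * ∑ s, κ r s * (g s - b s)) = 0 := by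
      rw [Finset.sum_sub_distrib, sub_eq_zero]
      simp only [Finset.sum_mul, Finset.mul_sum]
      rw [Finset.sum_comm]
      refine Finset.sum_congr rfl fun r _ => Finset.sum_congr rfl fun s _ => ?_
      rw [hs s r]; ring
    rw [hz] at hsum
    simp only [mul_add, Finset.sum_add_distrib] at hsum
    rw [← Finset.sum_mul] at hsum
    rw [hX]
    exact hsum
  by_contra hcon
  push Not at hcon
  have hU : 0 ≤ ∑ r, u r := Finset.sum_nonneg fun r _ => hu r
  have := key (Real.exp (-(X / (2 * (∑ r, u r + 1))))) (Real.exp_pos _) (by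
    rw [Real.exp_lt_one_iff]
    have : 0 < X / (2 * (∑ r, u r + 1)) := by positivity
    linarith)
  rw [Real.log_exp] at this
  have h2 : (∑ r, u r) * (X / (2 * (∑ r, u r + 1))) ≤ X / 2 := by
    rw [mul_div_assoc', div_le_div_iff₀ (by positivity) (by positivity)]
    nlinarith
  linarith

/-- activity in exponential coordinates on the support of `d` -/
def thq {S : Type*} (d q : S → ℝ) (r : S) : ℝ := if 0 < d r then Real.exp (q r) else 0

lemma thq_nonneg {S : Type*} (d q : S → ℝ) (r : S) : 0 ≤ thq d q r := by
  unfold thq; split_ifs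
  · exact (Real.exp_pos _).le
  · exact le_rfl

lemma rho_thq_zero {S : Type*} [Fintype S] (κ : S → S → ℝ) (d q : S → ℝ) (k : S → ℕ) {s : S}
    (hk : k s ≠ 0) (hd : ¬ 0 < d s) : rhoMu κ (thq d q) k = 0 := by
  unfold rhoMu
  rw [Finset.prod_eq_zero (Finset.mem_univ s), mul_zero]
  simp [thq, hd, hk]

lemma rho_thq_mu {S : Type*} [Fintype S] (κ : S → S → ℝ) {μ : S → ℝ} (hμ : ∀ r, 0 < μ r)
    (d q : S → ℝ) (k : S → ℕ) (hk : ∀ s, k s ≠ 0 → 0 < d s) :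
    rhoMu κ (thq d q) k = rhoMu κ μ k * Real.exp (∑ s, k s * (q s - Real.log (μ s))) := by
  unfold rhoMu
  rw [Real.exp_sum, mul_assoc, ← Finset.prod_mul_distrib]
  congr 1
  refine Finset.prod_congr rfl fun s _ => ?_
  by_cases h : k s = 0
  · simp [h]
  · rw [thq, if_pos (hk s h), Real.exp_nat_mul, Real.exp_sub, Real.exp_log (hμ s), div_pow]
    have := (hμ s).ne'
    field_simp

lemma rho_thq_thq {S : Type*} [Fintype S] (κ : S → S → ℝ)
    (d q q' : S → ℝ) (k : S → ℕ) :
    rhoMu κ (thq d q') k = rhoMu κ (thq d q) k * Real.exp (∑ s, k s * (q' s - q s)) := by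
  by_cases hk : ∀ s, k s ≠ 0 → 0 < d s
  · rw [rho_thq_mu κ (μ := fun _ => 1) (fun _ => one_pos) d q' k hk,
      rho_thq_mu κ (μ := fun _ => 1) (fun _ => one_pos) d q k hk, mul_assoc, ← Real.exp_add,
      ← Finset.sum_add_distrib]
    congr 3
    funext s
    simp
    ring
  · push Not at hk
    obtain ⟨s, h1, h2⟩ := hk
    rw [rho_thq_zero κ d q k h1 (not_lt.2 h2), rho_thq_zero κ d q' k h1 (not_lt.2 h2), zero_mul]

lemma hasSum_coe_ereal {ι : Type*} {f : ι → ℝ} {a : ℝ} (h : HasSum f a) :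
    HasSum (fun i => (f i : EReal)) (a : EReal) :=
  h.map (⟨⟨((↑) : ℝ → EReal), EReal.coe_zero⟩, EReal.coe_add⟩ : ℝ →+ EReal)
    continuous_coe_real_ereal

lemma hasSum_coe_ennreal_ereal {ι : Type*} {f : ι → ℝ≥0∞} {a : ℝ≥0∞} (h : HasSum f a) :
    HasSum (fun i => (f i : EReal)) (a : EReal) :=
  h.map (⟨⟨((↑) : ℝ≥0∞ → EReal), EReal.coe_ennreal_zero⟩, EReal.coe_ennreal_add⟩ : ℝ≥0∞ →+ EReal)
    continuous_coe_ennreal_ereal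

lemma exists_gap (x : EReal) (l : ℝ) (h : (l : EReal) ≤ x) : ∃ e : ℝ≥0∞, x = (l : EReal) + (e : EReal) := by
  induction x with
  | bot => simp at h
  | coe x =>
    have h' : l ≤ x := by exact_mod_cast h
    refine ⟨ENNReal.ofReal (x - l), ?_⟩
    rw [EReal.coe_ennreal_ofReal, max_eq_left (by linarith), ← EReal.coe_add]
    congr 1; ring
  | top => exact ⟨⊤, by simp⟩

lemma le_tsum_ereal {ι : Type*} {f : ι → EReal} {l : ι → ℝ} {L : ℝ} (hl : HasSum l L)
    (h : ∀ i, (l i : EReal) ≤ f i) : (L : EReal) ≤ ∑' i, f i := by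
  choose e he using fun i => exists_gap (f i) (l i) (h i)
  have h1 := hasSum_coe_ereal hl
  have h2 := hasSum_coe_ennreal_ereal (f := e) (a := ∑' i, e i) ENNReal.summable.hasSum
  have h3 : HasSum f ((L : EReal) + ((∑' i, e i : ℝ≥0∞) : EReal)) := by
    have hc : ContinuousAt (fun p : EReal × EReal => p.1 + p.2)
        ((L : EReal), ((∑' i, e i : ℝ≥0∞) : EReal)) :=
      EReal.continuousAt_add (Or.inl (EReal.coe_ne_top _)) (Or.inl (EReal.coe_ne_bot _))
    have := hc.tendsto.comp (Tendsto.prodMk_nhds h1 h2)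
    refine Tendsto.congr (fun A => ?_) this
    simp only [Function.comp]
    rw [← Finset.sum_add_distrib]
    exact Finset.sum_congr rfl fun i _ => (he i).symm
  rw [h3.tsum_eq]
  exact le_add_of_nonneg_right (EReal.coe_ennreal_nonneg _)

/-- value of the dual problem -/
def FF {S : Type*} [Fintype S] (κ : S → S → ℝ) (μ d q : S → ℝ) (Z : ℝ) : ℝ :=
  (∑ r, d r * (q r - Real.log (μ r)) - Z) + ∑ r, d r + (1 / 2) * ∑ r, ∑ s, d r * κ r s * μ s

lemma IMi_eq {S : Type*} [Fintype S] (κ : S → S → ℝ) (μ d : S → ℝ) {l : (S → ℕ) → ℝ}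
    (hl : ∀ k, 0 ≤ l k) (h0 : l 0 = 0) (hd : ∀ r, HasSum (fun k : S → ℕ => l k * k r) (d r)) :
    IMi κ μ l = (∑' k : S → ℕ, entTerm (l k) (rhoMu κ μ k)) + ((∑ r, d r - ∑' k, l k : ℝ) : EReal)
      + (((1 / 2) * ∑ r, ∑ s, d r * κ r s * μ s : ℝ) : EReal) := by
  unfold IMi
  have h1 : ∑' k : S → ℕ, l k * (((∑ s : S, k s : ℕ) : ℝ) - 1) = ∑ r, d r - ∑' k, l k := by
    have hs := summable_of_moments hl h0 (fun r => (hd r).summable)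
    have := (hasSum_sum (s := Finset.univ) fun r _ => hd r).sub hs.hasSum
    rw [← this.tsum_eq]
    congr 1
    funext k
    push_cast
    rw [mul_sub, Finset.mul_sum, mul_one]
  rw [h1]
  simp only [(hd _).tsum_eq]

lemma IMi_lower {S : Type*} [Fintype S] {κ : S → S → ℝ} (hκ0 : ∀ r s, 0 ≤ κ r s) {μ : S → ℝ}
    (hμ : ∀ r, 0 < μ r) (d q : S → ℝ) (hZ : Summable (rhoMu κ (thq d q))) {l : (S → ℕ) → ℝ}
    (hl : ∀ k, 0 ≤ l k) (h0 : l 0 = 0) (hd : ∀ r, HasSum (fun k : S → ℕ => l k * k r) (d r)) :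
    (FF κ μ d q (∑' k, rhoMu κ (thq d q) k) : EReal) ≤ IMi κ μ l := by
  rw [IMi_eq κ μ d hl h0 hd]
  have hs := summable_of_moments hl h0 (fun r => (hd r).summable)
  have hL := (hs.hasSum.sub hZ.hasSum).add
    (hasSum_sum (s := Finset.univ) fun r _ => (hd r).mul_right (q r - Real.log (μ r)))
  have key : ((∑' k, l k - ∑' k, rhoMu κ (thq d q) k + ∑ r, d r * (q r - Real.log (μ r)) : ℝ) : EReal)
      ≤ ∑' k : S → ℕ, entTerm (l k) (rhoMu κ μ k) := by
    refine le_tsum_ereal hL fun k => ?_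
    have hA : ∑ r, l k * (k r : ℝ) * (q r - Real.log (μ r)) =
        l k * ∑ r, (k r : ℝ) * (q r - Real.log (μ r)) := by
      rw [Finset.mul_sum]; exact Finset.sum_congr rfl fun r _ => by ring
    rw [hA]
    unfold entTerm
    split_ifs with h1 h2
    · rw [h1, zero_mul, add_zero, zero_sub]
      have := rho_nonneg hκ0 (thq_nonneg d q) k
      exact_mod_cast neg_nonpos.2 this
    · exact le_top
    · push Not at h2
      have hlk : 0 < l k := lt_of_le_of_ne (hl k) (Ne.symm h1)
      have hk : ∀ s, k s ≠ 0 → 0 < d s := by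
        intro s hks
        have : l k * k s ≤ d s := le_hasSum (hd s) k (fun j _ => mul_nonneg (hl j) (Nat.cast_nonneg _))
        have h3 : (0 : ℝ) < k s := by exact_mod_cast Nat.pos_of_ne_zero hks
        nlinarith [mul_pos hlk h3]
      rw [rho_thq_mu κ hμ d q k hk]
      set A := ∑ s, (k s : ℝ) * (q s - Real.log (μ s))
      set m := rhoMu κ μ k
      rw [EReal.coe_le_coe_iff]
      have h4 := Real.log_le_sub_one_of_pos (show 0 < m * Real.exp A / l k by positivity)
      rw [Real.log_div (by positivity) hlk.ne', Real.log_mul h2.ne' (Real.exp_pos _).ne', Real.log_exp] at h4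
      rw [Real.log_div hlk.ne' h2.ne']
      have h5 := mul_le_mul_of_nonneg_left h4 hlk.le
      have h6 : l k * (m * Real.exp A / l k - 1) = m * Real.exp A - l k := by field_simp
      rw [h6] at h5
      linarith
  have := add_le_add (add_le_add key (le_refl ((∑ r, d r - ∑' k, l k : ℝ) : EReal)))
    (le_refl (((1 / 2) * ∑ r, ∑ s, d r * κ r s * μ s : ℝ) : EReal))
  refine le_trans (le_of_eq ?_) this
  rw [← EReal.coe_add, ← EReal.coe_add]
  congr 1
  unfold FF
  ring

/-- truncated activity measure -/
def lamN {S : Type*} [Fintype S] (κ : S → S → ℝ) (θ : S → ℝ) (N : ℕ) (k : S → ℕ) : ℝ :=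
  if k ∈ BN S N then rhoMu κ θ k else 0

lemma lamN_hasSum {S : Type*} [Fintype S] (κ : S → S → ℝ) (θ : S → ℝ) (N : ℕ) (g : (S → ℕ) → ℝ) :
    HasSum (fun k => lamN κ θ N k * g k) (∑ k ∈ BN S N, rhoMu κ θ k * g k) := by
  have : HasSum (fun k => lamN κ θ N k * g k) (∑ k ∈ BN S N, lamN κ θ N k * g k) :=
    hasSum_sum_of_ne_finset_zero (fun k hk => by simp only [lamN, if_neg hk, zero_mul])
  rwa [Finset.sum_congr rfl (g := fun k => rhoMu κ θ k * g k)
    (fun k hk => by simp only [lamN, if_pos hk])] at this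

lemma IMi_trunc {S : Type*} [Fintype S] {κ : S → S → ℝ} (hκ0 : ∀ r s, 0 ≤ κ r s) {μ : S → ℝ}
    (hμ : ∀ r, 0 < μ r) (d q : S → ℝ) (N : ℕ)
    (hd : ∀ r, ∑ k ∈ BN S N, rhoMu κ (thq d q) k * k r = d r) :
    IMi κ μ (lamN κ (thq d q) N) = FF κ μ d q (∑ k ∈ BN S N, rhoMu κ (thq d q) k) := by
  have hnn : ∀ k, 0 ≤ lamN κ (thq d q) N k := fun k => by
    unfold lamN; split_ifs
    · exact rho_nonneg hκ0 (thq_nonneg d q) k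
    · exact le_rfl
  have hm : ∀ r, HasSum (fun k : S → ℕ => lamN κ (thq d q) N k * k r) (d r) := fun r => by
    rw [← hd r]; exact lamN_hasSum κ _ N (fun k => (k r : ℝ))
  rw [IMi_eq κ μ d hnn (by simp [lamN, rho_zero]) hm]
  have h1 : ∑' k, lamN κ (thq d q) N k = ∑ k ∈ BN S N, rhoMu κ (thq d q) k := by
    have := (lamN_hasSum κ (thq d q) N (fun _ => 1)).tsum_eq
    simpa using this
  have hent : ∀ k : S → ℕ, entTerm (lamN κ (thq d q) N k) (rhoMu κ μ k) =
      ((∑ r, lamN κ (thq d q) N k * k r * (q r - Real.log (μ r)) : ℝ) : EReal) := by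
    intro k
    have hA : ∑ r, lamN κ (thq d q) N k * (k r : ℝ) * (q r - Real.log (μ r)) =
        lamN κ (thq d q) N k * ∑ r, (k r : ℝ) * (q r - Real.log (μ r)) := by
      rw [Finset.mul_sum]; exact Finset.sum_congr rfl fun r _ => by ring
    rw [hA]
    unfold entTerm
    by_cases h0 : lamN κ (thq d q) N k = 0
    · rw [if_pos h0, h0, zero_mul]; rfl
    · have h2 : lamN κ (thq d q) N k = rhoMu κ (thq d q) k := by
        unfold lamN at h0 ⊢
        split_ifs at h0 ⊢ with h3
        · rfl
        · exact absurd rfl h0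
      have hk : ∀ s, k s ≠ 0 → 0 < d s := by
        intro s hks
        by_contra hds
        rw [h2, rho_thq_zero κ d q k hks hds] at h0
        exact h0 rfl
      have h3 := rho_thq_mu κ hμ d q k hk
      have h4 : 0 < rhoMu κ μ k := by
        refine lt_of_le_of_ne (rho_nonneg hκ0 (fun r => (hμ r).le) k) fun h => ?_
        rw [h2, h3, ← h, zero_mul] at h0
        exact h0 rfl
      rw [if_neg h0, if_neg (not_le.2 h4), h2]
      congr 2
      rw [h3, mul_div_assoc, mul_comm, div_mul_cancel₀ _ h4.ne', Real.log_exp]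
  have h2 : ∑' k : S → ℕ, entTerm (lamN κ (thq d q) N k) (rhoMu κ μ k) =
      ((∑ r, d r * (q r - Real.log (μ r)) : ℝ) : EReal) := by
    simp only [hent]
    exact (hasSum_coe_ereal (hasSum_sum (s := Finset.univ) fun r _ =>
      (hm r).mul_right (q r - Real.log (μ r)))).tsum_eq
  rw [h1, h2, ← EReal.coe_add, ← EReal.coe_add]
  congr 1
  unfold FF
  ring

/-- truncated dual functional -/
def DN {S : Type*} [Fintype S] (κ : S → S → ℝ) (d : S → ℝ) (N : ℕ) (q : S → ℝ) : ℝ :=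
  ∑ r, d r * q r - ∑ k ∈ BN S N, rhoMu κ (thq d q) k

lemma rho_thq_cont {S : Type*} [Fintype S] (κ : S → S → ℝ) (d : S → ℝ) (k : S → ℕ) :
    Continuous (fun q : S → ℝ => rhoMu κ (thq d q) k) := by
  unfold rhoMu
  refine continuous_const.mul (continuous_finsetProd _ fun s _ => ?_)
  refine Continuous.div_const (Continuous.pow ?_ _) _
  unfold thq
  split_ifs
  · exact Real.continuous_exp.comp (continuous_apply s)
  · exact continuous_const

lemma DN_cont {S : Type*} [Fintype S] (κ : S → S → ℝ) (d : S → ℝ) (N : ℕ) : Continuous (DN κ d N) := by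
  unfold DN
  refine Continuous.sub (continuous_finsetSum _ fun r _ => continuous_const.mul (continuous_apply r))
    (continuous_finsetSum _ fun k _ => rho_thq_cont κ d k)

lemma sum_theta_le {S : Type*} [Fintype S] {κ : S → S → ℝ} (hs : ∀ r s, κ r s = κ s r)
    (hκ0 : ∀ r s, 0 ≤ κ r s) {θ : S → ℝ} (hθ : ∀ r, 0 ≤ θ r) {N : ℕ} (hN : 2 ≤ N) :
    ∑ r, θ r ≤ ∑ k ∈ BN S N, rhoMu κ θ k := by
  rw [sum_BN]
  have h1 : ∑ r, θ r = ∑ k ∈ Finset.piAntidiag (Finset.univ : Finset S) 1, rhoMu κ θ k := by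
    simp only [← gco_one κ hs θ, gco]
    rw [Finset.sum_comm]
    refine Finset.sum_congr rfl fun k hk => ?_
    rw [← Finset.mul_sum]
    rw [Finset.mem_piAntidiag] at hk
    have : ∑ r, (k r : ℝ) = 1 := by exact_mod_cast hk.1
    rw [this, mul_one]
  rw [h1]
  exact Finset.single_le_sum (f := fun n => ∑ k ∈ Finset.piAntidiag (Finset.univ : Finset S) n, rhoMu κ θ k)
    (fun n _ => Finset.sum_nonneg fun k _ => rho_nonneg hκ0 hθ k) (Finset.mem_range.2 (by omega))

lemma exp_bd {a : ℝ} (ha : 0 < a) (q : ℝ) : a * q + (a - a * Real.log a) ≤ Real.exp q := by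
  have h := Real.add_one_le_exp (q - Real.log a)
  rw [Real.exp_sub, Real.exp_log ha, le_div_iff₀ ha] at h
  nlinarith

lemma term_bd (d : ℝ) (hd : 0 < d) : ∃ C : ℝ, ∀ q : ℝ, d * q - Real.exp q ≤ C - d / 2 * |q| := by
  refine ⟨|(2 * d) - (2 * d) * Real.log (2 * d)| + |(d / 2) - (d / 2) * Real.log (d / 2)|, fun q => ?_⟩
  have h1 := exp_bd (show 0 < 2 * d by linarith) q
  have h2 := exp_bd (show 0 < d / 2 by linarith) q
  have h3 := neg_abs_le ((2 * d) - (2 * d) * Real.log (2 * d))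
  have h4 := neg_abs_le ((d / 2) - (d / 2) * Real.log (d / 2))
  have h5 := abs_nonneg ((2 * d) - (2 * d) * Real.log (2 * d))
  have h6 := abs_nonneg ((d / 2) - (d / 2) * Real.log (d / 2))
  rcases abs_cases q with ⟨h, h0⟩ | ⟨h, h0⟩
  · rw [h]; nlinarith
  · rw [h]; nlinarith

lemma thq_congr {S : Type*} {d q q' : S → ℝ} (h : ∀ r, 0 < d r → q r = q' r) : thq d q = thq d q' := by
  funext r; unfold thq
  split_ifs with h1
  · rw [h r h1]
  · rfl

lemma DN_coercive {S : Type*} [Fintype S] {κ : S → S → ℝ} (hs : ∀ r s, κ r s = κ s r)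
    (hκ0 : ∀ r s, 0 ≤ κ r s) {d : S → ℝ} (hd : ∀ r, 0 ≤ d r) :
    ∃ R : ℝ, ∀ N, 2 ≤ N → ∀ q, ∀ r, DN κ d N q + d r / 2 * |q r| ≤ R := by
  have h : ∀ r, ∃ C : ℝ, 0 ≤ C ∧ ∀ q : S → ℝ, d r * q r - thq d q r ≤ C - d r / 2 * |q r| := by
    intro r
    rcases (hd r).eq_or_lt with h0 | h0
    · exact ⟨0, le_rfl, fun q => by simp [thq, ← h0]⟩
    · obtain ⟨C, hC⟩ := term_bd (d r) h0
      refine ⟨max C 0, le_max_right _ _, fun q => ?_⟩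
      rw [thq, if_pos h0]
      exact (hC (q r)).trans (sub_le_sub_right (le_max_left _ _) _)
  choose C hC0 hC using h
  refine ⟨∑ r, C r, fun N hN q r => ?_⟩
  have h1 := sum_theta_le hs hκ0 (thq_nonneg d q) hN
  have h2 : DN κ d N q ≤ ∑ s, (C s - d s / 2 * |q s|) := by
    calc DN κ d N q ≤ ∑ s, d s * q s - ∑ s, thq d q s := sub_le_sub_left h1 _
      _ = ∑ s, (d s * q s - thq d q s) := by rw [Finset.sum_sub_distrib]
      _ ≤ _ := Finset.sum_le_sum fun s _ => hC s q
  rw [Finset.sum_sub_distrib] at h2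
  have h3 : d r / 2 * |q r| ≤ ∑ s, d s / 2 * |q s| :=
    Finset.single_le_sum (f := fun s => d s / 2 * |q s|)
      (fun s _ => mul_nonneg (by linarith [hd s]) (abs_nonneg _)) (Finset.mem_univ r)
  linarith

/-- the box -/
def Qbox {S : Type*} (d : S → ℝ) (R : ℝ) : Set (S → ℝ) :=
  Set.univ.pi fun r => Set.Icc (-(2 * R / d r)) (2 * R / d r)

lemma exists_max {S : Type*} [Fintype S] {κ : S → S → ℝ} (hκ0 : ∀ r s, 0 ≤ κ r s) {d : S → ℝ}
    (hd : ∀ r, 0 ≤ d r) (qs : S → ℝ) (hZ : Summable (rhoMu κ (thq d qs))) (R : ℝ) (N : ℕ)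
    (hR : ∀ q, ∀ r, DN κ d N q + d r / 2 * |q r| ≤ R + (∑ r, d r * qs r - ∑' k, rhoMu κ (thq d qs) k)) :
    ∃ q ∈ Qbox d R, ∀ q', DN κ d N q' ≤ DN κ d N q := by
  set m := ∑ r, d r * qs r - ∑' k, rhoMu κ (thq d qs) k with hm
  set tr : (S → ℝ) → S → ℝ := fun q r => if 0 < d r then q r else 0 with htr
  have hDtr : ∀ q, DN κ d N (tr q) = DN κ d N q := by
    intro q
    unfold DN
    have e1 : thq d (tr q) = thq d q := thq_congr fun r hr => by simp only [htr, if_pos hr]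
    rw [e1]
    congr 1
    refine Finset.sum_congr rfl fun r _ => ?_
    rcases (hd r).eq_or_lt with h0 | h0
    · simp [← h0]
    · simp only [htr, if_pos h0]
  have hbox : ∀ q, m ≤ DN κ d N q → tr q ∈ Qbox d R := by
    intro q hq r _
    rw [Set.mem_Icc, ← abs_le]
    simp only [htr]
    split_ifs with h0
    · have := hR q r
      rw [le_div_iff₀ h0]
      linarith
    · have : d r = 0 := le_antisymm (not_lt.1 h0) (hd r)
      simp [this]
  have hms : m ≤ DN κ d N qs := by
    unfold DN
    have := hZ.sum_le_tsum (BN S N) (fun k _ => rho_nonneg hκ0 (thq_nonneg d qs) k)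
    linarith
  have hcomp : IsCompact (Qbox d R) := isCompact_univ_pi fun r => isCompact_Icc
  obtain ⟨q, hq, hmax⟩ := hcomp.exists_isMaxOn ⟨_, hbox qs hms⟩ (DN_cont κ d N).continuousOn
  refine ⟨q, hq, fun q' => ?_⟩
  by_cases h : m ≤ DN κ d N q'
  · rw [← hDtr]; exact hmax (hbox q' h)
  · push Not at h
    refine h.le.trans (hms.trans ?_)
    rw [← hDtr]; exact hmax (hbox qs hms)

lemma stationary {S : Type*} [Fintype S] {κ : S → S → ℝ} {d : S → ℝ}
    (hd : ∀ r, 0 ≤ d r) (N : ℕ) (q : S → ℝ) (hmax : ∀ q', DN κ d N q' ≤ DN κ d N q) (r : S) :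
    ∑ k ∈ BN S N, rhoMu κ (thq d q) k * k r = d r := by
  rcases (hd r).eq_or_lt with h0 | h0
  · rw [← h0]
    refine Finset.sum_eq_zero fun k _ => ?_
    by_cases hk : k r = 0
    · simp [hk]
    · rw [rho_thq_zero κ d q k hk (by rw [← h0]; exact lt_irrefl _), zero_mul]
  · have hf : ∀ t : ℝ, DN κ d N (fun s => q s + if s = r then t else 0) =
        (∑ s, d s * q s + d r * t) - ∑ k ∈ BN S N, rhoMu κ (thq d q) k * Real.exp (k r * t) := by
      intro t
      unfold DN
      congr 1
      · simp only [mul_add, Finset.sum_add_distrib]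
        simp
      · refine Finset.sum_congr rfl fun k _ => ?_
        rw [rho_thq_thq κ d q]
        congr 2
        simp
    have hder : HasDerivAt (fun t : ℝ => (∑ s, d s * q s + d r * t) -
        ∑ k ∈ BN S N, rhoMu κ (thq d q) k * Real.exp (k r * t))
        (d r - ∑ k ∈ BN S N, rhoMu κ (thq d q) k * k r) 0 := by
      refine HasDerivAt.sub ?_ ?_
      · simpa using ((hasDerivAt_id (0 : ℝ)).const_mul (d r)).const_add (∑ s, d s * q s)
      · refine HasDerivAt.fun_sum fun k _ => ?_
        have := (((hasDerivAt_id (0 : ℝ)).const_mul (k r : ℝ)).exp).const_mul (rhoMu κ (thq d q) k)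
        simpa using this
    have hloc : IsLocalMax (fun t : ℝ => (∑ s, d s * q s + d r * t) -
        ∑ k ∈ BN S N, rhoMu κ (thq d q) k * Real.exp (k r * t)) 0 := by
      refine Filter.Eventually.of_forall fun t => ?_
      have h1 := hmax (fun s => q s + if s = r then t else 0)
      have h2 := hf 0
      simp only [ite_self, add_zero] at h2
      rw [hf t] at h1
      change DN κ d N q = _ at h2
      rw [h2] at h1
      simpa using h1
    have := hloc.hasDerivAt_eq_zero hder
    linarith

lemma exists_good {S : Type*} [Fintype S] {κ : S → S → ℝ} (hs : ∀ r s, κ r s = κ s r)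
    (hκ0 : ∀ r s, 0 ≤ κ r s) {d : S → ℝ}
    (hd : ∀ r, 0 ≤ d r) (qs : S → ℝ) (hZ : Summable (rhoMu κ (thq d qs)))
    (hmax : ∀ q, Summable (rhoMu κ (thq d q)) → ∑ r, d r * q r - ∑' k, rhoMu κ (thq d q) k ≤
      ∑ r, d r * qs r - ∑' k, rhoMu κ (thq d qs) k) {ε : ℝ} (hε : 0 < ε) :
    ∃ N q, (∀ r, ∑ k ∈ BN S N, rhoMu κ (thq d q) k * k r = d r) ∧
      DN κ d N q ≤ (∑ r, d r * qs r - ∑' k, rhoMu κ (thq d qs) k) + ε := by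
  set m := ∑ r, d r * qs r - ∑' k, rhoMu κ (thq d qs) k with hm
  obtain ⟨R, hR⟩ := DN_coercive hs hκ0 hd
  have hex : ∀ N : ℕ, ∃ q ∈ Qbox d (R - m), ∀ q', DN κ d (N + 2) q' ≤ DN κ d (N + 2) q := fun N =>
    exists_max hκ0 hd qs hZ (R - m) (N + 2) (fun q r => by
      have := hR (N + 2) (by omega) q r
      linarith)
  choose qn hqn hqmax using hex
  by_contra hcon
  push Not at hcon
  have hbig : ∀ N, m + ε < DN κ d (N + 2) (qn N) := fun N =>
    hcon (N + 2) (qn N) (stationary hd (N + 2) (qn N) (hqmax N))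
  have hcomp : IsCompact (Qbox d (R - m)) := isCompact_univ_pi fun r => isCompact_Icc
  obtain ⟨q, _, φ, hφ, hlim⟩ := hcomp.tendsto_subseq hqn
  have hM : ∀ M, ∑ k ∈ BN S M, rhoMu κ (thq d q) k ≤ ∑ r, d r * q r - (m + ε) := by
    intro M
    have hc : m + ε ≤ DN κ d M q := by
      refine ge_of_tendsto (((DN_cont κ d M).tendsto q).comp hlim) ?_
      filter_upwards [eventually_ge_atTop M] with n hn
      refine (hbig (φ n)).le.trans ?_
      unfold DN
      refine sub_le_sub_left (Finset.sum_le_sum_of_subset_of_nonneg (BN_mono ?_) fun k _ _ =>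
        rho_nonneg hκ0 (thq_nonneg d _) k) _
      have := hφ.id_le n
      simp only [id] at this
      omega
    unfold DN at hc
    linarith
  obtain ⟨h1, h2⟩ := summable_of_BN (fun k => rho_nonneg hκ0 (thq_nonneg d q) k) hM
  have := hmax q h1
  linarith

lemma sInf_eq {S : Type*} [Fintype S] {κ : S → S → ℝ} (hs : ∀ r s, κ r s = κ s r)
    (hκ0 : ∀ r s, 0 ≤ κ r s) {μ : S → ℝ} (hμ : ∀ r, 0 < μ r) {d : S → ℝ}
    (hd : ∀ r, 0 ≤ d r) (qs : S → ℝ) (hZ : Summable (rhoMu κ (thq d qs)))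
    (hmax : ∀ q, Summable (rhoMu κ (thq d q)) → ∑ r, d r * q r - ∑' k, rhoMu κ (thq d q) k ≤
      ∑ r, d r * qs r - ∑' k, rhoMu κ (thq d qs) k) :
    sInf {v : EReal | ∃ lam : (S → ℕ) → ℝ, (∀ k, 0 ≤ lam k) ∧ lam 0 = 0 ∧
          (∀ r, HasSum (fun k : S → ℕ => lam k * (k r : ℝ)) (d r)) ∧ v = IMi κ μ lam} =
      (FF κ μ d qs (∑' k, rhoMu κ (thq d qs) k) : EReal) := by
  apply le_antisymm
  · apply EReal.le_of_forall_lt_iff_le.1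
    intro z hz
    rw [EReal.coe_lt_coe_iff] at hz
    obtain ⟨N, q, hst, hDN⟩ := exists_good hs hκ0 hd qs hZ hmax (sub_pos.2 hz)
    refine sInf_le_of_le (b := IMi κ μ (lamN κ (thq d q) N))
      ⟨lamN κ (thq d q) N, fun k => ?_, ?_, fun r => ?_, rfl⟩ ?_
    · unfold lamN; split_ifs
      · exact rho_nonneg hκ0 (thq_nonneg d q) k
      · exact le_rfl
    · simp [lamN, rho_zero]
    · rw [← hst r]; exact lamN_hasSum κ _ N (fun k => (k r : ℝ))
    · rw [IMi_trunc hκ0 hμ d q N hst, EReal.coe_le_coe_iff]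
      unfold FF DN at *
      simp only [mul_sub, Finset.sum_sub_distrib] at *
      linarith
  · refine le_sInf ?_
    rintro v ⟨l, hl, h0, hdl, rfl⟩
    exact IMi_lower hκ0 hμ d qs hZ hl h0 hdl

lemma IMe_fp {S : Type*} [Fintype S] {κ : S → S → ℝ} {μ b u : S → ℝ}
    (hμ : ∀ r, 0 < μ r) (hb : ∀ r, 0 ≤ b r) (hu : ∀ r, 0 ≤ u r)
    (hub : ∀ r, u r = b r * ∑ s, κ r s * u s) :
    IMe κ μ u = ((∑ r, u r * (Real.log (b r) - Real.log (μ r)) +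
      (1 / 2) * ∑ r, ∑ s, u r * κ r s * μ s : ℝ) : EReal) := by
  have h : ∀ r, entTerm (u r) ((∑ s : S, κ r s * u s) * μ r) =
      ((u r * (Real.log (b r) - Real.log (μ r)) : ℝ) : EReal) := by
    intro r
    unfold entTerm
    split_ifs with h1 h2
    · rw [h1]; simp
    · exfalso
      have hk : ∑ s, κ r s * u s ≤ 0 := nonpos_of_mul_nonpos_left h2 (hμ r)
      have := mul_nonpos_of_nonneg_of_nonpos (hb r) hk
      rw [← hub r] at this
      exact h1 (le_antisymm this (hu r))
    · push Not at h2
      have hk : 0 < ∑ s, κ r s * u s := pos_of_mul_pos_left h2 (hμ r).le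
      have hb' : b r ≠ 0 := fun h => h1 (by rw [hub r, h, zero_mul])
      rw [← Real.log_div hb' (hμ r).ne']
      congr 3
      rw [div_eq_div_iff (mul_pos hk (hμ r)).ne' (hμ r).ne']
      nth_rewrite 1 [hub r]
      ring
  unfold IMe
  rw [Finset.sum_congr rfl fun r _ => h r, EReal.coe_add]
  congr 1
  refine Finset.induction_on (Finset.univ : Finset S) (by simp) fun a t ha ih => ?_
  rw [Finset.sum_insert ha, Finset.sum_insert ha, ih, EReal.coe_add]

lemma final_part {S : Type*} [Fintype S] {κ : S → S → ℝ} (hs : ∀ r s, κ r s = κ s r)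
    (hκ0 : ∀ r s, 0 ≤ κ r s) {μ : S → ℝ} (hμ : ∀ r, 0 < μ r) {c b : S → ℝ}
    (hfp : IsFPSol κ c b) (hQ : QBd κ b) :
    sInf {v : EReal | ∃ lam : (S → ℕ) → ℝ, (∀ k, 0 ≤ lam k) ∧ lam 0 = 0 ∧
          (∀ r, HasSum (fun k : S → ℕ => lam k * (k r : ℝ)) (c r)) ∧ v = IMi κ μ lam}
        = sInf {v : EReal | ∃ lam : (S → ℕ) → ℝ, (∀ k, 0 ≤ lam k) ∧ lam 0 = 0 ∧
            (∀ r, HasSum (fun k : S → ℕ => lam k * (k r : ℝ)) (b r)) ∧ v = IMi κ μ lam}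
          + IMe κ μ (fun r => c r - b r) := by
  obtain ⟨hb, hbc, hfp⟩ := hfp
  have hu : ∀ r, 0 ≤ c r - b r := fun r => sub_nonneg.2 (hbc r)
  have hub : ∀ r, c r - b r = b r * ∑ s, κ r s * (c s - b s) := fun r => by
    rw [← hfp r, mul_comm]
  have hsupp : ∀ r, 0 < c r ↔ 0 < b r := by
    intro r
    constructor
    · intro h
      refine lt_of_le_of_ne (hb r) fun h0 => ?_
      have := hub r
      rw [← h0, zero_mul] at this
      linarith
    · intro h; exact h.trans_le (hbc r)
  have hthq : ∀ q, thq c q = thq b q := fun q => by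
    funext r; simp only [thq, hsupp r]
  have hu0 : ∀ r, ¬ 0 < b r → c r - b r = 0 := fun r h => by
    have : b r = 0 := le_antisymm (not_lt.1 h) (hb r)
    rw [hub r, this, zero_mul]
  set qs : S → ℝ := fun r => Real.log (b r) - ∑ s, κ r s * b s with hqs
  have hth : thq b qs = thS κ b := by
    funext r
    unfold thq thS
    split_ifs with h
    · rw [hqs]; simp only; rw [sub_eq_add_neg, Real.exp_add, Real.exp_log h]
    · have : b r = 0 := le_antisymm (not_lt.1 h) (hb r)
      rw [this, zero_mul]
  have hmom : ∀ r, HasSum (fun k : S → ℕ => rhoMu κ (thq b qs) k * k r) (b r) := by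
    rw [hth]; exact gam_b hs hκ0 hb hQ
  have hZ : Summable (rhoMu κ (thq b qs)) :=
    summable_of_moments (fun k => rho_nonneg hκ0 (thq_nonneg b qs) k) (rho_zero _ _)
      fun r => (hmom r).summable
  have hconv : ∀ q, Summable (rhoMu κ (thq b q)) →
      ∑' k, rhoMu κ (thq b qs) k + ∑ r, b r * (q r - qs r) ≤ ∑' k, rhoMu κ (thq b q) k := by
    intro q hq
    have h1 : HasSum (fun k : S → ℕ => rhoMu κ (thq b qs) k +
        ∑ r, rhoMu κ (thq b qs) k * k r * (q r - qs r))
        (∑' k, rhoMu κ (thq b qs) k + ∑ r, b r * (q r - qs r)) :=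
      hZ.hasSum.add (hasSum_sum fun r _ => (hmom r).mul_right _)
    refine hasSum_le (fun k => ?_) h1 hq.hasSum
    rw [rho_thq_thq κ b qs q k]
    have h2 := Real.add_one_le_exp (∑ s, (k s : ℝ) * (q s - qs s))
    have h3 := mul_le_mul_of_nonneg_left h2 (rho_nonneg hκ0 (thq_nonneg b qs) k)
    refine le_trans (le_of_eq ?_) h3
    rw [mul_add, mul_one, Finset.mul_sum, add_comm]
    simp only [mul_assoc]
  have hmaxb : ∀ q, Summable (rhoMu κ (thq b q)) → ∑ r, b r * q r - ∑' k, rhoMu κ (thq b q) k ≤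
      ∑ r, b r * qs r - ∑' k, rhoMu κ (thq b qs) k := by
    intro q hq
    have := hconv q hq
    simp only [mul_sub, Finset.sum_sub_distrib] at this
    linarith
  have hmaxc : ∀ q, Summable (rhoMu κ (thq c q)) → ∑ r, c r * q r - ∑' k, rhoMu κ (thq c q) k ≤
      ∑ r, c r * qs r - ∑' k, rhoMu κ (thq c qs) k := by
    intro q hq
    rw [hthq] at hq
    rw [hthq, hthq]
    have h1 := hmaxb q hq
    have h2 := critC hs hκ0 hb hu hub (thq_nonneg b q)
      (fun r hr => by rw [thq, if_pos hr]; exact Real.exp_pos _) hq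
    have h3 : ∑ r, (c r - b r) * (Real.log (thq b q r) - (Real.log (b r) - ∑ s, κ r s * b s)) =
        ∑ r, (c r * q r - b r * q r - (c r * qs r - b r * qs r)) := by
      refine Finset.sum_congr rfl fun r _ => ?_
      by_cases hr : 0 < b r
      · rw [thq, if_pos hr, Real.log_exp, hqs]; ring
      · have h0 := hu0 r hr
        rw [h0]
        have : c r = b r := by linarith
        rw [this]; ring
    rw [h3] at h2
    simp only [Finset.sum_sub_distrib] at h2
    linarith
  have hc : ∀ r, 0 ≤ c r := fun r => (hb r).trans (hbc r)
  rw [sInf_eq hs hκ0 hμ hb qs hZ hmaxb,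
    sInf_eq hs hκ0 hμ hc qs (by rw [hthq]; exact hZ) hmaxc, hthq, IMe_fp hμ hb hu hub,
    ← EReal.coe_add]
  congr 1
  have hsw : ∑ r, (c r - b r) * ∑ s, κ r s * b s = ∑ r, (c r - b r) := by
    calc ∑ r, (c r - b r) * ∑ s, κ r s * b s
        = ∑ r, ∑ s, (c r - b r) * (κ r s * b s) := by simp only [Finset.mul_sum]
      _ = ∑ s, ∑ r, (c r - b r) * (κ r s * b s) := Finset.sum_comm
      _ = ∑ s, b s * ∑ r, κ s r * (c r - b r) := by
          refine Finset.sum_congr rfl fun s _ => ?_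
          rw [Finset.mul_sum]
          refine Finset.sum_congr rfl fun r _ => ?_
          rw [hs r s]; ring
      _ = _ := Finset.sum_congr rfl fun s _ => (hub s).symm
  have e1 : ∑ r, (c r - b r) * (Real.log (b r) - Real.log (μ r)) =
      ∑ r, c r * (qs r - Real.log (μ r)) - ∑ r, b r * (qs r - Real.log (μ r))
        + (∑ r, c r - ∑ r, b r) := by
    rw [← Finset.sum_sub_distrib, ← Finset.sum_sub_distrib, ← hsw, ← Finset.sum_add_distrib]
    refine Finset.sum_congr rfl fun r _ => ?_
    rw [hqs]; ring
  have e2 : ∑ r, ∑ s, (c r - b r) * κ r s * μ s =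
      ∑ r, ∑ s, c r * κ r s * μ s - ∑ r, ∑ s, b r * κ r s * μ s := by
    simp only [sub_mul, Finset.sum_sub_distrib]
  unfold FF
  rw [e1, e2]
  ring

/-- minimization of `I_Mi` under the constraint `c(λ) = c`, supercritical case. -/
theorem IMi_minimizer_supercritical
    {S : Type*} [Fintype S] [DecidableEq S] [Nonempty S]
    (κ : S → S → ℝ) (hκsym : ∀ r s, κ r s = κ s r) (hκ0 : ∀ r s, 0 ≤ κ r s)
    (μ : S → ℝ) (hμ0 : ∀ r, 0 < μ r) (hμ1 : (∑ r : S, μ r) = 1)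
    (c : S → ℝ) (hc0 : ∀ r, 0 ≤ c r) (hcμ : ∀ r, c r ≤ μ r) (hSig : 1 < sigmaOp κ c)
    (bstar : S → ℝ) (hb : IsFPSol κ c bstar)
    (hmin : ∀ b, IsFPSol κ c b → ∀ r, bstar r ≤ b r) :
    bstar ≠ c ∧ sigmaOp κ bstar = 1 ∧
      sInf {v : EReal | ∃ lam : (S → ℕ) → ℝ, (∀ k, 0 ≤ lam k) ∧ lam 0 = 0 ∧
          (∀ r, HasSum (fun k : S → ℕ => lam k * (k r : ℝ)) (c r)) ∧ v = IMi κ μ lam}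
        = sInf {v : EReal | ∃ lam : (S → ℕ) → ℝ, (∀ k, 0 ≤ lam k) ∧ lam 0 = 0 ∧
            (∀ r, HasSum (fun k : S → ℕ => lam k * (k r : ℝ)) (bstar r)) ∧ v = IMi κ μ lam}
          + IMe κ μ (fun r => c r - bstar r) := by
  obtain ⟨h1, h2, hQ⟩ := FP_part κ hκsym hκ0 c hc0 hSig bstar hb hmin
  exact ⟨h1, h2, final_part hκsym hκ0 hμ0 hb hQ⟩

end
end

section
/- Let κ be a kernel on S, μ a probability vector on S with μ_r > 0 for all r, and c ∈ [0,∞)^S with c ≤ μ componentwise. For b ∈ [0,∞)^S with b ≤ c and Σ(κ,b) ≤ 1 define G_c(b) = ∑_{r∈S} b_r log(b_r/μ_r) − (1/2) ∑_{r,s∈S} b_r κ(r,s) b_s + ∑_{r∈S} (c_r − b_r) log( (c_r − b_r) / ((κ(c−b))_r μ_r) ) + (1/2) ∑_{r,s∈S} c_r κ(r,s) μ_s ∈ (−∞,+∞], with the conventions log 0 = −∞ and 0·log 0 = 0. (1) If Σ(κ,c) ≤ 1, then the minimum of G_c over {b ∈ [0,∞)^S : b ≤ c, Σ(κ,b) ≤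 1} equals G_c(c), and b = c is the unique minimizer. (2) If Σ(κ,c) > 1, then the minimum equals G_c(b*), where b* is the pointwise-smallest solution of the fixed-point system for c (it satisfies b* ≠ c and Σ(κ,b*) = 1), and b* is the unique minimizer. -/
open scoped Classical ENNReal
open Filter MeasureTheory

noncomputable section

lemma sc1 (t : ℝ) (h0 : 0 < t) (h1 : t < 1) : (1-t) + (1-t)^2/2 < -Real.log t := by
  have h := Real.hasSum_pow_div_log_of_abs_lt_one (x := 1 - t) (by rw [abs_lt]; constructor <;> linarith)
  have h2 := sum_le_hasSum (Finset.range 3) (fun i _ => by have : 0 < 1 - t := by linarith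
                                                           positivity) h
  simp [Finset.sum_range_succ] at h2
  have : 0 < (1-t)^3 := by have : 0 < 1 - t := by linarith
                           positivity
  norm_num at h2
  linarith
lemma sc2 (t : ℝ) (h0 : 0 ≤ t) (h1 : t < 1) : (1-t)^2/2 < t * Real.log t - t + 1 := by
  rcases h0.eq_or_lt with rfl | h0
  · norm_num
  have hl : 0 < Real.log t⁻¹ := Real.log_pos (one_lt_inv_iff₀.mpr ⟨h0, h1⟩)
  have := Real.self_lt_sinh_iff.2 hl
  rw [Real.sinh_log (by positivity), Real.log_inv, inv_inv] at this
  have h3 := mul_lt_mul_of_pos_left this h0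
  have : t * ((t⁻¹ - t)/2) = (1 - t^2)/2 := by field_simp
  nlinarith

lemma sc3 (a b m : ℝ) (ha : 0 < a) (hb : 0 ≤ b) (hm : 0 < m) (hne : b ≠ a) :
    (b-a)^2/(max b a)/2 < b * Real.log (b/m) - b * Real.log (a/m) - b + a := by
  have key : b * Real.log (b/m) - b * Real.log (a/m) = b * Real.log (b / a) := by
    rcases hb.eq_or_lt with rfl | hb
    · simp
    rw [Real.log_div hb.ne' hm.ne', Real.log_div ha.ne' hm.ne', Real.log_div hb.ne' ha.ne']; ring
  rw [key]
  rcases lt_or_gt_of_ne hne with h | h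
  · rw [max_eq_right h.le]
    have := mul_lt_mul_of_pos_left (sc2 (b/a) (by positivity) ((div_lt_one ha).2 h)) ha
    have e1 : a * ((1-b/a)^2/2) = (b-a)^2/a/2 := by field_simp; ring
    have e2 : a * (b/a * Real.log (b/a) - b/a + 1) = b * Real.log (b / a) - b + a := by field_simp
    linarith
  · have hb' : 0 < b := ha.trans h
    rw [max_eq_left h.le]
    have := mul_lt_mul_of_pos_left (sc1 (a/b) (by positivity) ((div_lt_one hb').2 h)) hb'
    have e1 : b * ((1-a/b) + (1-a/b)^2/2) = (b-a)^2/b/2 + b - a := by field_simp; ring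
    have e2 : Real.log (b/a) = -Real.log (a/b) := by rw [← Real.log_inv, inv_div]
    rw [e2]; linarith

lemma sc4 (a b m : ℝ) (ha : 0 ≤ a) (hb : 0 ≤ b) (hab : a = 0 → b = 0) (hm : 0 < m) :
    (b-a)^2/(max b a)/2 ≤ b * Real.log (b/m) - b * Real.log (a/m) - b + a := by
  by_cases hne : b = a
  · subst hne; simp
  rcases ha.eq_or_lt with h | h
  · exact absurd ((hab h.symm).trans h) hne
  · exact (sc3 a b m h hb hm hne).le

def kv {S : Type*} [Fintype S] (κ : S → S → ℝ) (x : S → ℝ) (r : S) : ℝ := ∑ s : S, κ r s * x s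

def bil {S : Type*} [Fintype S] (κ : S → S → ℝ) (x y : S → ℝ) : ℝ := ∑ r : S, x r * kv κ y r

section helpers
variable {S : Type*} [Fintype S] {κ : S → S → ℝ}

lemma kv_add (x y : S → ℝ) (t : ℝ) (r : S) :
    kv κ (fun s => x s + t * y s) r = kv κ x r + t * kv κ y r := by
  simp only [kv, Finset.mul_sum, ← Finset.sum_add_distrib]
  exact Finset.sum_congr rfl fun _ _ => by ring

lemma kv_smul (y : S → ℝ) (t : ℝ) (r : S) :
    kv κ (fun s => t * y s) r = t * kv κ y r := by
  simp only [kv, Finset.mul_sum]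
  exact Finset.sum_congr rfl fun _ _ => by ring

lemma kv_nonneg (hκ0 : ∀ r s, 0 ≤ κ r s) {x : S → ℝ} (hx : ∀ s, 0 ≤ x s) (r : S) : 0 ≤ kv κ x r :=
  Finset.sum_nonneg fun s _ => mul_nonneg (hκ0 r s) (hx s)

lemma kv_mono (hκ0 : ∀ r s, 0 ≤ κ r s) {x y : S → ℝ} (hx : ∀ s, x s ≤ y s) (r : S) :
    kv κ x r ≤ kv κ y r :=
  Finset.sum_le_sum fun s _ => mul_le_mul_of_nonneg_left (hx s) (hκ0 r s)

lemma bil_comm (hs : ∀ r s, κ r s = κ s r) (x y : S → ℝ) : bil κ x y = bil κ y x := by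
  simp only [bil, kv, Finset.mul_sum]
  rw [Finset.sum_comm]
  refine Finset.sum_congr rfl fun r _ => Finset.sum_congr rfl fun s _ => ?_
  rw [hs]; ring

lemma bil_add_left (x y z : S → ℝ) (t : ℝ) :
    bil κ (fun s => x s + t * y s) z = bil κ x z + t * bil κ y z := by
  simp only [bil, Finset.mul_sum, ← Finset.sum_add_distrib]
  exact Finset.sum_congr rfl fun _ _ => by ring

lemma bil_expand (hs : ∀ r s, κ r s = κ s r) (x y : S → ℝ) (t : ℝ) :
    bil κ (fun s => x s + t * y s) (fun s => x s + t * y s)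
      = bil κ x x + 2 * t * bil κ x y + t ^ 2 * bil κ y y := by
  rw [bil_add_left, bil_comm hs x, bil_comm hs y, bil_add_left, bil_add_left, bil_comm hs y x]
  ring

lemma bil_nonneg (hκ0 : ∀ r s, 0 ≤ κ r s) {x y : S → ℝ} (hx : ∀ s, 0 ≤ x s) (hy : ∀ s, 0 ≤ y s) :
    0 ≤ bil κ x y := Finset.sum_nonneg fun s _ => mul_nonneg (hx s) (kv_nonneg hκ0 hy s)

lemma bil_abs (hκ0 : ∀ r s, 0 ≤ κ r s) (x : S → ℝ) :
    -bil κ (fun s => |x s|) (fun s => |x s|) ≤ bil κ x x := by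
  simp only [bil, kv, Finset.mul_sum, ← Finset.sum_neg_distrib]
  refine Finset.sum_le_sum fun r _ => Finset.sum_le_sum fun s _ => ?_
  have h : |x r| * |x s| = |x r * x s| := (abs_mul _ _).symm
  have h2 := neg_abs_le (x r * x s)
  have := mul_le_mul_of_nonneg_left h2 (hκ0 r s)
  rw [← h] at this
  linarith

lemma sig_eq (ν f : S → ℝ) (r : S) :
    (∑ s : S, κ r s * f s * ν s) = kv κ (fun s => ν s * f s) r :=
  Finset.sum_congr rfl fun _ _ => by ring

lemma sig_bdd (hκ0 : ∀ r s, 0 ≤ κ r s) {ν : S → ℝ} (hν : ∀ s, 0 ≤ ν s) :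
    BddAbove { t : ℝ | ∃ f : S → ℝ, (∀ s, 0 ≤ f s) ∧ (∑ r : S, ν r * f r ^ 2) ≤ 1 ∧
    t = Real.sqrt (∑ r : S, ν r * (∑ s : S, κ r s * f s * ν s) ^ 2) } := by
  refine ⟨Real.sqrt (∑ r : S, ν r * (kv κ (fun s => 1 + ν s) r) ^ 2), ?_⟩
  rintro t ⟨f, hf, h1, rfl⟩
  apply Real.sqrt_le_sqrt
  refine Finset.sum_le_sum fun r _ => ?_
  rw [sig_eq]
  apply mul_le_mul_of_nonneg_left _ (hν r)
  apply pow_le_pow_left₀ (kv_nonneg hκ0 (fun s => mul_nonneg (hν s) (hf s)) r)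
  apply kv_mono hκ0
  intro s
  have h2 : ν s * f s ^ 2 ≤ 1 := (Finset.single_le_sum (f := fun r => ν r * f r ^ 2)
    (fun i _ => mul_nonneg (hν i) (sq_nonneg _)) (Finset.mem_univ s)).trans h1
  have h3 : 0 ≤ ν s * (f s - 1) ^ 2 := mul_nonneg (hν s) (sq_nonneg _)
  have := mul_nonneg (hν s) (hf s)
  nlinarith

lemma sig_bound (hκ0 : ∀ r s, 0 ≤ κ r s) {ν : S → ℝ} (hν : ∀ s, 0 ≤ ν s) {g : S → ℝ}
    (hg : ∀ s, 0 ≤ g s) :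
    ∑ r, ν r * (kv κ (fun s => ν s * g s) r) ^ 2 ≤ sigmaOp κ ν ^ 2 * ∑ r, ν r * g r ^ 2 := by
  have hN : 0 ≤ ∑ r, ν r * g r ^ 2 := Finset.sum_nonneg fun i _ => mul_nonneg (hν i) (sq_nonneg _)
  rcases hN.eq_or_lt with h | h
  · rw [← h]
    have h0 : ∀ s, ν s * g s = 0 := by
      intro s
      have := (Finset.sum_eq_zero_iff_of_nonneg
        (fun i _ => mul_nonneg (hν i) (sq_nonneg (g i)))).1 h.symm s (Finset.mem_univ s)
      simpa using this
    simp [h0, kv]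
  · set N := ∑ r, ν r * g r ^ 2
    have hsN : 0 < √N := Real.sqrt_pos.2 h
    have hmem : √(∑ r : S, ν r * (∑ s : S, κ r s * ((√N)⁻¹ * g s) * ν s) ^ 2) ≤ sigmaOp κ ν := by
      refine le_csSup (sig_bdd hκ0 hν) ⟨fun s => (√N)⁻¹ * g s, fun s => mul_nonneg (by positivity) (hg s), ?_, rfl⟩
      have : ∑ r, ν r * ((√N)⁻¹ * g r) ^ 2 = (√N ^ 2)⁻¹ * N := by
        simp only [N, Finset.mul_sum]
        exact Finset.sum_congr rfl fun _ _ => by ring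
      rw [this, Real.sq_sqrt hN, inv_mul_cancel₀ h.ne']
    have e : ∑ r : S, ν r * (∑ s : S, κ r s * ((√N)⁻¹ * g s) * ν s) ^ 2
        = N⁻¹ * ∑ r, ν r * (kv κ (fun s => ν s * g s) r) ^ 2 := by
      rw [Finset.mul_sum]
      refine Finset.sum_congr rfl fun r _ => ?_
      have : (∑ s : S, κ r s * ((√N)⁻¹ * g s) * ν s) = (√N)⁻¹ * kv κ (fun s => ν s * g s) r := by
        simp only [kv, Finset.mul_sum]
        exact Finset.sum_congr rfl fun _ _ => by ring
      rw [this, mul_pow, inv_pow, Real.sq_sqrt hN]; ring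
    rw [e] at hmem
    have h2 := Real.sqrt_le_left (Real.sqrt_nonneg _ |>.trans hmem) |>.1 hmem
    rw [inv_mul_le_iff₀ h] at h2
    linarith

lemma sig_nonneg (ν : S → ℝ) : 0 ≤ sigmaOp κ ν := by
  apply Real.sSup_nonneg
  rintro t ⟨f, -, -, rfl⟩
  exact Real.sqrt_nonneg _

lemma form_of_sig (hκ0 : ∀ r s, 0 ≤ κ r s) {ν : S → ℝ} (hν : ∀ s, 0 ≤ ν s)
    (h1 : sigmaOp κ ν ≤ 1) {h : S → ℝ} (hh : ∀ s, 0 ≤ h s) (h0 : ∀ s, ν s = 0 → h s = 0) :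
    bil κ h h ≤ ∑ r, h r ^ 2 / ν r := by
  have hb := sig_bound hκ0 hν (g := fun s => h s / ν s) (fun s => div_nonneg (hh s) (hν s))
  have e : ∀ s, ν s * (h s / ν s) = h s := by
    intro s
    by_cases hs : ν s = 0
    · simp [hs, h0 s hs]
    · field_simp
  have e2 : ∀ s, ν s * (h s / ν s) ^ 2 = h s ^ 2 / ν s := by
    intro s
    rw [pow_two, ← mul_assoc, e]; ring
  simp only [e, e2] at hb
  have hN : 0 ≤ ∑ r, h r ^ 2 / ν r := Finset.sum_nonneg fun i _ => div_nonneg (sq_nonneg _) (hν i)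
  have hs2 : sigmaOp κ ν ^ 2 ≤ 1 := pow_le_one₀ (sig_nonneg ν) h1
  have hb2 : ∑ r, ν r * kv κ h r ^ 2 ≤ ∑ r, h r ^ 2 / ν r := hb.trans (by nlinarith)
  have : 2 * bil κ h h ≤ ∑ r, h r ^ 2 / ν r + ∑ r, ν r * kv κ h r ^ 2 := by
    rw [bil, Finset.mul_sum, ← Finset.sum_add_distrib]
    refine Finset.sum_le_sum fun r _ => ?_
    have h3 := mul_nonneg (hν r) (sq_nonneg (h r / ν r - kv κ h r))
    have : ν r * (h r / ν r - kv κ h r)^2 = ν r * (h r / ν r)^2 - 2 * (ν r * (h r / ν r)) * kv κ h r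
      + ν r * kv κ h r ^ 2 := by ring
    rw [this, e, e2] at h3
    linarith
  linarith

lemma sig_of_form (hs : ∀ r s, κ r s = κ s r) (hκ0 : ∀ r s, 0 ≤ κ r s) {ν : S → ℝ}
    (hν : ∀ s, 0 ≤ ν s)
    (hf : ∀ g : S → ℝ, (∀ s, 0 ≤ g s) → bil κ (fun s => ν s * g s) (fun s => ν s * g s)
      ≤ ∑ r, ν r * g r ^ 2) : sigmaOp κ ν ≤ 1 := by
  refine csSup_le ⟨_, ⟨fun _ => 0, fun _ => le_rfl, by simp, rfl⟩⟩ ?_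
  rintro t ⟨f, hf0, hf1, rfl⟩
  rw [Real.sqrt_le_one]
  simp only [sig_eq]
  set G := kv κ (fun s => ν s * f s) with hG
  have hG0 : ∀ s, 0 ≤ G s := kv_nonneg hκ0 fun s => mul_nonneg (hν s) (hf0 s)
  have k1 := hf (fun s => f s + G s) (fun s => add_nonneg (hf0 s) (hG0 s))
  have k2 := hf (fun s => |f s - G s|) (fun s => abs_nonneg _)
  have k3 := bil_abs hκ0 (fun s => ν s * (f s - G s))
  have e3 : (fun s => |ν s * (f s - G s)|) = fun s => ν s * |f s - G s| := by
    funext s; rw [abs_mul, abs_of_nonneg (hν s)]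
  rw [e3] at k3
  have x1 := bil_expand hs (fun s => ν s * f s) (fun s => ν s * G s) 1
  have x2 := bil_expand hs (fun s => ν s * f s) (fun s => ν s * G s) (-1)
  have e1 : (fun s => ν s * f s + 1 * (ν s * G s)) = fun s => ν s * (f s + G s) := by
    funext s; ring
  have e2 : (fun s => ν s * f s + (-1) * (ν s * G s)) = fun s => ν s * (f s - G s) := by
    funext s; ring
  rw [e1] at x1
  rw [e2] at x2
  have x3 : bil κ (fun s => ν s * f s) (fun s => ν s * G s) = ∑ r, ν r * G r ^ 2 := by
    rw [bil_comm hs]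
    exact Finset.sum_congr rfl fun r _ => by rw [← hG]; ring
  have x4 : ∑ r, ν r * (f r + G r) ^ 2 + ∑ r, ν r * |f r - G r| ^ 2
      = 2 * ∑ r, ν r * f r ^ 2 + 2 * ∑ r, ν r * G r ^ 2 := by
    simp only [Finset.mul_sum, ← Finset.sum_add_distrib, sq_abs]
    exact Finset.sum_congr rfl fun _ _ => by ring
  linarith

lemma super_eig [Nonempty S] (hs : ∀ r s, κ r s = κ s r) (hκ0 : ∀ r s, 0 ≤ κ r s) {ν : S → ℝ}
    (hν : ∀ s, 0 ≤ ν s) (h1 : 1 < sigmaOp κ ν) :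
    ∃ v : S → ℝ, ∃ l : ℝ, (∀ s, 0 ≤ v s) ∧ 1 < l ∧ (∃ s, 0 < v s) ∧
      ∀ r, l * v r ≤ ν r * kv κ v r := by
  have h2 : ∃ g : S → ℝ, (∀ s, 0 ≤ g s) ∧
      ∑ r, ν r * g r ^ 2 < bil κ (fun s => ν s * g s) (fun s => ν s * g s) := by
    by_contra hcon
    push Not at hcon
    exact absurd (sig_of_form hs hκ0 hν hcon) (not_le.2 h1)
  obtain ⟨g0, hg0, hlt⟩ := h2
  set u : S → ℝ := fun s => √(ν s) with hu
  have hu0 : ∀ s, 0 ≤ u s := fun s => Real.sqrt_nonneg _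
  have huu : ∀ s, u s * u s = ν s := fun s => Real.mul_self_sqrt (hν s)
  let q : (S → ℝ) → ℝ := fun g => bil κ (fun s => u s * g s) (fun s => u s * g s)
  let C : Set (S → ℝ) := {g | (∀ s, 0 ≤ g s) ∧ ∑ s, g s ^ 2 = 1}
  have hCc : IsCompact C := by
    apply (isCompact_Icc (a := (0 : S → ℝ)) (b := 1)).of_isClosed_subset
    · have : C = (⋂ s, {g : S → ℝ | 0 ≤ g s}) ∩ {g | ∑ s, g s ^ 2 = 1} := by
        ext g; simp [C]
      rw [this]
      apply IsClosed.inter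
      · exact isClosed_iInter fun s => isClosed_le continuous_const (continuous_apply s)
      · exact isClosed_eq (by fun_prop) continuous_const
    · rintro g ⟨hg, hg1⟩
      refine ⟨hg, fun s => ?_⟩
      have : g s ^ 2 ≤ 1 := hg1 ▸ Finset.single_le_sum (f := fun r => g r ^ 2)
        (fun i _ => sq_nonneg _) (Finset.mem_univ s)
      exact (sq_le_one_iff₀ (hg s)).1 this
  have hqc : Continuous q := by
    simp only [q, bil, kv]; fun_prop
  have hne : C.Nonempty := by
    obtain ⟨r⟩ := ‹Nonempty S›
    refine ⟨Pi.single r 1, fun s => ?_, ?_⟩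
    · by_cases h : s = r
      · subst h; simp
      · simp [h]
    · rw [Finset.sum_eq_single r] <;> simp +contextual
  obtain ⟨g, ⟨hg, hg1⟩, hmax⟩ := hCc.exists_isMaxOn hne hqc.continuousOn
  set l := q g with hl
  have hq : ∀ f : S → ℝ, (∀ s, 0 ≤ f s) → q f ≤ l * ∑ s, f s ^ 2 := by
    intro f hf
    have hN : 0 ≤ ∑ s, f s ^ 2 := Finset.sum_nonneg fun i _ => sq_nonneg _
    rcases hN.eq_or_lt with h | h
    · have h0 : ∀ s, f s = 0 := by
        intro s
        have := (Finset.sum_eq_zero_iff_of_nonneg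
          (fun i _ => sq_nonneg (f i))).1 h.symm s (Finset.mem_univ s)
        simpa using this
      simp [q, bil, h0]
    · set N := ∑ s, f s ^ 2
      have hsN : 0 < √N := Real.sqrt_pos.2 h
      have hmem : (fun s => (√N)⁻¹ * f s) ∈ C := by
        refine ⟨fun s => mul_nonneg (by positivity) (hf s), ?_⟩
        simp only [mul_pow, ← Finset.mul_sum, inv_pow]
        rw [Real.sq_sqrt hN, inv_mul_cancel₀ h.ne']
      have h3 : q (fun s => (√N)⁻¹ * f s) ≤ l := hmax hmem
      have e : q (fun s => (√N)⁻¹ * f s) = N⁻¹ * q f := by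
        have : N⁻¹ = (√N)⁻¹ * (√N)⁻¹ := by rw [← mul_inv, Real.mul_self_sqrt hN]
        rw [this]
        simp only [q, bil, kv, Finset.mul_sum]
        exact Finset.sum_congr rfl fun _ _ => Finset.sum_congr rfl fun _ _ => by ring
      rw [e, inv_mul_le_iff₀ h] at h3
      linarith
  have hl1 : 1 < l := by
    have h3 := hq (fun s => u s * g0 s) (fun s => mul_nonneg (hu0 s) (hg0 s))
    have e1 : q (fun s => u s * g0 s) = bil κ (fun s => ν s * g0 s) (fun s => ν s * g0 s) := by
      simp only [q, ← mul_assoc, huu]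
    have e2 : ∑ s, (u s * g0 s) ^ 2 = ∑ s, ν s * g0 s ^ 2 :=
      Finset.sum_congr rfl fun s _ => by rw [← huu]; ring
    rw [e1, e2] at h3
    have hN : 0 ≤ ∑ s, ν s * g0 s ^ 2 :=
      Finset.sum_nonneg fun i _ => mul_nonneg (hν i) (sq_nonneg _)
    by_contra hcon
    push Not at hcon
    nlinarith
  have hMg : ∀ r, l * g r ≤ u r * kv κ (fun s => u s * g s) r := by
    intro r
    by_contra hcon
    push Not at hcon
    have hA0 : 0 ≤ u r * kv κ (fun s => u s * g s) r :=
      mul_nonneg (hu0 r) (kv_nonneg hκ0 (fun s => mul_nonneg (hu0 s) (hg s)) r)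
    have hgr : 0 < g r := by
      by_contra h
      have : g r = 0 := le_antisymm (not_lt.1 h) (hg r)
      rw [this] at hcon; linarith
    set A := u r * kv κ (fun s => u s * g s) r
    let d : S → ℝ := Pi.single r 1
    have hd0 : ∀ s, s ≠ r → d s = 0 := fun s h => by simp [d, h]
    have hdr : d r = 1 := by simp [d]
    let τ := min (g r) ((l * g r - A) / l)
    have hτ0 : 0 < τ := lt_min hgr (div_pos (by linarith) (by linarith))
    have hτ1 : τ ≤ g r := min_le_left _ _
    have hτ2 : τ * l ≤ l * g r - A := by
      rw [← le_div_iff₀ (by linarith)]; exact min_le_right _ _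
    have h3 := hq (fun s => g s + (-τ) * d s) (fun s => by
      by_cases h : s = r
      · subst h; rw [hdr]; linarith
      · rw [hd0 s h]; simpa using hg s)
    have e1 : q (fun s => g s + (-τ) * d s)
        = l + 2 * (-τ) * bil κ (fun s => u s * g s) (fun s => u s * d s)
          + (-τ)^2 * bil κ (fun s => u s * d s) (fun s => u s * d s) := by
      rw [hl]
      simp only [q]
      rw [← bil_expand hs]
      congr 1 <;> (funext s; ring)
    have e2 : bil κ (fun s => u s * g s) (fun s => u s * d s) = A := by
      rw [bil_comm hs, bil, Finset.sum_eq_single r]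
      · rw [hdr]; simp [A]
      · intro s _ h; simp [hd0 s h]
      · simp
    have e3 : 0 ≤ bil κ (fun s => u s * d s) (fun s => u s * d s) := by
      have : ∀ s, 0 ≤ u s * d s := fun s => mul_nonneg (hu0 s) (by
        by_cases h : s = r
        · subst h; rw [hdr]; linarith
        · rw [hd0 s h])
      exact bil_nonneg hκ0 this this
    have e4 : ∑ s, (g s + (-τ) * d s) ^ 2 = 1 + 2 * (-τ) * g r + τ ^ 2 := by
      have : ∀ s, (g s + (-τ) * d s) ^ 2 = g s ^ 2 + (2 * (-τ) * g s * d s + τ ^ 2 * d s ^ 2) :=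
        fun s => by ring
      simp only [this]
      rw [Finset.sum_add_distrib, hg1, Finset.sum_eq_single r]
      · rw [hdr]; ring
      · intro s _ h; simp [hd0 s h]
      · simp
    rw [e1, e2, e4] at h3
    have h4 := mul_nonneg (sq_nonneg (-τ)) e3
    have h5 : τ * (2 * (l * g r - A) - τ * l) ≤ 0 := by nlinarith
    have h6 : 0 < 2 * (l * g r - A) - τ * l := by linarith
    have := mul_pos hτ0 h6
    linarith
  refine ⟨fun s => u s * g s, l, fun s => mul_nonneg (hu0 s) (hg s), hl1, ?_, ?_⟩
  · by_contra hcon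
    push Not at hcon
    have h0 : ∀ s, u s * g s = 0 := fun s => le_antisymm (hcon s) (mul_nonneg (hu0 s) (hg s))
    have : l = 0 := by simp [hl, q, h0, bil]
    linarith
  · intro r
    have := mul_le_mul_of_nonneg_left (hMg r) (hu0 r)
    rw [← huu r]
    linarith

lemma exists_eps (x : S → ℝ) (hx : ∀ s, 0 ≤ x s) (d : ℝ) (hd : 0 < d) :
    ∃ ε : ℝ, 0 < ε ∧ ∀ s, ε * x s ≤ d := by
  have hN : 0 ≤ ∑ s, x s := Finset.sum_nonneg fun i _ => hx i
  refine ⟨d / (1 + ∑ s, x s), by positivity, fun s => ?_⟩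
  have : x s ≤ ∑ s, x s := Finset.single_le_sum (fun i _ => hx i) (Finset.mem_univ s)
  rw [div_mul_eq_mul_div, div_le_iff₀ (by positivity)]
  exact mul_le_mul_of_nonneg_left (by linarith) hd.le

lemma exists_max_s18 (hκ0 : ∀ r s, 0 ≤ κ r s) {c : S → ℝ} (hc : ∀ s, 0 ≤ c s) :
    ∃ W : S → ℝ, (∀ r, 0 ≤ W r) ∧ (∀ r, W r ≤ c r) ∧ (∀ r, W r = (c r - W r) * kv κ W r) ∧
      ∀ w : S → ℝ, (∀ r, 0 ≤ w r) → (∀ r, w r ≤ (c r - w r) * kv κ w r) → ∀ r, w r ≤ W r := by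
  let P : Set (S → ℝ) := {w | (∀ r, 0 ≤ w r) ∧ ∀ r, w r ≤ (c r - w r) * kv κ w r}
  have hPc : ∀ w ∈ P, ∀ r, w r ≤ c r := by
    rintro w ⟨h0, h1⟩ r
    by_contra hcon
    push Not at hcon
    have := mul_nonneg (sub_nonneg.2 hcon.le) (kv_nonneg hκ0 h0 r)
    have := h1 r
    have := hc r
    nlinarith
  have h0P : (0 : S → ℝ) ∈ P := by
    refine ⟨fun _ => le_rfl, fun r => ?_⟩
    simp [kv]
  let W : S → ℝ := fun r => sSup ((fun w : S → ℝ => w r) '' P)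
  have hle : ∀ w ∈ P, ∀ r, w r ≤ W r := by
    intro w hw r
    refine le_csSup (s := (fun w : S → ℝ => w r) '' P) ?_ ⟨w, hw, rfl⟩
    refine ⟨c r, ?_⟩
    rintro _ ⟨w, hw, rfl⟩
    exact hPc w hw r
  have hlub : ∀ r z, (∀ w ∈ P, w r ≤ z) → W r ≤ z := by
    intro r z h
    refine csSup_le (s := (fun w : S → ℝ => w r) '' P) ⟨_, 0, h0P, rfl⟩ ?_
    rintro _ ⟨w, hw, rfl⟩
    exact h w hw
  have hW0 : ∀ r, 0 ≤ W r := fun r => hle 0 h0P r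
  have hk : ∀ r, 0 ≤ kv κ W r := kv_nonneg hκ0 hW0
  let V : S → ℝ := fun r => c r * kv κ W r / (1 + kv κ W r)
  have hWV : ∀ r, W r ≤ V r := by
    intro r
    apply hlub
    intro w hw
    have h1 := hw.2 r
    have h2 := mul_le_mul_of_nonneg_left (kv_mono hκ0 (hle w hw) r) (sub_nonneg.2 (hPc w hw r))
    have := hk r
    rw [le_div_iff₀ (by linarith)]
    nlinarith
  have hVeq : ∀ r, V r = (c r - V r) * kv κ W r := by
    intro r
    have := hk r
    have : 1 + kv κ W r ≠ 0 := by linarith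
    simp only [V]
    field_simp
    ring
  have hVc : ∀ r, V r ≤ c r := by
    intro r
    have := hk r
    rw [div_le_iff₀ (by linarith)]
    nlinarith [hc r]
  have hVP : V ∈ P := by
    refine ⟨fun r => (hW0 r).trans (hWV r), fun r => ?_⟩
    calc V r = (c r - V r) * kv κ W r := hVeq r
      _ ≤ _ := mul_le_mul_of_nonneg_left (kv_mono hκ0 hWV r) (sub_nonneg.2 (hVc r))
  have hVW : V = W := funext fun r => le_antisymm (hle V hVP r) (hWV r)
  rw [hVW] at hVeq hVc
  exact ⟨W, hW0, hVc, hVeq, fun w h1 h2 => hle w ⟨h1, h2⟩⟩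

lemma max_pos [Nonempty S] (hs : ∀ r s, κ r s = κ s r) (hκ0 : ∀ r s, 0 ≤ κ r s)
    {c : S → ℝ} (hc : ∀ s, 0 ≤ c s) (h1 : 1 < sigmaOp κ c) {W : S → ℝ}
    (hmax : ∀ w : S → ℝ, (∀ r, 0 ≤ w r) → (∀ r, w r ≤ (c r - w r) * kv κ w r) → ∀ r, w r ≤ W r) :
    ∃ r, 0 < W r := by
  obtain ⟨v, l, hv, hl, ⟨s, hvs⟩, hvl⟩ := super_eig hs hκ0 hc h1
  obtain ⟨ε, hε, hεk⟩ := exists_eps (kv κ v) (kv_nonneg hκ0 hv) (l - 1) (by linarith)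
  refine ⟨s, lt_of_lt_of_le (mul_pos hε hvs) (hmax (fun s => ε * v s)
    (fun r => mul_nonneg hε.le (hv r)) (fun r => ?_) s)⟩
  rw [kv_smul]
  have h2 := mul_le_mul_of_nonneg_left (hεk r) (hv r)
  have h3 := mul_le_mul_of_nonneg_left (hvl r) hε.le
  have h4 := mul_le_mul_of_nonneg_left h2 hε.le
  nlinarith

lemma max_sub [Nonempty S] (hs : ∀ r s, κ r s = κ s r) (hκ0 : ∀ r s, 0 ≤ κ r s)
    {c : S → ℝ} {W : S → ℝ}
    (hW0 : ∀ r, 0 ≤ W r) (hWc : ∀ r, W r ≤ c r) (hWe : ∀ r, W r = (c r - W r) * kv κ W r)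
    (hmax : ∀ w : S → ℝ, (∀ r, 0 ≤ w r) → (∀ r, w r ≤ (c r - w r) * kv κ w r) → ∀ r, w r ≤ W r) :
    sigmaOp κ (fun r => c r - W r) ≤ 1 := by
  by_contra hcon
  push Not at hcon
  obtain ⟨v, l, hv, hl, ⟨s0, hvs⟩, hvl⟩ :=
    super_eig hs hκ0 (fun s => sub_nonneg.2 (hWc s)) hcon
  have hkW := kv_nonneg hκ0 hW0
  have hkv := kv_nonneg hκ0 hv
  by_cases hZ : ∃ r, W r = 0 ∧ 0 < v r
  · obtain ⟨r0, hr0, hvr0⟩ := hZ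
    let v' : S → ℝ := fun r => if W r = 0 then v r else 0
    have hv' : ∀ r, 0 ≤ v' r := fun r => by simp only [v']; split_ifs; exacts [hv r, le_rfl]
    have hkv' := kv_nonneg hκ0 hv'
    obtain ⟨ε, hε, hεk⟩ := exists_eps (kv κ v') hkv' (l - 1) (by linarith)
    have key := hmax (fun s => W s + ε * v' s)
      (fun r => add_nonneg (hW0 r) (mul_nonneg hε.le (hv' r))) (fun r => by
        rw [kv_add]
        by_cases hr : W r = 0
        · have hvr : v' r = v r := by simp [v', hr]
          rw [hvr, hr]
          rcases (hv r).eq_or_lt with h | h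
          · rw [← h]
            have hcr : 0 ≤ c r := (hW0 r).trans (hWc r)
            have := mul_nonneg hcr (add_nonneg (hkW r) (mul_nonneg hε.le (hkv' r)))
            simpa using this
          · have hvlr := hvl r
            rw [hr, sub_zero] at hvlr
            have hcr : c r ≠ 0 := by
              intro h0
              rw [h0] at hvlr
              nlinarith
            have hk0 : kv κ W r = 0 := by
              have := hWe r
              rw [hr, sub_zero] at this
              exact (mul_eq_zero.1 this.symm).resolve_left hcr
            have hkk : kv κ v' r = kv κ v r := by
              refine Finset.sum_congr rfl fun s _ => ?_
              have h5 := (Finset.sum_eq_zero_iff_of_nonneg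
                (fun s _ => mul_nonneg (hκ0 r s) (hW0 s))).1 hk0 s (Finset.mem_univ s)
              by_cases hws : W s = 0
              · simp [v', hws]
              · have : κ r s = 0 := (mul_eq_zero.1 h5).resolve_right hws
                simp [this]
            have h6 := hεk r
            rw [hkk] at h6 ⊢
            rw [hk0]
            have h2 := mul_le_mul_of_nonneg_left h6 (hv r)
            have h3 := mul_le_mul_of_nonneg_left hvlr hε.le
            have h4 := mul_le_mul_of_nonneg_left h2 hε.le
            nlinarith
        · have hvr : v' r = 0 := by simp [v', hr]
          rw [hvr]
          have h1 := hWe r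
          have h2 := mul_nonneg (sub_nonneg.2 (hWc r)) (mul_nonneg hε.le (hkv' r))
          simp only [mul_zero, add_zero]
          rw [mul_add, ← h1]; linarith) r0
    simp only [v', hr0, if_true] at key
    have := mul_pos hε hvr0
    linarith
  · push Not at hZ
    have e := bil_comm hs W v
    have hpt : ∀ r, l * (v r * kv κ W r) ≤ W r * kv κ v r := by
      intro r
      have h1 := hWe r
      have h2 := mul_le_mul_of_nonneg_left (hvl r) (hkW r)
      have h3 : kv κ W r * ((c r - W r) * kv κ v r) = W r * kv κ v r := by
        conv_rhs => rw [h1]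
        ring
      linarith
    have hsum : l * bil κ v W ≤ bil κ W v := by
      rw [bil, bil, Finset.mul_sum]
      exact Finset.sum_le_sum fun r _ => hpt r
    have hpos : 0 < bil κ v W := by
      have hWs : 0 < W s0 := by
        rcases (hW0 s0).eq_or_lt with h | h
        · exact absurd hvs (not_lt.2 (hZ s0 h.symm))
        · exact h
      have hks : 0 < kv κ W s0 := by
        rcases (hkW s0).eq_or_lt with h | h
        · have := hWe s0
          rw [← h] at this
          simp only [mul_zero] at this; linarith
        · exact h
      exact lt_of_lt_of_le (mul_pos hvs hks) (Finset.single_le_sum (f := fun r => v r * kv κ W r)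
        (fun i _ => mul_nonneg (hv i) (hkW i)) (Finset.mem_univ s0))
    rw [e] at hsum
    nlinarith

lemma one_le_sig_max (hκ0 : ∀ r s, 0 ≤ κ r s)
    {c : S → ℝ} {W : S → ℝ}
    (hW0 : ∀ r, 0 ≤ W r) (hWc : ∀ r, W r ≤ c r) (hWe : ∀ r, W r = (c r - W r) * kv κ W r)
    (hpos : ∃ r, 0 < W r) : 1 ≤ sigmaOp κ (fun r => c r - W r) := by
  have hkW := kv_nonneg hκ0 hW0
  have h := sig_bound hκ0 (fun s => sub_nonneg.2 (hWc s)) hkW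
  have e : (fun s => (c s - W s) * kv κ W s) = W := funext fun s => (hWe s).symm
  rw [e] at h
  have hN : 0 < ∑ r, (c r - W r) * kv κ W r ^ 2 := by
    obtain ⟨r, hr⟩ := hpos
    refine Finset.sum_pos' (fun i _ => mul_nonneg (sub_nonneg.2 (hWc i)) (sq_nonneg _))
      ⟨r, Finset.mem_univ r, ?_⟩
    have h1 := hWe r
    have h2 : 0 < kv κ W r := by
      rcases (hkW r).eq_or_lt with h | h
      · rw [← h] at h1
        simp only [mul_zero] at h1; linarith
      · exact h
    have : (c r - W r) * kv κ W r ^ 2 = W r * kv κ W r := by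
      conv_rhs => rw [h1]
      ring
    rw [this]; positivity
  have h0 := sig_nonneg (κ := κ) (fun r => c r - W r)
  by_contra hcon
  push Not at hcon
  have : sigmaOp κ (fun r => c r - W r) ^ 2 < 1 := pow_lt_one₀ h0 hcon (by norm_num)
  nlinarith

lemma ent_lower {x y a m : ℝ} (hx : 0 ≤ x) (hm : 0 < m) (ha : 0 ≤ a) (hy : 0 ≤ y)
    (hxa : a = 0 → x = 0) :
    ((x * Real.log (a / m) + x - a * y : ℝ) : EReal) ≤ entTerm x (y * m) := by
  unfold entTerm
  split_ifs with h1 h2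
  · subst h1
    have := mul_nonneg ha hy
    exact_mod_cast (by simpa using this)
  · exact le_top
  · have hx' : 0 < x := lt_of_le_of_ne hx (Ne.symm h1)
    have hy' : 0 < y := by
      by_contra h
      have : y = 0 := le_antisymm (not_lt.1 h) hy
      simp [this] at h2
    have ha' : 0 < a := lt_of_le_of_ne ha (fun h => h1 (hxa h.symm))
    rw [EReal.coe_le_coe_iff]
    have h3 := Real.log_le_sub_one_of_pos (show 0 < a * y / x by positivity)
    have h4 : Real.log (x / (y * m)) = Real.log (a / m) - Real.log (a * y / x) := by
      rw [Real.log_div hx'.ne' (by positivity), Real.log_div ha'.ne' hm.ne',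
        Real.log_div (by positivity) hx'.ne', Real.log_mul hy'.ne' hm.ne',
        Real.log_mul ha'.ne' hy'.ne']
      ring
    have h5 := mul_le_mul_of_nonneg_left h3 hx
    have h6 : x * (a * y / x - 1) = a * y - x := by field_simp
    rw [h4]; linarith

lemma ent_eq {x y a m : ℝ} (hx : 0 ≤ x) (hm : 0 < m) (ha : 0 ≤ a) (hy : 0 ≤ y)
    (hxy : x = a * y) :
    entTerm x (y * m) = ((x * Real.log (a / m) + x - a * y : ℝ) : EReal) := by
  unfold entTerm
  split_ifs with h1 h2
  · rw [← hxy, h1]; simp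
  · exfalso
    have hx' : 0 < x := lt_of_le_of_ne hx (Ne.symm h1)
    have hy' : 0 < y := lt_of_le_of_ne hy (fun h => by simp [← h] at hxy; exact h1 hxy)
    have := mul_pos hy' hm
    linarith
  · have hx' : 0 < x := lt_of_le_of_ne hx (Ne.symm h1)
    have hy' : 0 < y := lt_of_le_of_ne hy (fun h => by simp [← h] at hxy; exact h1 hxy)
    rw [EReal.coe_eq_coe_iff]
    have : x / (y * m) = a / m := by rw [hxy]; field_simp
    rw [this, ← hxy]; ring

lemma coe_sum' (f : S → ℝ) : ((∑ r, f r : ℝ) : EReal) = ∑ r, (f r : EReal) :=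
  map_sum (⟨⟨Real.toEReal, EReal.coe_zero⟩, EReal.coe_add⟩ : ℝ →+ EReal) f Finset.univ

lemma core_min (hs : ∀ r s, κ r s = κ s r) (hκ0 : ∀ r s, 0 ≤ κ r s) {μ c a b : S → ℝ}
    (hμ0 : ∀ r, 0 < μ r) (ha : IsFPSol κ c a) (ha1 : sigmaOp κ a ≤ 1)
    (hb0 : ∀ r, 0 ≤ b r) (hbc : ∀ r, b r ≤ c r) (hb1 : sigmaOp κ b ≤ 1) :
    Gc κ μ c a ≤ Gc κ μ c b ∧ (Gc κ μ c b = Gc κ μ c a → b = a) := by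
  obtain ⟨ha0, hac, hae⟩ := ha
  have hca : ∀ r, a r = 0 → c r = 0 := by
    intro r h
    have := hae r
    rw [h] at this
    linarith
  have hba : ∀ r, a r = 0 → b r = 0 := fun r h =>
    le_antisymm ((hbc r).trans (hca r h).le) (hb0 r)
  let L : (S → ℝ) → ℝ := fun b => (∑ r : S, b r * Real.log (b r / μ r))
      - (1/2) * ∑ r : S, ∑ s : S, b r * κ r s * b s
      + (1/2) * ∑ r : S, ∑ s : S, c r * κ r s * μ s
      + ∑ r, ((c r - b r) * Real.log (a r / μ r) + (c r - b r)
        - a r * kv κ (fun s => c s - b s) r)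
  have hGa : Gc κ μ c a = (L a : EReal) := by
    simp only [L]
    rw [EReal.coe_add, coe_sum']
    unfold Gc
    congr 1
    refine Finset.sum_congr rfl fun r _ => ?_
    exact ent_eq (sub_nonneg.2 (hac r)) (hμ0 r) (ha0 r)
      (kv_nonneg hκ0 (fun s => sub_nonneg.2 (hac s)) r) (by rw [mul_comm]; exact (hae r).symm)
  have hGb : (L b : EReal) ≤ Gc κ μ c b := by
    simp only [L]
    rw [EReal.coe_add, coe_sum']
    unfold Gc
    refine add_le_add le_rfl (Finset.sum_le_sum fun r _ => ?_)
    exact ent_lower (sub_nonneg.2 (hbc r)) (hμ0 r) (ha0 r)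
      (kv_nonneg hκ0 (fun s => sub_nonneg.2 (hbc s)) r) (fun h => by
        rw [hca r h, hba r h]; simp)
  -- the difference
  let D : S → ℝ := fun r =>
    b r * Real.log (b r / μ r) - b r * Real.log (a r / μ r) - b r + a r
  have hquad : ∀ x : S → ℝ, ∑ r : S, ∑ s : S, x r * κ r s * x s = bil κ x x := by
    intro x
    simp only [bil, kv, Finset.mul_sum, mul_assoc]
  have hdiff : L b - L a = ∑ r, D r
      - (1/2) * bil κ (fun s => b s + (-1) * a s) (fun s => b s + (-1) * a s) := by
    rw [bil_expand hs]
    simp only [L, hquad]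
    have k : ∀ r, kv κ (fun s => c s - a s) r = kv κ (fun s => c s - b s) r + kv κ b r - kv κ a r := by
      intro r
      simp only [kv, ← Finset.sum_add_distrib, ← Finset.sum_sub_distrib]
      exact Finset.sum_congr rfl fun _ _ => by ring
    have e1 : ∑ r, D r = ∑ r, b r * Real.log (b r / μ r)
        + ∑ r, ((c r - b r) * Real.log (a r / μ r) + (c r - b r)
          - a r * kv κ (fun s => c s - b s) r)
        - ∑ r, a r * Real.log (a r / μ r)
        - ∑ r, ((c r - a r) * Real.log (a r / μ r) + (c r - a r)
          - a r * kv κ (fun s => c s - a s) r) - bil κ a b + bil κ a a := by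
      simp only [bil, k, ← Finset.sum_add_distrib, ← Finset.sum_sub_distrib, D]
      exact Finset.sum_congr rfl fun _ _ => by ring
    rw [e1, bil_comm hs b a]
    ring
  have hbil : bil κ (fun s => b s + (-1) * a s) (fun s => b s + (-1) * a s)
      ≤ ∑ r, (b r - a r) ^ 2 / (max b a) r := by
    let p : S → ℝ := fun r => max (b r - a r) 0
    let n : S → ℝ := fun r => max (a r - b r) 0
    have hp : ∀ r, 0 ≤ p r := fun r => le_max_right _ _
    have hn : ∀ r, 0 ≤ n r := fun r => le_max_right _ _
    have e : (fun s => b s + (-1) * a s) = fun s => p s + (-1) * n s := by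
      funext s
      simp only [p, n]
      rcases le_total (b s) (a s) with h | h
      · rw [max_eq_right (by linarith), max_eq_left (by linarith)]; ring
      · rw [max_eq_left (by linarith), max_eq_right (by linarith)]; ring
    rw [e, bil_expand hs]
    have h1 := bil_nonneg hκ0 hp hn
    have h2 := form_of_sig hκ0 hb0 hb1 hp (fun s h => by
      simp only [p]; exact max_eq_right (by linarith [ha0 s]))
    have h3 := form_of_sig hκ0 ha0 ha1 hn (fun s h => by
      simp only [n]; exact max_eq_right (by linarith [hb0 s]))
    have h4 : ∑ r, p r ^ 2 / b r + ∑ r, n r ^ 2 / a r = ∑ r, (b r - a r) ^ 2 / (max b a) r := by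
      rw [← Finset.sum_add_distrib]
      refine Finset.sum_congr rfl fun s _ => ?_
      simp only [p, n, Pi.sup_apply]
      rcases le_total (b s) (a s) with h | h
      · rw [max_eq_right (by linarith), max_eq_left (by linarith), max_eq_right h]; ring
      · rw [max_eq_left (by linarith), max_eq_right (by linarith), max_eq_left h]; ring
    linarith
  have hD : ∑ r, (b r - a r) ^ 2 / (max b a) r / 2 ≤ ∑ r, D r :=
    Finset.sum_le_sum fun r _ => sc4 _ _ _ (ha0 r) (hb0 r) (hba r) (hμ0 r)
  have hhalf : ∑ r, (b r - a r) ^ 2 / (max b a) r / 2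
      = (1/2) * ∑ r, (b r - a r) ^ 2 / (max b a) r := by
    rw [← Finset.sum_div]; ring
  have hle : L a ≤ L b := by linarith
  refine ⟨?_, fun heq => ?_⟩
  · rw [hGa]
    exact (EReal.coe_le_coe_iff.2 hle).trans hGb
  · by_contra hne
    obtain ⟨r, hr⟩ := Function.ne_iff.1 hne
    have hD' : ∑ r, (b r - a r) ^ 2 / (max b a) r / 2 < ∑ r, D r := by
      refine Finset.sum_lt_sum (fun r _ => sc4 _ _ _ (ha0 r) (hb0 r) (hba r) (hμ0 r))
        ⟨r, Finset.mem_univ r, ?_⟩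
      refine sc3 _ _ _ (lt_of_le_of_ne (ha0 r) fun h => hr ?_) (hb0 r) (hμ0 r) hr
      rw [hba r h.symm, h]
    rw [heq, hGa, EReal.coe_le_coe_iff] at hGb
    linarith

end helpers

/-- minimization of `G_c` over subcritical `b ≤ c`. -/
theorem Gc_minimizer
    {S : Type*} [Fintype S] [DecidableEq S] [Nonempty S]
    (κ : S → S → ℝ) (hκsym : ∀ r s, κ r s = κ s r) (hκ0 : ∀ r s, 0 ≤ κ r s)
    (μ : S → ℝ) (hμ0 : ∀ r, 0 < μ r) (hμ1 : (∑ r : S, μ r) = 1)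
    (c : S → ℝ) (hc0 : ∀ r, 0 ≤ c r) (hcμ : ∀ r, c r ≤ μ r) :
    (sigmaOp κ c ≤ 1 →
        ∀ b : S → ℝ, (∀ r, 0 ≤ b r) → (∀ r, b r ≤ c r) → sigmaOp κ b ≤ 1 →
          Gc κ μ c c ≤ Gc κ μ c b ∧ (Gc κ μ c b = Gc κ μ c c → b = c)) ∧
      (1 < sigmaOp κ c →
        ∃ bstar : S → ℝ, IsFPSol κ c bstar ∧
          (∀ b : S → ℝ, IsFPSol κ c b → ∀ r, bstar r ≤ b r) ∧
          bstar ≠ c ∧ sigmaOp κ bstar = 1 ∧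
          ∀ b : S → ℝ, (∀ r, 0 ≤ b r) → (∀ r, b r ≤ c r) → sigmaOp κ b ≤ 1 →
            Gc κ μ c bstar ≤ Gc κ μ c b ∧ (Gc κ μ c b = Gc κ μ c bstar → b = bstar)) := by
  constructor
  · intro h1 b hb0 hbc hb1
    exact core_min hκsym hκ0 hμ0 ⟨hc0, fun _ => le_rfl, fun r => by simp⟩ h1 hb0 hbc hb1
  · intro h1
    obtain ⟨W, hW0, hWc, hWe, hmax⟩ := exists_max_s18 hκ0 hc0
    obtain ⟨r0, hr0⟩ := max_pos hκsym hκ0 hc0 h1 hmax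
    have hsub := max_sub hκsym hκ0 hW0 hWc hWe hmax
    have hfp : IsFPSol κ c (fun r => c r - W r) := by
      refine ⟨fun r => sub_nonneg.2 (hWc r), fun r => by linarith [hW0 r], fun r => ?_⟩
      have := hWe r
      simp only [sub_sub_cancel]
      rw [mul_comm]
      exact this.symm
    refine ⟨fun r => c r - W r, hfp, ?_, ?_, ?_, ?_⟩
    · rintro b ⟨h0, h2, h3⟩ r
      have := hmax (fun r => c r - b r) (fun r => sub_nonneg.2 (h2 r)) (fun r => by
        have := h3 r
        rw [sub_sub_cancel, mul_comm]
        exact this.ge) r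
      linarith
    · intro h
      have := congrFun h r0
      linarith
    · exact le_antisymm hsub (one_le_sig_max hκ0 hW0 hWc hWe ⟨r0, hr0⟩)
    · intro b hb0 hbc hb1
      exact core_min hκsym hκ0 hμ0 hfp hsub hb0 hbc hb1

end
end
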